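/- Let η, m : ℝ → ℝ be functions with η(z) > 0 and m(z) > 0 for all z, η(z) → 0 and m(z) → ∞ as z → ∞. Then for every ε > 0 there exists T₀ such that for every real T ≥ T₀, the number of primes p ≤ T having the following bad property is at most ε·π(T): there exists an integer t such that every integer ξ with t ≤ ξ ≤ t + m(T) and p ∤ ξ satisfies ord_p(ξ) ≤ T^{1/2+η(T)}. -/

import Mathlib

namespace OrderInIntervals

open Finset ArithmeticFunction

/-- Squarefree integers `k ≤ R` coprime to `d`: the support of the Selberg weights. -/
def sieveSupport (d R : ℕ) : Finset ℕ := {k ∈ Icc 1 R | Squarefree k ∧ k.Coprime d}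

lemma mem_sieveSupport {d R k : ℕ} :
    k ∈ sieveSupport d R ↔ (1 ≤ k ∧ k ≤ R) ∧ Squarefree k ∧ k.Coprime d := by
  simp [sieveSupport]

lemma mem_sieveSupport_of_dvd {d R k e : ℕ} (hk : k ∈ sieveSupport d R) (he : e ∣ k) :
    e ∈ sieveSupport d R := by
  rw [mem_sieveSupport] at *
  refine ⟨⟨Nat.pos_of_dvd_of_pos he hk.1.1, (Nat.le_of_dvd hk.1.1 he).trans hk.1.2⟩,
    hk.2.1.squarefree_of_dvd he, Nat.Coprime.of_dvd_left he hk.2.2⟩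

/-- The normalising sum of the Selberg sieve. -/
noncomputable def sieveMass (d R : ℕ) : ℝ := ∑ k ∈ sieveSupport d R, (k.totient : ℝ)⁻¹

/-- The Selberg weights divided by their argument, before normalisation. -/
noncomputable def sieveWeight (d R e : ℕ) : ℝ :=
  (moebius e : ℝ) * ∑ k ∈ sieveSupport d R with e ∣ k, (k.totient : ℝ)⁻¹

lemma sum_moebius_between {k l : ℕ} (hk : Squarefree k) (hl : l ∣ k) :
    ∑ e ∈ k.divisors with l ∣ e, (moebius e : ℝ) = if l = k then (moebius l : ℝ) else 0 := by
  obtain ⟨m, rfl⟩ := hl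
  have hlm := Nat.squarefree_mul_iff.1 hk
  have hl0 : l ≠ 0 := hlm.2.1.ne_zero
  have hm0 : m ≠ 0 := hlm.2.2.ne_zero
  have h1 : ∑ e ∈ (l * m).divisors with l ∣ e, (moebius e : ℝ)
      = ∑ f ∈ m.divisors, (moebius (l * f) : ℝ) := by
    symm
    apply Finset.sum_nbij (fun f => l * f)
    · intro f hf
      simp only [Nat.mem_divisors, mem_filter] at *
      exact ⟨⟨Nat.mul_dvd_mul_left l hf.1, by positivity⟩, dvd_mul_right _ _⟩
    · intro a _ b _ h
      exact Nat.eq_of_mul_eq_mul_left (Nat.pos_of_ne_zero hl0) h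
    · intro e he
      simp only [Nat.mem_divisors, coe_filter, Set.mem_ofPred_eq] at he
      obtain ⟨⟨h2, h3⟩, f, rfl⟩ := he
      refine ⟨f, ?_, rfl⟩
      simp only [Nat.mem_divisors, mem_coe]
      exact ⟨Nat.dvd_of_mul_dvd_mul_left (Nat.pos_of_ne_zero hl0) h2, hm0⟩
    · intros; rfl
  rw [h1]
  have h2 : ∀ f ∈ m.divisors, (moebius (l * f) : ℝ) = moebius l * moebius f := by
    intro f hf
    rw [isMultiplicative_moebius.map_mul_of_coprime
      (Nat.Coprime.of_dvd_right (Nat.dvd_of_mem_divisors hf) hlm.1)]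
    push_cast; rfl
  rw [sum_congr rfl h2, ← mul_sum]
  have h3 : ∑ f ∈ m.divisors, (moebius f : ℝ) = if m = 1 then 1 else 0 := by
    have := congrArg (fun g : ArithmeticFunction ℤ => g m) moebius_mul_coe_zeta
    simp only [coe_mul_zeta_apply, one_apply] at this
    exact_mod_cast this
  rw [h3]
  by_cases hm : m = 1
  · simp [hm]
  · have : l ≠ l * m := by
      intro h
      apply hm
      exact Nat.eq_of_mul_eq_mul_left (Nat.pos_of_ne_zero hl0) (by omega)
    simp [hm, this]

lemma sum_sieveWeight {d R l : ℕ} (hl : l ∈ sieveSupport d R) :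
    ∑ e ∈ sieveSupport d R with l ∣ e, sieveWeight d R e
      = (moebius l : ℝ) * (l.totient : ℝ)⁻¹ := by
  have h1 : ∀ k ∈ sieveSupport d R,
      ∑ e ∈ sieveSupport d R with l ∣ e ∧ e ∣ k, (moebius e : ℝ) * (k.totient : ℝ)⁻¹
        = if l = k then (moebius l : ℝ) * (l.totient : ℝ)⁻¹ else 0 := by
    intro k hk
    by_cases hlk : l ∣ k
    · have : ({e ∈ sieveSupport d R | l ∣ e ∧ e ∣ k} : Finset ℕ)
          = {e ∈ k.divisors | l ∣ e} := by
        ext e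
        simp only [mem_filter, Nat.mem_divisors]
        constructor
        · rintro ⟨_, h2, h3⟩
          exact ⟨⟨h3, (mem_sieveSupport.1 hk).2.1.ne_zero⟩, h2⟩
        · rintro ⟨⟨h2, _⟩, h3⟩
          exact ⟨mem_sieveSupport_of_dvd hk h2, h3, h2⟩
      rw [this, ← sum_mul, sum_moebius_between (mem_sieveSupport.1 hk).2.1 hlk]
      split_ifs with h
      · rw [h]
      · simp
    · rw [if_neg (by rintro rfl; exact hlk dvd_rfl)]
      apply sum_eq_zero
      intro e he
      rw [mem_filter] at he
      exact absurd (he.2.1.trans he.2.2) hlk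
  calc ∑ e ∈ sieveSupport d R with l ∣ e, sieveWeight d R e
      = ∑ k ∈ sieveSupport d R, ∑ e ∈ sieveSupport d R with l ∣ e ∧ e ∣ k,
          (moebius e : ℝ) * (k.totient : ℝ)⁻¹ := by
        simp only [sieveWeight, mul_sum, sum_filter]
        rw [sum_comm]
        refine sum_congr rfl fun e _ => ?_
        by_cases h : l ∣ e <;> simp [h]
    _ = (moebius l : ℝ) * (l.totient : ℝ)⁻¹ := by
        rw [sum_congr rfl h1, sum_ite_eq]
        simp [hl]

lemma sum_sum_gcd (d R : ℕ) :
    ∑ a ∈ sieveSupport d R, ∑ b ∈ sieveSupport d R,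
      sieveWeight d R a * sieveWeight d R b * (a.gcd b : ℝ) = sieveMass d R := by
  have h1 : ∀ a ∈ sieveSupport d R, ∀ b ∈ sieveSupport d R, (a.gcd b : ℝ)
      = ∑ l ∈ sieveSupport d R with l ∣ a ∧ l ∣ b, (l.totient : ℝ) := by
    intro a ha b hb
    rw [← Nat.cast_sum]
    congr 1
    conv_lhs => rw [← Nat.sum_totient (a.gcd b)]
    apply sum_congr _ fun _ _ => rfl
    ext l
    simp only [Nat.mem_divisors, mem_filter, Nat.dvd_gcd_iff]
    constructor
    · rintro ⟨h, _⟩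
      exact ⟨mem_sieveSupport_of_dvd ha h.1, h⟩
    · rintro ⟨_, h⟩
      exact ⟨h, (Nat.gcd_pos_of_pos_left _ (mem_sieveSupport.1 ha).1.1).ne'⟩
  calc _ = ∑ l ∈ sieveSupport d R, (l.totient : ℝ) *
        (∑ a ∈ sieveSupport d R with l ∣ a, sieveWeight d R a) ^ 2 := by
        rw [sum_congr rfl fun a ha => sum_congr rfl fun b hb => by rw [h1 a ha b hb]]
        simp only [sum_filter, mul_sum]
        rw [sum_congr rfl fun a ha => sum_comm, sum_comm]
        refine sum_congr rfl fun l _ => ?_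
        rw [sq, sum_mul_sum, mul_sum]
        refine sum_congr rfl fun a _ => ?_
        rw [mul_sum]
        refine sum_congr rfl fun b _ => ?_
        by_cases ha : l ∣ a <;> by_cases hb : l ∣ b <;> simp [ha, hb]
        ring
    _ = sieveMass d R := by
        refine sum_congr rfl fun l hl => ?_
        rw [sum_sieveWeight hl]
        have h2 := (mem_sieveSupport.1 hl)
        have h3 : ((moebius l : ℝ)) ^ 2 = 1 := by
          exact_mod_cast moebius_sq_eq_one_of_squarefree h2.2.1
        have h4 : (l.totient : ℝ) ≠ 0 := by
          exact_mod_cast (Nat.totient_pos.2 h2.1.1).ne'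
        rw [mul_pow, h3]
        field_simp

lemma abs_sieveWeight_le (d R e : ℕ) : |sieveWeight d R e| ≤ sieveMass d R := by
  unfold sieveWeight sieveMass
  rw [abs_mul]
  have h1 : |(moebius e : ℝ)| ≤ 1 := by exact_mod_cast abs_moebius_le_one
  have h2 : |∑ k ∈ sieveSupport d R with e ∣ k, (k.totient : ℝ)⁻¹| 
      ≤ ∑ k ∈ sieveSupport d R, (k.totient : ℝ)⁻¹ := by
    rw [abs_of_nonneg (sum_nonneg fun _ _ => by positivity)]
    exact sum_le_sum_of_subset_of_nonneg (filter_subset _ _) fun _ _ _ => by positivity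
  calc _ ≤ 1 * _ := mul_le_mul h1 h2 (abs_nonneg _) zero_le_one
    _ = _ := one_mul _

lemma sieveWeight_one (d R : ℕ) : sieveWeight d R 1 = sieveMass d R := by
  simp [sieveWeight, sieveMass]

/-- The number of `m ∈ [1,X]` with `a ∣ d m + 1` is `X / a + O(1)`. -/
lemma abs_card_dvd_sub_le {d a : ℕ} (ha : 0 < a) (had : a.Coprime d) (X : ℕ) :
    |((#{m ∈ Ioc 0 X | a ∣ d * m + 1} : ℕ) : ℝ) - X / a| ≤ 1 := by
  have : NeZero a := ⟨ha.ne'⟩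
  obtain ⟨v, hv⟩ : ∃ v : ℕ, ∀ m : ℕ, a ∣ d * m + 1 ↔ m ≡ v [MOD a] := by
    have hu : IsUnit (d : ZMod a) := (ZMod.isUnit_iff_coprime d a).2 had.symm
    obtain ⟨u, hu⟩ := hu
    refine ⟨(-(↑u⁻¹ : ZMod a)).val, fun m => ?_⟩
    rw [← ZMod.natCast_eq_natCast_iff, ZMod.natCast_val, ZMod.cast_id', id, 
      ← ZMod.natCast_eq_zero_iff]
    push_cast
    rw [← hu]
    constructor
    · intro h
      have : (u : ZMod a) * m = -1 := by linear_combination h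
      calc (m : ZMod a) = ↑u⁻¹ * (u * m) := by simp
        _ = _ := by rw [this]; ring
    · intro h
      rw [h]; simp
  simp only [hv]
  have h1 := Nat.Ioc_filter_modEq_card 0 X (r := a) ha v
  have ha' : (0 : ℝ) < a := by exact_mod_cast ha
  have hq : ∀ y : ℝ, y = (X - v) / a - (0 - v) / a → y = X / a := by
    intro y hy; rw [hy]; field_simp; ring
  have hle : ⌊(((0 : ℕ) : ℚ) - v) / a⌋ ≤ ⌊((X : ℚ) - v) / a⌋ := by
    apply Int.floor_le_floor
    gcongr
    simp
  rw [max_eq_left (by linarith)] at h1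
  have h2 : ((#{m ∈ Ioc 0 X | m ≡ v [MOD a]} : ℕ) : ℚ)
      = ⌊((X : ℚ) - v) / a⌋ - ⌊(((0 : ℕ) : ℚ) - v) / a⌋ := by
    exact_mod_cast h1
  have h3 : |((#{m ∈ Ioc 0 X | m ≡ v [MOD a]} : ℕ) : ℚ) - X / a| ≤ 1 := by
    have e1 : (X : ℚ) / a = ((X : ℚ) - v) / a - (((0 : ℕ) : ℚ) - v) / a := by
      push_cast; ring
    rw [h2, e1, abs_le]
    have l1 := Int.floor_le (((X : ℚ) - v) / a)
    have l2 := Int.lt_floor_add_one (((X : ℚ) - v) / a)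
    have l3 := Int.floor_le ((((0 : ℕ) : ℚ) - v) / a)
    have l4 := Int.lt_floor_add_one ((((0 : ℕ) : ℚ) - v) / a)
    constructor <;> linarith
  have h4 : ((|((#{m ∈ Ioc 0 X | m ≡ v [MOD a]} : ℕ) : ℚ) - X / a| : ℚ) : ℝ) ≤ (1 : ℚ) := by
    exact_mod_cast h3
  push_cast at h4
  exact h4

lemma sieveMass_pos {d R : ℕ} (hR : 1 ≤ R) : 0 < sieveMass d R := by
  unfold sieveMass
  apply sum_pos
  · intro k hk
    have := Nat.totient_pos.2 (mem_sieveSupport.1 hk).1.1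
    positivity
  · exact ⟨1, mem_sieveSupport.2 ⟨⟨le_rfl, hR⟩, squarefree_one, Nat.coprime_one_left d⟩⟩

lemma sum_sq_sieve_le (d R X : ℕ) :
    ∑ m ∈ Ioc 0 X, (∑ e ∈ sieveSupport d R with e ∣ d * m + 1, e * sieveWeight d R e) ^ 2
      ≤ X * sieveMass d R + (R ^ 2 * sieveMass d R) ^ 2 := by
  set K := sieveSupport d R
  set Y := sieveWeight d R
  have h1 : ∑ m ∈ Ioc 0 X, (∑ e ∈ K with e ∣ d * m + 1, e * Y e) ^ 2
      = ∑ a ∈ K, ∑ b ∈ K, (a * Y a) * (b * Y b) *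
        ((#{m ∈ Ioc 0 X | a.lcm b ∣ d * m + 1} : ℕ) : ℝ) := by
    simp only [card_filter, Nat.cast_sum, mul_sum]
    rw [sum_congr rfl fun a _ => sum_comm, sum_comm]
    refine sum_congr rfl fun m _ => ?_
    rw [sq, sum_filter, sum_mul_sum]
    refine sum_congr rfl fun a _ => sum_congr rfl fun b _ => ?_
    by_cases ha : a ∣ d * m + 1 <;> by_cases hb : b ∣ d * m + 1 <;>
      simp [ha, hb, Nat.lcm_dvd_iff]
  have h2 : ∀ a ∈ K, ∀ b ∈ K, (a * Y a) * (b * Y b) *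
        ((#{m ∈ Ioc 0 X | a.lcm b ∣ d * m + 1} : ℕ) : ℝ)
      ≤ X * (Y a * Y b * (a.gcd b : ℝ)) + (a * |Y a|) * (b * |Y b|) := by
    intro a ha b hb
    have ha0 : 0 < a := (mem_sieveSupport.1 ha).1.1
    have hb0 : 0 < b := (mem_sieveSupport.1 hb).1.1
    have hl : (0 : ℝ) < a.lcm b := by exact_mod_cast Nat.lcm_pos ha0 hb0
    have h3 := abs_card_dvd_sub_le (Nat.lcm_pos ha0 hb0)
      (Nat.Coprime.of_dvd_left (Nat.lcm_dvd_mul a b)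
        (Nat.Coprime.mul_left (mem_sieveSupport.1 ha).2.2 (mem_sieveSupport.1 hb).2.2)) X
    set N := ((#{m ∈ Ioc 0 X | a.lcm b ∣ d * m + 1} : ℕ) : ℝ)
    have h4 : (a : ℝ) * b = a.gcd b * a.lcm b := by exact_mod_cast (Nat.gcd_mul_lcm a b).symm
    have h5 : (a * Y a) * (b * Y b) * N = X * (Y a * Y b * (a.gcd b : ℝ))
        + (a * Y a) * (b * Y b) * (N - X / a.lcm b) := by
      have : (a * Y a) * (b * Y b) * (X / a.lcm b) = X * (Y a * Y b * (a.gcd b : ℝ)) := by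
        field_simp
        linear_combination Y a * Y b * X * h4
      linear_combination this
    rw [h5, add_le_add_iff_left]
    calc _ ≤ |(a * Y a) * (b * Y b) * (N - X / a.lcm b)| := le_abs_self _
      _ = (a * |Y a|) * (b * |Y b|) * |N - X / a.lcm b| := by simp [abs_mul]
      _ ≤ (a * |Y a|) * (b * |Y b|) * 1 := by gcongr
      _ = _ := mul_one _
  have hG : 0 ≤ sieveMass d R := sum_nonneg fun _ _ => by positivity
  have h6 : ∑ a ∈ K, (a : ℝ) * |Y a| ≤ R ^ 2 * sieveMass d R := by
    calc ∑ a ∈ K, (a : ℝ) * |Y a| ≤ ∑ a ∈ K, R * sieveMass d R := by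
          refine sum_le_sum fun a ha => ?_
          have : (a : ℝ) ≤ R := by exact_mod_cast (mem_sieveSupport.1 ha).1.2
          exact mul_le_mul this (abs_sieveWeight_le d R a) (abs_nonneg _) (by positivity)
      _ = #K * (R * sieveMass d R) := by simp
      _ ≤ R * (R * sieveMass d R) := by
          gcongr
          calc #K ≤ #(Icc 1 R) := card_filter_le _ _
            _ = R := by simp
      _ = _ := by ring
  rw [h1]
  calc _ ≤ ∑ a ∈ K, ∑ b ∈ K, (X * (Y a * Y b * (a.gcd b : ℝ)) + (a * |Y a|) * (b * |Y b|)) :=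
        sum_le_sum fun a ha => sum_le_sum fun b hb => h2 a ha b hb
    _ = X * (∑ a ∈ K, ∑ b ∈ K, Y a * Y b * (a.gcd b : ℝ)) + (∑ a ∈ K, (a : ℝ) * |Y a|) ^ 2 := by
        rw [sq, sum_mul_sum]; simp only [sum_add_distrib, mul_sum]
    _ ≤ _ := by
        rw [sum_sum_gcd]
        gcongr

/-- The Selberg sieve bound for primes `≡ 1 (mod d)`. -/
lemma card_prime_mul_add_one_le {d R : ℕ} (hd : 1 ≤ d) (hR : 1 ≤ R) (X : ℕ) :
    ((#{m ∈ Ioc 0 X | (d * m + 1).Prime} : ℕ) : ℝ) ≤ R + X / sieveMass d R + R ^ 4 := by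
  have hG := sieveMass_pos (d := d) hR
  set G := sieveMass d R
  have h1 : #{m ∈ Ioc 0 X | (d * m + 1).Prime}
      ≤ R + #{m ∈ Ioc 0 X | (d * m + 1).Prime ∧ R < d * m + 1} := by
    have : ({m ∈ Ioc 0 X | (d * m + 1).Prime} : Finset ℕ) ⊆
        Icc 1 R ∪ {m ∈ Ioc 0 X | (d * m + 1).Prime ∧ R < d * m + 1} := by
      intro m hm
      simp only [mem_filter, mem_Ioc, mem_union, mem_Icc] at *
      by_cases h : R < d * m + 1
      · exact Or.inr ⟨hm.1, hm.2, h⟩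
      · left
        refine ⟨hm.1.1, ?_⟩
        nlinarith
    refine (card_le_card this).trans ((card_union_le _ _).trans ?_)
    simp
  have h2 : G ^ 2 * ((#{m ∈ Ioc 0 X | (d * m + 1).Prime ∧ R < d * m + 1} : ℕ) : ℝ)
      ≤ X * G + (R ^ 2 * G) ^ 2 := by
    refine le_trans ?_ (sum_sq_sieve_le d R X)
    rw [card_filter, Nat.cast_sum, mul_sum]
    refine sum_le_sum fun m hm => ?_
    split_ifs with h
    · have : ({e ∈ sieveSupport d R | e ∣ d * m + 1} : Finset ℕ) = {1} := by
        ext e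
        simp only [mem_filter, mem_singleton]
        constructor
        · rintro ⟨h3, h4⟩
          rcases (Nat.dvd_prime h.1).1 h4 with h5 | h5
          · exact h5
          · have := (mem_sieveSupport.1 h3).1.2
            omega
        · rintro rfl
          exact ⟨mem_sieveSupport.2 ⟨⟨le_rfl, hR⟩, squarefree_one, Nat.coprime_one_left d⟩,
            one_dvd _⟩
      rw [this, sum_singleton, sieveWeight_one]
      simp [G]
    · simpa using sq_nonneg _
  have h3 : ((#{m ∈ Ioc 0 X | (d * m + 1).Prime ∧ R < d * m + 1} : ℕ) : ℝ)
      ≤ X / G + R ^ 4 := by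
    rw [mul_comm, ← le_div_iff₀ (by positivity)] at h2
    refine h2.trans (le_of_eq ?_)
    field_simp
  have h4 : ((#{m ∈ Ioc 0 X | (d * m + 1).Prime} : ℕ) : ℝ)
    ≤ R + ((#{m ∈ Ioc 0 X | (d * m + 1).Prime ∧ R < d * m + 1} : ℕ) : ℝ) := by
    exact_mod_cast h1
  linarith

lemma sum_inv_le_div_totient {N : ℕ} (hN : N ≠ 0) (F : Finset ℕ)
    (hF : ∀ m ∈ F, m ≠ 0 ∧ m.primeFactors ⊆ N.primeFactors) :
    ∑ m ∈ F, (m : ℝ)⁻¹ ≤ N / N.totient := by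
  let f : ℕ →* ℝ :=
    { toFun := fun n => (n : ℝ)⁻¹, map_one' := by simp, map_mul' := by intro a b; simp [mul_comm] }
  have hf : ∀ {p : ℕ}, p.Prime → ‖f p‖ < 1 := by
    intro p hp
    have : (1 : ℝ) < p := by exact_mod_cast hp.one_lt
    simp only [f, MonoidHom.coe_mk, OneHom.coe_mk, norm_inv, RCLike.norm_natCast]
    exact inv_lt_one_of_one_lt₀ this
  obtain ⟨-, h⟩ := EulerProduct.summable_and_hasSum_factoredNumbers_prod_filter_prime_geometric hf
    N.primeFactors
  have hmem : ∀ m ∈ F, m ∈ Nat.factoredNumbers N.primeFactors := by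
    intro m hm
    rw [Nat.mem_factoredNumbers']
    intro p hp hpm
    exact (hF m hm).2 (Nat.mem_primeFactors.2 ⟨hp, hpm, (hF m hm).1⟩)
  have h1 : ∑ m ∈ F, (m : ℝ)⁻¹ = ∑ m ∈ F.subtype (· ∈ Nat.factoredNumbers N.primeFactors), f m := by
    rw [Finset.sum_subtype_of_mem (f := fun m => f m) hmem]
    rfl
  have hval : ∏ p ∈ N.primeFactors with p.Prime, (1 - f p)⁻¹ = N / N.totient := by
    rw [filter_true_of_mem fun p hp => Nat.prime_of_mem_primeFactors hp]
    have h2 : ((N.totient : ℚ) : ℝ) = ((N * ∏ p ∈ N.primeFactors, (1 - (p : ℚ)⁻¹) : ℚ) : ℝ) := by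
      rw [Nat.totient_eq_mul_prod_factors]
    push_cast at h2
    have hN' : (N : ℝ) ≠ 0 := by exact_mod_cast hN
    rw [h2, prod_inv_distrib, div_mul_eq_div_div, div_self hN', one_div]
    rfl
  rw [h1, ← hval]
  refine sum_le_hasSum _ (fun m _ => ?_) h
  simp only [f, MonoidHom.coe_mk, OneHom.coe_mk]
  positivity

lemma log_le_sieveMass {d : ℕ} (hd : 1 ≤ d) (R : ℕ) :
    Real.log (R + 1) ≤ sieveMass d R * (d / d.totient) := by
  have hd0 : d ≠ 0 := by omega
  let κ : ℕ → ℕ := fun n => ∏ p ∈ n.primeFactors with ¬ p ∣ d, p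
  have hκdvd : ∀ n, n ≠ 0 → κ n ∣ n := fun n hn =>
    (prod_dvd_prod_of_subset _ _ _ (filter_subset _ _)).trans (Nat.prod_primeFactors_dvd n)
  have hκpf : ∀ n, (κ n).primeFactors = {p ∈ n.primeFactors | ¬ p ∣ d} := fun n =>
    Nat.primeFactors_prod fun p hp => Nat.prime_of_mem_primeFactors (mem_filter.1 hp).1
  have hκ : ∀ n ∈ Ioc 0 R, κ n ∈ sieveSupport d R := by
    intro n hn
    rw [mem_Ioc] at hn
    have h1 := hκdvd n (by omega)
    rw [mem_sieveSupport]
    refine ⟨⟨Nat.pos_of_dvd_of_pos h1 hn.1, (Nat.le_of_dvd hn.1 h1).trans hn.2⟩, ?_, ?_⟩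
    · refine Squarefree.squarefree_of_dvd (prod_dvd_prod_of_subset _ _ _ (filter_subset _ _)) ?_
      rw [← Nat.radical_eq_prod_primeFactors]
      exact UniqueFactorizationMonoid.squarefree_radical
    · refine Nat.Coprime.prod_left fun p hp => ?_
      rw [mem_filter] at hp
      exact (Nat.Prime.coprime_iff_not_dvd (Nat.prime_of_mem_primeFactors hp.1)).2 hp.2
  have h1 : Real.log (R + 1) ≤ ∑ n ∈ Ioc 0 R, (n : ℝ)⁻¹ := by
    have := log_add_one_le_harmonic R
    have h2 : ((harmonic R : ℚ) : ℝ) = ∑ n ∈ Ioc 0 R, (n : ℝ)⁻¹ := by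
      rw [harmonic_eq_sum_Icc]
      push_cast
      rfl
    rw [h2] at this
    exact_mod_cast this
  refine h1.trans ?_
  rw [← sum_fiberwise_of_maps_to hκ, sieveMass, sum_mul]
  refine sum_le_sum fun k hk => ?_
  obtain ⟨⟨hk1, hk2⟩, hk3, hk4⟩ := mem_sieveSupport.1 hk
  have hk0 : (k : ℝ) ≠ 0 := by exact_mod_cast (by omega : k ≠ 0)
  have h3 : ∑ n ∈ Ioc 0 R with κ n = k, (n : ℝ)⁻¹
      = (k : ℝ)⁻¹ * ∑ m ∈ ({n ∈ Ioc 0 R | κ n = k}).image (· / k), (m : ℝ)⁻¹ := by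
    have hdv : ∀ n ∈ ({n ∈ Ioc 0 R | κ n = k}), k ∣ n := by
      intro n hn
      simp only [mem_filter, mem_Ioc] at hn
      rw [← hn.2]
      exact hκdvd n (by omega)
    rw [sum_image, mul_sum]
    · refine sum_congr rfl fun n hn => ?_
      rw [Nat.cast_div (hdv n hn) hk0]
      field_simp
    · intro a ha b hb hab
      exact (Nat.div_left_inj (hdv a ha) (hdv b hb)).1 hab
  rw [h3]
  have h4 := sum_inv_le_div_totient (N := k * d) (by positivity)
    (({n ∈ Ioc 0 R | κ n = k}).image (· / k)) (by
      intro m hm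
      simp only [mem_image, mem_filter, mem_Ioc] at hm
      obtain ⟨n, ⟨⟨hn0, hnR⟩, hn⟩, rfl⟩ := hm
      have hkn : k ∣ n := hn ▸ hκdvd n (by omega)
      obtain ⟨c, rfl⟩ := hkn
      have hc : c ≠ 0 := by rintro rfl; simp at hn0
      rw [Nat.mul_div_cancel_left _ (by omega)]
      refine ⟨hc, fun p hp => ?_⟩
      rw [Nat.primeFactors_mul (by omega) hd0, mem_union]
      by_cases hpd : p ∣ d
      · exact Or.inr (Nat.mem_primeFactors.2 ⟨Nat.prime_of_mem_primeFactors hp, hpd, hd0⟩)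
      · left
        rw [← hn, hκpf, mem_filter]
        exact ⟨Nat.primeFactors_mono (dvd_mul_left _ _) (by positivity) hp, hpd⟩)
  have ht1 : (k.totient : ℝ) ≠ 0 := by exact_mod_cast (Nat.totient_pos.2 (by omega)).ne'
  have ht2 : (d.totient : ℝ) ≠ 0 := by exact_mod_cast (Nat.totient_pos.2 (by omega)).ne'
  calc _ ≤ (k : ℝ)⁻¹ * (((k * d : ℕ) : ℝ) / ((k * d).totient)) := by gcongr
    _ = _ := by
      rw [Nat.totient_mul hk4]
      push_cast
      field_simp

/-- A Brun–Titchmarsh inequality for primes `≡ 1 (mod d)`. -/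
theorem card_primes_dvd_sub_one_le {T : ℝ} (hT : 1 < T) {d : ℕ} (hd : 1 ≤ d)
    (hdT : (d : ℝ) ≤ T ^ (9 / 10 : ℝ)) :
    ((#{p ∈ (⌊T⌋₊).primesLE | d ∣ p - 1} : ℕ) : ℝ) ≤ 120 * T / (d.totient * Real.log T) := by
  have hT0 : 0 < T := by linarith
  have hlog : 0 < Real.log T := Real.log_pos hT
  set R := ⌊T ^ (1 / 80 : ℝ)⌋₊ with hRdef
  have hT80 : 1 ≤ T ^ (1 / 80 : ℝ) := Real.one_le_rpow hT.le (by norm_num)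
  have hR1 : 1 ≤ R := Nat.le_floor (by simpa using hT80)
  have hRle : (R : ℝ) ≤ T ^ (1 / 80 : ℝ) := Nat.floor_le (by positivity)
  have hRlt : T ^ (1 / 80 : ℝ) < R + 1 := Nat.lt_floor_add_one _
  set X := ⌊T⌋₊ / d with hX
  have hcard : #{p ∈ (⌊T⌋₊).primesLE | d ∣ p - 1} ≤ #{m ∈ Ioc 0 X | (d * m + 1).Prime} := by
    have hinv : ∀ p ∈ ({p ∈ (⌊T⌋₊).primesLE | d ∣ p - 1} : Finset ℕ),
        d * ((p - 1) / d) + 1 = p := by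
      intro p hp
      simp only [mem_filter, Nat.mem_primesLE] at hp
      rw [Nat.mul_div_cancel' hp.2]
      have := hp.1.2.one_lt
      omega
    apply card_le_card_of_injOn (fun p => (p - 1) / d)
    · intro p hp
      have h1 := hinv p hp
      simp only [coe_filter, Set.mem_ofPred_eq, Nat.mem_primesLE] at hp
      simp only [coe_filter, Set.mem_ofPred_eq, mem_Ioc]
      refine ⟨⟨Nat.div_pos (Nat.le_of_dvd ?_ hp.2) hd, Nat.div_le_div_right ?_⟩, by rw [h1]; exact hp.1.2⟩
      · have := hp.1.2.one_lt
        omega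
      · omega
    · intro p hp q hq hpq
      have h1 := hinv p hp
      have h2 := hinv q hq
      simp only at hpq
      rw [← h1, ← h2, hpq]
  have h1 := card_prime_mul_add_one_le hd hR1 X
  have hG := sieveMass_pos (d := d) hR1
  set G := sieveMass d R
  have hφ : (0 : ℝ) < d.totient := by exact_mod_cast Nat.totient_pos.2 hd
  have hd0 : (0 : ℝ) < d := by exact_mod_cast hd
  have h2 : Real.log T / 80 ≤ G * (d / d.totient) := by
    refine le_trans ?_ (log_le_sieveMass hd R)
    rw [show Real.log T / 80 = (1 / 80) * Real.log T by ring, ← Real.log_rpow hT0]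
    exact Real.log_le_log (by positivity) hRlt.le
  have hXd : (X : ℝ) * d ≤ T := by
    have h3 : X * d ≤ ⌊T⌋₊ := Nat.div_mul_le_self _ _
    have h4 : ((X * d : ℕ) : ℝ) ≤ ⌊T⌋₊ := by exact_mod_cast h3
    push_cast at h4
    exact h4.trans (Nat.floor_le hT0.le)
  have h3 : (X : ℝ) / G ≤ 80 * T / (d.totient * Real.log T) := by
    rw [div_le_div_iff₀ hG (by positivity)]
    have h4 : Real.log T * d.totient ≤ 80 * G * d := by
      have h5 : G * (d / d.totient) * d.totient = G * d := by field_simp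
      have h6 := mul_le_mul_of_nonneg_right h2 hφ.le
      rw [h5] at h6
      linarith
    calc (X : ℝ) * (d.totient * Real.log T) = X * (Real.log T * d.totient) := by ring
      _ ≤ X * (80 * G * d) := by gcongr
      _ = (X * d) * (80 * G) := by ring
      _ ≤ T * (80 * G) := by gcongr
      _ = _ := by ring
  have hR4 : (R : ℝ) ^ 4 ≤ T ^ (1 / 20 : ℝ) := by
    calc (R : ℝ) ^ 4 ≤ (T ^ (1 / 80 : ℝ)) ^ 4 := by gcongr
      _ = T ^ (1 / 20 : ℝ) := by
        rw [← Real.rpow_natCast, ← Real.rpow_mul hT0.le]; norm_num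
  have hRR : (R : ℝ) ≤ (R : ℝ) ^ 4 := by
    have : R ^ 1 ≤ R ^ 4 := Nat.pow_le_pow_right hR1 (by norm_num)
    rw [pow_one] at this
    exact_mod_cast this
  have h5 : T ^ (1 / 20 : ℝ) ≤ 20 * T / (d.totient * Real.log T) := by
    rw [le_div_iff₀ (by positivity)]
    have h6 : Real.log T ≤ T ^ (1 / 20 : ℝ) / (1 / 20) :=
      Real.log_le_rpow_div hT0.le (by norm_num)
    have h7 : (d.totient : ℝ) ≤ T ^ (9 / 10 : ℝ) :=
      le_trans (by exact_mod_cast Nat.totient_le d) hdT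
    calc T ^ (1 / 20 : ℝ) * (d.totient * Real.log T)
        ≤ T ^ (1 / 20 : ℝ) * (T ^ (9 / 10 : ℝ) * (T ^ (1 / 20 : ℝ) / (1 / 20))) := by gcongr
      _ = 20 * (T ^ (1 / 20 : ℝ) * T ^ (9 / 10 : ℝ) * T ^ (1 / 20 : ℝ)) := by ring
      _ = 20 * T := by
        rw [← Real.rpow_add hT0, ← Real.rpow_add hT0]; norm_num
  have h8 : ((#{p ∈ (⌊T⌋₊).primesLE | d ∣ p - 1} : ℕ) : ℝ)
      ≤ ((#{m ∈ Ioc 0 X | (d * m + 1).Prime} : ℕ) : ℝ) := by exact_mod_cast hcard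
  have h9 : 120 * T / (d.totient * Real.log T) = 80 * T / (d.totient * Real.log T)
      + 20 * T / (d.totient * Real.log T) + 20 * T / (d.totient * Real.log T) := by ring
  linarith

lemma card_primes_dvd_sub_one_le_div {T : ℝ} (hT : 0 ≤ T) {d : ℕ} (hd : 1 ≤ d) :
    ((#{p ∈ (⌊T⌋₊).primesLE | d ∣ p - 1} : ℕ) : ℝ) ≤ T / d := by
  have hcard : #{p ∈ (⌊T⌋₊).primesLE | d ∣ p - 1} ≤ #(Ioc 0 (⌊T⌋₊ / d)) := by
    apply card_le_card_of_injOn (fun p => (p - 1) / d)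
    · intro p hp
      simp only [coe_filter, Set.mem_ofPred_eq, Nat.mem_primesLE] at hp
      simp only [coe_Ioc, Set.mem_Ioc]
      refine ⟨Nat.div_pos (Nat.le_of_dvd ?_ hp.2) hd, Nat.div_le_div_right ?_⟩
      · have := hp.1.2.one_lt
        omega
      · omega
    · intro p hp q hq hpq
      simp only [coe_filter, Set.mem_ofPred_eq, Nat.mem_primesLE] at hp hq
      have := (Nat.div_left_inj hp.2 hq.2).1 hpq
      have := hp.1.2.one_lt
      have := hq.1.2.one_lt
      omega
  rw [Nat.card_Ioc, Nat.sub_zero] at hcard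
  have h1 : ((#{p ∈ (⌊T⌋₊).primesLE | d ∣ p - 1} : ℕ) : ℝ) ≤ ((⌊T⌋₊ / d : ℕ) : ℝ) := by
    exact_mod_cast hcard
  refine h1.trans (Nat.cast_div_le.trans ?_)
  gcongr
  exact Nat.floor_le hT

end OrderInIntervals

namespace OrderInIntervals

open Finset ArithmeticFunction Filter

lemma log_factorial_eq_sum (n : ℕ) :
    Real.log n.factorial = ∑ d ∈ Ioc 0 n, vonMangoldt d * ((n / d : ℕ) : ℝ) := by
  rw [← sum_Ioc_mul_zeta_eq_sum, vonMangoldt_mul_zeta]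
  induction n with
  | zero => simp
  | succ k ih =>
    rw [Nat.factorial_succ, ← insert_Ioc_right_eq_Ioc_add_one (Nat.zero_le _), sum_insert (by simp),
      ← ih, Nat.cast_mul, Real.log_mul (by positivity) (by positivity)]
    simp [log_apply]

lemma log_factorial_le (n : ℕ) : Real.log n.factorial ≤ n * Real.log n := by
  rw [← Real.log_pow]
  apply Real.log_le_log (by positivity)
  exact_mod_cast Nat.factorial_le_pow n

lemma le_log_factorial {n : ℕ} (hn : 1 ≤ n) : n * Real.log n - n ≤ Real.log n.factorial := by
  have h := Real.pow_div_factorial_le_exp (n : ℝ) (by positivity) n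
  have hn' : (0 : ℝ) < n := by exact_mod_cast hn
  have h2 := Real.log_le_log (by positivity) h
  rw [Real.log_div (by positivity) (by positivity), Real.log_pow, Real.log_exp] at h2
  linarith

lemma sum_vonMangoldt_div_le {n : ℕ} (hn : 1 ≤ n) :
    ∑ d ∈ Ioc 0 n, vonMangoldt d / d ≤ Real.log n + 6 := by
  have hn' : (0 : ℝ) < n := by exact_mod_cast hn
  have h1 : n * ∑ d ∈ Ioc 0 n, vonMangoldt d / d
      ≤ ∑ d ∈ Ioc 0 n, vonMangoldt d * ((n / d : ℕ) : ℝ) + ∑ d ∈ Ioc 0 n, vonMangoldt d := by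
    rw [mul_sum, ← sum_add_distrib]
    refine sum_le_sum fun d hd => ?_
    have hd0 : (0 : ℝ) < d := by exact_mod_cast (mem_Ioc.1 hd).1
    have h2 : (n : ℝ) / d ≤ ((n / d : ℕ) : ℝ) + 1 := by
      rw [← Nat.floor_div_eq_div (K := ℝ)]
      exact (Nat.lt_floor_add_one _).le
    calc n * (vonMangoldt d / d) = vonMangoldt d * (n / d) := by ring
      _ ≤ vonMangoldt d * (((n / d : ℕ) : ℝ) + 1) := by
        gcongr
      _ = _ := by ring
  have h3 : ∑ d ∈ Ioc 0 n, vonMangoldt d ≤ 6 * n := by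
    have := Chebyshev.psi_le_const_mul_self (x := n) (by positivity)
    rw [Chebyshev.psi, Nat.floor_natCast] at this
    have h4 : Real.log 4 ≤ 2 := by
      rw [show (4 : ℝ) = 2 ^ 2 by norm_num, Real.log_pow]
      have := Real.log_two_lt_d9
      push_cast
      linarith
    nlinarith
  rw [← log_factorial_eq_sum] at h1
  have h4 := log_factorial_le n
  have : n * ∑ d ∈ Ioc 0 n, vonMangoldt d / d ≤ n * (Real.log n + 6) := by linarith
  exact le_of_mul_le_mul_left this hn'

lemma le_sum_vonMangoldt_div {n : ℕ} (hn : 1 ≤ n) :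
    Real.log n - 1 ≤ ∑ d ∈ Ioc 0 n, vonMangoldt d / d := by
  have hn' : (0 : ℝ) < n := by exact_mod_cast hn
  have h1 : ∑ d ∈ Ioc 0 n, vonMangoldt d * ((n / d : ℕ) : ℝ)
      ≤ n * ∑ d ∈ Ioc 0 n, vonMangoldt d / d := by
    rw [mul_sum]
    refine sum_le_sum fun d hd => ?_
    calc vonMangoldt d * ((n / d : ℕ) : ℝ) ≤ vonMangoldt d * (n / d) := by
          gcongr
          exact Nat.cast_div_le
      _ = _ := by ring
  rw [← log_factorial_eq_sum] at h1
  have h4 := le_log_factorial hn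
  have : n * (Real.log n - 1) ≤ n * ∑ d ∈ Ioc 0 n, vonMangoldt d / d := by linarith
  exact le_of_mul_le_mul_left this hn'

/-- The primes in the interval `(x, y]`. -/
noncomputable def primesBetween (x y : ℝ) : Finset ℕ := {q ∈ (⌊y⌋₊).primesLE | x < (q : ℝ)}

lemma mem_primesBetween {x y : ℝ} {q : ℕ} :
    q ∈ primesBetween x y ↔ q.Prime ∧ x < q ∧ (q : ℝ) ≤ y := by
  rw [primesBetween, mem_filter, Nat.mem_primesLE]
  constructor
  · rintro ⟨⟨h1, h2⟩, h3⟩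
    exact ⟨h2, h3, (Nat.le_floor_iff' h2.ne_zero).1 h1⟩
  · rintro ⟨h1, h2, h3⟩
    exact ⟨⟨(Nat.le_floor_iff' h1.ne_zero).2 h3, h1⟩, h2⟩

lemma sum_log_div_primesBetween_le {x y : ℝ} (hx : 1 ≤ x) (hxy : x ≤ y) :
    ∑ q ∈ primesBetween x y, Real.log q / q ≤ Real.log y - Real.log x + 8 := by
  have hx1 : 1 ≤ ⌊x⌋₊ := Nat.le_floor (by simpa using hx)
  have hy1 : 1 ≤ ⌊y⌋₊ := hx1.trans (Nat.floor_le_floor hxy)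
  have h1 := sum_vonMangoldt_div_le hy1
  have h2 := le_sum_vonMangoldt_div hx1
  have h3 : Real.log ⌊y⌋₊ ≤ Real.log y :=
    Real.log_le_log (by exact_mod_cast hy1) (Nat.floor_le (by linarith))
  have h4 : Real.log x - 1 ≤ Real.log ⌊x⌋₊ := by
    have h5 : x ≤ 2 * ⌊x⌋₊ := by
      have := Nat.lt_floor_add_one x
      have : (1 : ℝ) ≤ ⌊x⌋₊ := by exact_mod_cast hx1
      linarith
    have h6 := Real.log_le_log (by linarith) h5
    rw [Real.log_mul (by norm_num) (by positivity)] at h6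
    have := Real.log_two_lt_d9
    linarith
  have h5 : ∑ q ∈ primesBetween x y, Real.log q / q + ∑ d ∈ Ioc 0 ⌊x⌋₊, vonMangoldt d / d
      ≤ ∑ d ∈ Ioc 0 ⌊y⌋₊, vonMangoldt d / d := by
    have e1 : ∑ q ∈ primesBetween x y, Real.log q / q
        = ∑ q ∈ primesBetween x y, vonMangoldt q / q :=
      sum_congr rfl fun q hq => by rw [vonMangoldt_apply_prime (mem_primesBetween.1 hq).1]
    rw [e1, ← sum_union]
    · refine sum_le_sum_of_subset_of_nonneg ?_ fun d _ _ =>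
        div_nonneg vonMangoldt_nonneg (by positivity)
      intro d hd
      rw [mem_union, mem_primesBetween, mem_Ioc] at hd
      rw [mem_Ioc]
      rcases hd with ⟨h, _, h'⟩ | ⟨h, h'⟩
      · exact ⟨h.pos, Nat.le_floor h'⟩
      · exact ⟨h, h'.trans (Nat.floor_le_floor hxy)⟩
    · rw [disjoint_left]
      intro q hq hq'
      have h6 := (mem_primesBetween.1 hq).2.1
      have h7 := (Nat.le_floor_iff (by linarith)).1 (mem_Ioc.1 hq').2
      linarith
  linarith

lemma sum_inv_primesBetween_le {x y : ℝ} (hx : 1 < x) (hxy : x ≤ y) :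
    ∑ q ∈ primesBetween x y, (q : ℝ)⁻¹ ≤ (Real.log y - Real.log x + 8) / Real.log x := by
  have hl := Real.log_pos hx
  rw [le_div_iff₀ hl, sum_mul]
  refine le_trans (sum_le_sum fun q hq => ?_) (sum_log_div_primesBetween_le hx.le hxy)
  rw [mem_primesBetween] at hq
  rw [div_eq_mul_inv, mul_comm]
  gcongr
  exact hq.2.1.le

lemma inv_sub_one_le {x : ℝ} (hx : 1 < x) {q : ℕ} (hq : x < q) :
    ((q : ℝ) - 1)⁻¹ ≤ (1 + 1 / (x - 1)) * (q : ℝ)⁻¹ := by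
  have h1 : (0 : ℝ) < x - 1 := by linarith
  have h2 : (0 : ℝ) < q - 1 := by linarith
  have h3 : (0 : ℝ) < q := by linarith
  rw [← one_div, ← one_div, div_le_iff₀ h2]
  have : (1 : ℝ) + 1 / (x - 1) = x / (x - 1) := by field_simp; ring
  rw [this, div_mul_div_comm, div_mul_eq_mul_div, le_div_iff₀ (by positivity)]
  nlinarith

lemma sum_inv_sub_one_primesBetween_le {x y : ℝ} (hx : 1 < x) (hxy : x ≤ y) :
    ∑ q ∈ primesBetween x y, ((q : ℝ) - 1)⁻¹
      ≤ (1 + 1 / (x - 1)) * ((Real.log y - Real.log x + 8) / Real.log x) := by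
  have h1 : (0 : ℝ) < x - 1 := by linarith
  calc _ ≤ ∑ q ∈ primesBetween x y, (1 + 1 / (x - 1)) * (q : ℝ)⁻¹ :=
        sum_le_sum fun q hq => inv_sub_one_le hx (mem_primesBetween.1 hq).2.1
    _ ≤ _ := by
        rw [← mul_sum]
        gcongr
        exact sum_inv_primesBetween_le hx hxy

lemma eventually_sum_inv_sub_one_step_le :
    ∀ᶠ x : ℝ in atTop, ∑ q ∈ primesBetween x (x ^ Real.exp (1 / 100)), ((q : ℝ) - 1)⁻¹
      ≤ 165 / 16000 := by
  have h1 : Tendsto (fun x : ℝ => (1 + 1 / (x - 1)) *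
      (Real.exp (1 / 100) - 1 + 8 / Real.log x)) atTop
      (nhds ((1 + 0) * (Real.exp (1 / 100) - 1 + 0))) := by
    refine Tendsto.mul (Tendsto.add tendsto_const_nhds ?_) (Tendsto.add tendsto_const_nhds ?_)
    · exact tendsto_const_nhds.div_atTop (tendsto_atTop_add_const_right _ _ tendsto_id)
    · exact tendsto_const_nhds.div_atTop Real.tendsto_log_atTop
  have h2 : (1 + 0) * (Real.exp (1 / 100) - 1 + 0) < 165 / 16000 := by
    have := Real.exp_bound' (x := 1 / 100) (by norm_num) (by norm_num) (n := 3) (by norm_num)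
    norm_num [sum_range_succ, Nat.factorial] at this ⊢
    linarith
  filter_upwards [h1.eventually_lt_const h2, eventually_gt_atTop 1] with x hx hx1
  have hl := Real.log_pos hx1
  refine le_trans (sum_inv_sub_one_primesBetween_le hx1 ?_) (le_trans (le_of_eq ?_) hx.le)
  · conv_lhs => rw [← Real.rpow_one x]
    exact Real.rpow_le_rpow_of_exponent_le hx1.le (Real.one_le_exp (by norm_num))
  · rw [Real.log_rpow (by linarith)]
    field_simp

lemma primesBetween_subset_union {x y z : ℝ} :
    primesBetween x z ⊆ primesBetween x y ∪ primesBetween y z := by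
  intro q hq
  rw [mem_union, mem_primesBetween, mem_primesBetween]
  rw [mem_primesBetween] at hq
  rcases le_or_gt (q : ℝ) y with h | h
  · exact Or.inl ⟨hq.1, hq.2.1, h⟩
  · exact Or.inr ⟨hq.1, h, hq.2.2⟩

/-- The reciprocal sum of the primes in `(T^γ, T]` with `γ = e^{-16m}` is at most `16.5 m`. -/
lemma eventually_sum_inv_sub_one_le (m : ℕ) :
    ∀ᶠ T : ℝ in atTop, ∑ q ∈ primesBetween (T ^ Real.exp (-(16 * m : ℝ))) T, ((q : ℝ) - 1)⁻¹
      ≤ 33 / 2 * m := by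
  have h0 := (tendsto_rpow_atTop (Real.exp_pos (-(16 * m : ℝ)))).eventually
    (eventually_forall_ge_atTop.2 eventually_sum_inv_sub_one_step_le)
  filter_upwards [h0, eventually_ge_atTop 1] with T hT hT1
  have hT0 : 0 ≤ T := by linarith
  have key : ∀ i : ℕ, ∑ q ∈ primesBetween (T ^ Real.exp (-(16 * m : ℝ)))
      (T ^ Real.exp (-(16 * m : ℝ) + i / 100)), ((q : ℝ) - 1)⁻¹ ≤ 165 / 16000 * i := by
    intro i
    induction i with
    | zero =>
      have : primesBetween (T ^ Real.exp (-(16 * m : ℝ)))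
          (T ^ Real.exp (-(16 * m : ℝ) + (0 : ℕ) / 100)) = ∅ := by
        apply eq_empty_of_forall_notMem
        intro q hq
        rw [mem_primesBetween] at hq
        simp only [Nat.cast_zero, zero_div, add_zero] at hq
        linarith [hq.2.1, hq.2.2]
      rw [this]; simp
    | succ i ih =>
      have h1 := hT (T ^ Real.exp (-(16 * m : ℝ) + i / 100)) (by
        apply Real.rpow_le_rpow_of_exponent_le hT1
        apply Real.exp_le_exp.2
        have : (0 : ℝ) ≤ i / 100 := by positivity
        linarith)
      rw [← Real.rpow_mul hT0, ← Real.exp_add] at h1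
      have e : (-(16 * m : ℝ) + i / 100 + 1 / 100) = -(16 * m : ℝ) + (i + 1 : ℕ) / 100 := by
        push_cast; ring
      rw [e] at h1
      have hnn : ∀ (x : ℝ) (y : ℝ), 0 ≤ ∑ q ∈ primesBetween x y, ((q : ℝ) - 1)⁻¹ := by
        intro x y
        refine sum_nonneg fun q hq => ?_
        have : (1 : ℝ) ≤ q := by exact_mod_cast (mem_primesBetween.1 hq).1.one_lt.le
        exact inv_nonneg.2 (by linarith)
      calc _ ≤ ∑ q ∈ primesBetween (T ^ Real.exp (-(16 * m : ℝ)))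
                (T ^ Real.exp (-(16 * m : ℝ) + i / 100))
              ∪ primesBetween (T ^ Real.exp (-(16 * m : ℝ) + i / 100))
                (T ^ Real.exp (-(16 * m : ℝ) + (i + 1 : ℕ) / 100)), ((q : ℝ) - 1)⁻¹ := by
            refine sum_le_sum_of_subset_of_nonneg primesBetween_subset_union fun q hq _ => ?_
            have : (1 : ℝ) ≤ q := by
              rcases mem_union.1 hq with h | h <;>
              exact_mod_cast (mem_primesBetween.1 h).1.one_lt.le
            exact inv_nonneg.2 (by linarith)
        _ ≤ _ := sum_union_inter (f := fun q : ℕ => ((q : ℝ) - 1)⁻¹) ▸ le_add_of_nonneg_right (by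
            refine sum_nonneg fun q hq => ?_
            have : (1 : ℝ) ≤ q := by
              exact_mod_cast (mem_primesBetween.1 (mem_inter.1 hq).1).1.one_lt.le
            exact inv_nonneg.2 (by linarith))
        _ ≤ 165 / 16000 * i + 165 / 16000 := add_le_add ih h1
        _ = _ := by push_cast; ring
  have h2 := key (1600 * m)
  have e : (-(16 * m : ℝ) + (1600 * m : ℕ) / 100) = 0 := by push_cast; ring
  rw [e, Real.exp_zero, Real.rpow_one] at h2
  refine h2.trans (le_of_eq ?_)
  push_cast; ring

/-- Chebyshev's lower bound. -/
lemma eventually_le_card_primesLE :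
    ∀ᶠ T : ℝ in atTop, T / (2 * Real.log T) ≤ (#(⌊T⌋₊).primesLE : ℝ) := by
  have h1 : ∀ᶠ T : ℝ in atTop, Real.log T ≤ (1 / 100) * T := by
    have := Real.isLittleO_log_id_atTop.bound (c := 1 / 100) (by norm_num)
    filter_upwards [this, eventually_ge_atTop 1] with T hT hT1
    simp only [id, Real.norm_eq_abs] at hT
    rw [abs_of_nonneg (Real.log_nonneg hT1), abs_of_nonneg (by linarith)] at hT
    exact hT
  filter_upwards [h1, eventually_ge_atTop 100] with T hT hT1
  have h2 := Chebyshev.pi_ge' (x := T) (by linarith)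
  have hl : 0 < Real.log T := Real.log_pos (by linarith)
  have e : (#(⌊T⌋₊).primesLE : ℝ) = (⌊T⌋₊.primeCounting : ℝ) := by
    congr 1
    simp
  rw [e]
  refine le_trans ?_ h2
  have h3 : Real.log (T + 2) ≤ Real.log 2 + Real.log T := by
    rw [← Real.log_mul (by norm_num) (by linarith)]
    exact Real.log_le_log (by linarith) (by linarith)
  have := Real.log_two_gt_d9
  have := Real.log_two_lt_d9
  rw [mul_comm 2, ← div_div, div_right_comm]
  gcongr
  nlinarith

end OrderInIntervals

namespace OrderInIntervals

open Finset Filter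

lemma log_le_sum_of_smooth {y : ℝ} {s n N : ℕ} (hn : n ≠ 0) (hnN : n ≤ N) (hsn : s ∣ n)
    (hs : ∀ q : ℕ, q.Prime → q ∣ s → (q : ℝ) ≤ y) :
    Real.log s ≤ ∑ q ∈ primesBetween 1 y, ∑ k ∈ Icc 1 (Nat.log 2 N),
      if q ^ k ∣ n then Real.log q else 0 := by
  have hs0 : s ≠ 0 := ne_zero_of_dvd_ne_zero hn hsn
  rw [Real.log_nat_eq_sum_factorization, Finsupp.sum, Nat.support_factorization]
  have hlog : ∀ q : ℕ, 0 ≤ Real.log q := fun q => Real.log_natCast_nonneg q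
  have hsub : s.primeFactors ⊆ primesBetween 1 y := by
    intro q hq
    have hp := Nat.prime_of_mem_primeFactors hq
    rw [mem_primesBetween]
    exact ⟨hp, by exact_mod_cast hp.one_lt, hs q hp (Nat.dvd_of_mem_primeFactors hq)⟩
  refine le_trans (sum_le_sum fun q hq => ?_) (sum_le_sum_of_subset_of_nonneg hsub
    fun q _ _ => sum_nonneg fun k _ => by split_ifs <;> simp [hlog])
  have hp := Nat.prime_of_mem_primeFactors hq
  have hv : s.factorization q ≤ Nat.log 2 N := by
    apply Nat.le_log_of_pow_le (by norm_num)
    calc 2 ^ s.factorization q ≤ q ^ s.factorization q := Nat.pow_le_pow_left hp.two_le _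
      _ ≤ s := Nat.le_of_dvd (Nat.pos_of_ne_zero hs0) (Nat.ordProj_dvd s q)
      _ ≤ N := (Nat.le_of_dvd (Nat.pos_of_ne_zero hn) hsn).trans hnN
  calc (s.factorization q : ℝ) * Real.log q
      = ∑ k ∈ Icc 1 (s.factorization q), Real.log q := by simp
    _ = ∑ k ∈ Icc 1 (s.factorization q), if q ^ k ∣ n then Real.log q else 0 := by
        refine sum_congr rfl fun k hk => ?_
        rw [if_pos]
        exact ((pow_dvd_pow q (mem_Icc.1 hk).2).trans (Nat.ordProj_dvd s q)).trans hsn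
    _ ≤ _ := sum_le_sum_of_subset_of_nonneg (Icc_subset_Icc_right hv)
        fun k _ _ => by split_ifs <;> simp [hlog]

lemma sum_card_dvd_pow_le {T : ℝ} (hT : 1 < T) {q : ℕ} (hq : q.Prime) (L : ℕ) :
    ∑ k ∈ Icc 1 L, ((#{p ∈ (⌊T⌋₊).primesLE | q ^ k ∣ p - 1} : ℕ) : ℝ)
      ≤ 480 * T / Real.log T * (1 / q) + L * T ^ (1 / 10 : ℝ) := by
  have hl := Real.log_pos hT
  have hq2 : (2 : ℝ) ≤ q := by exact_mod_cast hq.two_le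
  have hT0 : 0 < T := by linarith
  have h1 : ∀ k ∈ Icc 1 L, ((#{p ∈ (⌊T⌋₊).primesLE | q ^ k ∣ p - 1} : ℕ) : ℝ)
      ≤ 240 * T / Real.log T * (1 / q) * (1 / q) ^ (k - 1) + T ^ (1 / 10 : ℝ) := by
    intro k hk
    have hk1 := (mem_Icc.1 hk).1
    rcases le_or_gt ((q : ℝ) ^ k) (T ^ (9 / 10 : ℝ)) with h | h
    · have h2 := card_primes_dvd_sub_one_le hT (d := q ^ k) (Nat.one_le_pow _ _ hq.pos)
        (by push_cast; exact h)
      have h3 : ((q ^ k).totient : ℝ) = q ^ (k - 1) * (q - 1) := by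
        rw [Nat.totient_prime_pow hq (by omega)]
        push_cast [Nat.cast_sub hq.one_lt.le]
        ring
      rw [h3] at h2
      refine h2.trans ?_
      have h4 : 120 * T / ((q : ℝ) ^ (k - 1) * (q - 1) * Real.log T)
          = 120 * T / Real.log T * (1 / (q - 1)) * (1 / q) ^ (k - 1) := by
        rw [one_div_pow]
        field_simp
      have h5 : 1 / ((q : ℝ) - 1) ≤ 2 * (1 / q) := by
        rw [← div_eq_mul_one_div, div_le_div_iff₀ (by linarith) (by linarith)]
        linarith
      rw [h4]
      calc _ ≤ 120 * T / Real.log T * (2 * (1 / q)) * (1 / (q : ℝ)) ^ (k - 1) := by gcongr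
        _ = 240 * T / Real.log T * (1 / q) * (1 / (q : ℝ)) ^ (k - 1) + 0 := by ring
        _ ≤ _ := by gcongr; positivity
    · have h2 := card_primes_dvd_sub_one_le_div hT0.le (d := q ^ k) (Nat.one_le_pow _ _ hq.pos)
      refine h2.trans ?_
      calc T / ((q ^ k : ℕ) : ℝ) ≤ T / T ^ (9 / 10 : ℝ) := by push_cast; gcongr
        _ = 0 + T ^ (1 / 10 : ℝ) := by
          nth_rewrite 1 [← Real.rpow_one T]
          rw [← Real.rpow_sub hT0]; norm_num
        _ ≤ _ := by gcongr; positivity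
  refine (sum_le_sum h1).trans ?_
  rw [sum_add_distrib, ← mul_sum]
  have h2 : ∑ k ∈ Icc 1 L, (1 / (q : ℝ)) ^ (k - 1) ≤ 2 := by
    have e : ∑ k ∈ Icc 1 L, (1 / (q : ℝ)) ^ (k - 1) = ∑ k ∈ range L, (1 / (q : ℝ)) ^ k := by
      rw [range_eq_Ico, sum_Ico_eq_sum_range, ← Ico_add_one_right_eq_Icc, sum_Ico_eq_sum_range]
      simp
    rw [e]
    have h3 : (1 : ℝ) / q ≤ 1 / 2 := by gcongr
    calc ∑ k ∈ range L, (1 / (q : ℝ)) ^ k ≤ ∑ k ∈ range L, (1 / (2 : ℝ)) ^ k := by gcongr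
      _ ≤ 2 := sum_geometric_two_le L
  calc _ ≤ 240 * T / Real.log T * (1 / q) * 2 + ∑ k ∈ Icc 1 L, T ^ (1 / 10 : ℝ) := by gcongr
    _ = _ := by simp; ring

open Classical in
/-- Few shifted primes `p - 1` have a large smooth divisor. -/
theorem eventually_card_smooth_divisor_le {γ σ : ℝ} (hγ : 0 < γ) (hγ' : γ ≤ 1 / 3) (hσ : 0 < σ) :
    ∀ᶠ T : ℝ in atTop, ((#{p ∈ (⌊T⌋₊).primesLE | ∃ s : ℕ, s ∣ p - 1 ∧
      (∀ q : ℕ, q.Prime → q ∣ s → (q : ℝ) ≤ T ^ γ) ∧ T ^ σ < s} : ℕ) : ℝ)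
      ≤ 500 * γ / σ * (T / Real.log T) := by
  have hε : ∀ᶠ T : ℝ in atTop, Real.log T ^ 3 ≤ γ * T ^ (1 / 10 : ℝ) := by
    have := (isLittleO_log_rpow_rpow_atTop (s := 1 / 10) 3 (by norm_num)).bound hγ
    filter_upwards [this, eventually_ge_atTop 1] with T hT hT1
    have h0 := Real.log_nonneg hT1
    rw [Real.norm_of_nonneg (by positivity), Real.norm_of_nonneg (by positivity)] at hT
    exact_mod_cast hT
  have hε2 : ∀ᶠ T : ℝ in atTop, 3840 ≤ γ * Real.log T := by
    have := (Real.tendsto_log_atTop.const_mul_atTop hγ).eventually_ge_atTop 3840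
    exact this
  filter_upwards [hε, hε2, eventually_gt_atTop 1] with T h1 h2 hT
  have hT0 : 0 < T := by linarith
  have hl := Real.log_pos hT
  set y := T ^ γ
  have hy1 : 1 ≤ y := Real.one_le_rpow hT.le hγ.le
  set L := Nat.log 2 ⌊T⌋₊
  set S := ({p ∈ (⌊T⌋₊).primesLE | ∃ s : ℕ, s ∣ p - 1 ∧
      (∀ q : ℕ, q.Prime → q ∣ s → (q : ℝ) ≤ y) ∧ T ^ σ < s} : Finset ℕ)
  have hL : (L : ℝ) ≤ 2 * Real.log T := by
    have h3 : 2 ^ L ≤ ⌊T⌋₊ := Nat.pow_log_le_self 2 (Nat.floor_pos.2 hT.le).ne'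
    have h4 : ((2 : ℝ)) ^ L ≤ T := by
      calc (2 : ℝ) ^ L = ((2 ^ L : ℕ) : ℝ) := by push_cast; rfl
        _ ≤ ⌊T⌋₊ := by exact_mod_cast h3
        _ ≤ T := Nat.floor_le hT0.le
    have h5 := Real.log_le_log (by positivity) h4
    rw [Real.log_pow] at h5
    have := Real.log_two_gt_d9
    have : (0 : ℝ) ≤ L := by positivity
    nlinarith
  have h3 : #S * (σ * Real.log T) ≤ ∑ p ∈ (⌊T⌋₊).primesLE, ∑ q ∈ primesBetween 1 y,
      ∑ k ∈ Icc 1 L, if q ^ k ∣ p - 1 then Real.log q else 0 := by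
    rw [← nsmul_eq_mul, ← sum_const]
    refine le_trans (sum_le_sum fun p hp => ?_) (sum_le_sum_of_subset_of_nonneg (filter_subset _ _)
      fun p _ _ => sum_nonneg fun q _ => sum_nonneg fun k _ => by
        split_ifs <;> simp [Real.log_natCast_nonneg])
    obtain ⟨hp1, s, hs1, hs2, hs3⟩ := mem_filter.1 hp
    rw [Nat.mem_primesLE] at hp1
    have := hp1.2.one_lt
    refine le_trans ?_ (log_le_sum_of_smooth (by omega) (by omega) hs1 hs2)
    rw [← Real.log_rpow hT0]
    exact Real.log_le_log (by positivity) hs3.le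
  have h4 : ∑ p ∈ (⌊T⌋₊).primesLE, ∑ q ∈ primesBetween 1 y,
      ∑ k ∈ Icc 1 L, (if q ^ k ∣ p - 1 then Real.log q else 0)
      = ∑ q ∈ primesBetween 1 y, Real.log q *
        ∑ k ∈ Icc 1 L, ((#{p ∈ (⌊T⌋₊).primesLE | q ^ k ∣ p - 1} : ℕ) : ℝ) := by
    rw [sum_comm]
    refine sum_congr rfl fun q _ => ?_
    rw [sum_comm, mul_sum]
    refine sum_congr rfl fun k _ => ?_
    rw [card_filter, Nat.cast_sum, mul_sum]
    refine sum_congr rfl fun p _ => ?_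
    split_ifs <;> simp
  rw [h4] at h3
  have hlogy : Real.log y = γ * Real.log T := Real.log_rpow hT0 γ
  have h5 : ∑ q ∈ primesBetween 1 y, Real.log q *
        ∑ k ∈ Icc 1 L, ((#{p ∈ (⌊T⌋₊).primesLE | q ^ k ∣ p - 1} : ℕ) : ℝ)
      ≤ 480 * T / Real.log T * (γ * Real.log T + 8)
        + y * (γ * Real.log T) * (L * T ^ (1 / 10 : ℝ)) := by
    calc _ ≤ ∑ q ∈ primesBetween 1 y, (480 * T / Real.log T * (Real.log q / q)
            + Real.log y * (L * T ^ (1 / 10 : ℝ))) := by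
          refine sum_le_sum fun q hq => ?_
          rw [mem_primesBetween] at hq
          have h6 := sum_card_dvd_pow_le hT hq.1 L
          have h7 : Real.log q ≤ Real.log y :=
            Real.log_le_log (by exact_mod_cast hq.1.pos) hq.2.2
          have h8 := Real.log_natCast_nonneg q
          calc _ ≤ Real.log q * (480 * T / Real.log T * (1 / q) + L * T ^ (1 / 10 : ℝ)) := by
                gcongr
            _ = 480 * T / Real.log T * (Real.log q / q)
                + Real.log q * (L * T ^ (1 / 10 : ℝ)) := by ring
            _ ≤ _ := by gcongr
      _ = 480 * T / Real.log T * ∑ q ∈ primesBetween 1 y, Real.log q / q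
            + #(primesBetween 1 y) * (Real.log y * (L * T ^ (1 / 10 : ℝ))) := by
          rw [sum_add_distrib, ← mul_sum, sum_const, nsmul_eq_mul]
      _ ≤ 480 * T / Real.log T * (γ * Real.log T + 8)
            + y * (Real.log y * (L * T ^ (1 / 10 : ℝ))) := by
          have h6 := sum_log_div_primesBetween_le le_rfl hy1
          rw [Real.log_one, sub_zero, hlogy] at h6
          have h7 : (#(primesBetween 1 y) : ℝ) ≤ y := by
            have : #(primesBetween 1 y) ≤ #(Icc 1 ⌊y⌋₊) := by
              refine card_le_card fun q hq => ?_
              rw [mem_primesBetween] at hq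
              exact mem_Icc.2 ⟨hq.1.pos, Nat.le_floor hq.2.2⟩
            rw [Nat.card_Icc, Nat.add_sub_cancel] at this
            exact le_trans (by exact_mod_cast this) (Nat.floor_le (by linarith))
          have h8 : 0 ≤ Real.log y := Real.log_nonneg hy1
          gcongr
      _ = _ := by rw [hlogy]; ring
  have h6 : y * (γ * Real.log T) * (L * T ^ (1 / 10 : ℝ)) * Real.log T ≤ γ * T * Real.log T := by
    have h7 : y ≤ T ^ (1 / 3 : ℝ) := Real.rpow_le_rpow_of_exponent_le hT.le hγ'
    have h9 : T ^ (1 / 3 : ℝ) * (T ^ (1 / 10 : ℝ) * T ^ (1 / 10 : ℝ)) ≤ T := by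
      rw [← Real.rpow_add hT0, ← Real.rpow_add hT0]
      conv_rhs => rw [← Real.rpow_one T]
      exact Real.rpow_le_rpow_of_exponent_le hT.le (by norm_num)
    have h10 : 1 ≤ Real.log T := by nlinarith
    calc y * (γ * Real.log T) * (L * T ^ (1 / 10 : ℝ)) * Real.log T
        ≤ T ^ (1 / 3 : ℝ) * (γ * Real.log T) * ((2 * Real.log T) * T ^ (1 / 10 : ℝ))
          * Real.log T := by gcongr
      _ = 2 * γ * T ^ (1 / 3 : ℝ) * T ^ (1 / 10 : ℝ) * Real.log T ^ 3 := by ring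
      _ ≤ 2 * γ * T ^ (1 / 3 : ℝ) * T ^ (1 / 10 : ℝ) * (γ * T ^ (1 / 10 : ℝ)) := by gcongr
      _ = 2 * γ * γ * (T ^ (1 / 3 : ℝ) * (T ^ (1 / 10 : ℝ) * T ^ (1 / 10 : ℝ))) := by ring
      _ ≤ 2 * γ * γ * T := by gcongr
      _ ≤ γ * T * 1 := by nlinarith [mul_pos hγ hT0]
      _ ≤ γ * T * Real.log T := by gcongr
  have h7 : #S * (σ * Real.log T) * Real.log T ≤ 500 * γ * T * Real.log T := by
    have h8 : 480 * T / Real.log T * (γ * Real.log T + 8) * Real.log T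
        = 480 * T * (γ * Real.log T + 8) := by field_simp
    have h9 := mul_le_mul_of_nonneg_right (h3.trans h5) hl.le
    rw [add_mul, h8] at h9
    have h10 : 480 * T * (γ * Real.log T + 8) ≤ 480 * T * γ * Real.log T + T * (γ * Real.log T) := by
      nlinarith
    nlinarith [mul_pos (mul_pos hγ hT0) hl]
  have h8 := le_of_mul_le_mul_right h7 hl
  rw [div_mul_div_comm, le_div_iff₀ (by positivity)]
  linarith

lemma totient_prod_primes {U : Finset ℕ} (hU : ∀ q ∈ U, q.Prime) :
    (((∏ q ∈ U, q).totient : ℕ) : ℝ) = ∏ q ∈ U, ((q : ℝ) - 1) := by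
  induction U using Finset.induction_on with
  | empty => simp
  | insert a s ha ih =>
    rw [prod_insert ha, prod_insert ha, Nat.totient_mul, Nat.cast_mul,
      ih fun q hq => hU q (mem_insert_of_mem hq), Nat.totient_prime (hU a (mem_insert_self _ _)),
      Nat.cast_sub (hU a (mem_insert_self _ _)).one_lt.le, Nat.cast_one]
    refine Nat.Coprime.prod_right fun q hq => ?_
    rw [Nat.coprime_primes (hU a (mem_insert_self _ _)) (hU q (mem_insert_of_mem hq))]
    rintro rfl
    exact ha hq

lemma card_prod_dvd_le {T : ℝ} (hT : 1 < T) {U : Finset ℕ} (hU : ∀ q ∈ U, q.Prime)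
    (hUT : ((∏ q ∈ U, q : ℕ) : ℝ) ≤ T ^ (9 / 10 : ℝ)) :
    ((#{p ∈ (⌊T⌋₊).primesLE | ∏ q ∈ U, q ∣ p - 1} : ℕ) : ℝ)
      ≤ 120 * (T / Real.log T) * ∏ q ∈ U, ((q : ℝ) - 1)⁻¹ := by
  have h := card_primes_dvd_sub_one_le hT (d := ∏ q ∈ U, q)
    (Nat.one_le_iff_ne_zero.2 (prod_ne_zero_iff.2 fun q hq => (hU q hq).ne_zero)) hUT
  refine h.trans (le_of_eq ?_)
  rw [totient_prod_primes hU, prod_inv_distrib]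
  have : ∏ q ∈ U, ((q : ℝ) - 1) ≠ 0 := by
    refine prod_ne_zero_iff.2 fun q hq => ?_
    have : (1 : ℝ) < q := by exact_mod_cast (hU q hq).one_lt
    linarith
  have := Real.log_pos hT
  field_simp

lemma pow_add_mul_le_add_pow {x y : ℝ} (hx : 0 ≤ x) (hy : 0 ≤ y) (m : ℕ) :
    x ^ (m + 1) + (m + 1) * y * x ^ m ≤ (y + x) ^ (m + 1) := by
  induction m with
  | zero => simp; linarith
  | succ m ih =>
    have h1 : (y + x) * (x ^ (m + 1) + (m + 1) * y * x ^ m) ≤ (y + x) * (y + x) ^ (m + 1) := by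
      gcongr
    have h2 : 0 ≤ (m + 1) * y * y * x ^ m := by positivity
    calc _ = (y + x) * (x ^ (m + 1) + (m + 1) * y * x ^ m) - (m + 1) * y * y * x ^ m := by
          push_cast; ring
      _ ≤ (y + x) * (y + x) ^ (m + 1) := by linarith
      _ = _ := by ring

lemma sum_powersetCard_prod_le {ι : Type*} [DecidableEq ι] {s : Finset ι} {f : ι → ℝ}
    (hf : ∀ i ∈ s, 0 ≤ f i) (m : ℕ) :
    ∑ t ∈ powersetCard m s, ∏ i ∈ t, f i ≤ (∑ i ∈ s, f i) ^ m / m.factorial := by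
  induction s using Finset.induction_on generalizing m with
  | empty =>
    cases m with
    | zero => simp
    | succ m => rw [powersetCard_eq_empty.2 (by simp)]; simp
  | insert a s ha ih =>
    have hs : ∀ i ∈ s, 0 ≤ f i := fun i hi => hf i (mem_insert_of_mem hi)
    have hfa := hf a (mem_insert_self _ _)
    have hS : 0 ≤ ∑ i ∈ s, f i := sum_nonneg hs
    cases m with
    | zero => simp
    | succ m =>
      rw [powersetCard_succ_insert ha, sum_union, sum_image, sum_insert ha]
      · have h1 : ∑ t ∈ powersetCard m s, ∏ i ∈ insert a t, f i
            = f a * ∑ t ∈ powersetCard m s, ∏ i ∈ t, f i := by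
          rw [mul_sum]
          refine sum_congr rfl fun t ht => prod_insert fun h => ha ?_
          exact (mem_powersetCard.1 ht).1 h
        rw [h1]
        have h2 := ih hs (m + 1)
        have h3 := ih hs m
        have h4 : (∑ i ∈ s, f i) ^ (m + 1) + (m + 1) * f a * (∑ i ∈ s, f i) ^ m
            ≤ (f a + ∑ i ∈ s, f i) ^ (m + 1) := by
          exact pow_add_mul_le_add_pow hS hfa m
        have h5 : ((m + 1).factorial : ℝ) = (m + 1) * m.factorial := by
          rw [Nat.factorial_succ]; push_cast; ring
        calc _ ≤ (∑ i ∈ s, f i) ^ (m + 1) / (m + 1).factorial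
              + f a * ((∑ i ∈ s, f i) ^ m / m.factorial) := by gcongr
          _ = ((∑ i ∈ s, f i) ^ (m + 1) + (m + 1) * f a * (∑ i ∈ s, f i) ^ m)
              / (m + 1).factorial := by
            rw [h5]; field_simp
          _ ≤ _ := by gcongr
      · intro t ht u hu htu
        have h1 : a ∉ t := fun h => ha ((mem_powersetCard.1 ht).1 h)
        have h2 : a ∉ u := fun h => ha ((mem_powersetCard.1 hu).1 h)
        rw [← erase_insert h1, ← erase_insert h2]
        exact congrArg (fun w => erase w a) htu
      · rw [disjoint_left]
        intro t ht ht'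
        obtain ⟨u, hu, rfl⟩ := mem_image.1 ht'
        exact ha ((mem_powersetCard.1 ht).1 (mem_insert_self _ _))

lemma sum_powerset_card_le_prod_le {ι : Type*} [DecidableEq ι] {s : Finset ι} {f : ι → ℝ}
    (hf : ∀ i ∈ s, 0 ≤ f i) (J : ℕ) :
    ∑ t ∈ s.powerset with #t ≤ J, ∏ i ∈ t, f i ≤ 2 ^ J * Real.exp ((∑ i ∈ s, f i) / 2) := by
  have h1 : ∀ t ∈ s.powerset, 0 ≤ ∏ i ∈ t, f i / 2 := fun t ht =>
    prod_nonneg fun i hi => div_nonneg (hf i (mem_powerset.1 ht hi)) (by norm_num)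
  calc ∑ t ∈ s.powerset with #t ≤ J, ∏ i ∈ t, f i
      ≤ ∑ t ∈ s.powerset with #t ≤ J, 2 ^ J * ∏ i ∈ t, f i / 2 := by
        refine sum_le_sum fun t ht => ?_
        rw [mem_filter] at ht
        have h2 : ∏ i ∈ t, f i = 2 ^ #t * ∏ i ∈ t, f i / 2 := by
          rw [← prod_const, ← prod_mul_distrib]
          exact prod_congr rfl fun i _ => by ring
        rw [h2]
        gcongr
        · exact h1 t ht.1
        · norm_num
        · exact ht.2
    _ ≤ ∑ t ∈ s.powerset, 2 ^ J * ∏ i ∈ t, f i / 2 :=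
        sum_le_sum_of_subset_of_nonneg (filter_subset _ _) fun t ht _ =>
          mul_nonneg (by positivity) (h1 t ht)
    _ = 2 ^ J * ∏ i ∈ s, (1 + f i / 2) := by rw [← mul_sum, prod_one_add]
    _ ≤ 2 ^ J * ∏ i ∈ s, Real.exp (f i / 2) := by
        gcongr with i hi
        · intro i hi
          have := hf i hi
          positivity
        · rw [add_comm]; exact Real.add_one_le_exp _
    _ = _ := by rw [← Real.exp_sum, sum_div]

/-- Discarding the largest elements gives a subset whose sum is at most its proportional share. -/
lemma exists_subset_card_mul_sum_le {ι : Type*} [DecidableEq ι] (g : ι → ℝ) {N : ℕ}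
    (hN : 0 < N) (k : ℕ) (s : Finset ι) (hs : #s = N + k) :
    ∃ t ⊆ s, #t = N ∧ #s * ∑ i ∈ t, g i ≤ N * ∑ i ∈ s, g i := by
  induction k generalizing s with
  | zero => exact ⟨s, Subset.rfl, by simpa using hs, by rw [hs]; simp⟩
  | succ k ih =>
    obtain ⟨a, ha, hmax⟩ := exists_max_image s g (card_pos.1 (by omega))
    have hcard : #(s.erase a) = N + k := by rw [card_erase_of_mem ha]; omega
    obtain ⟨t, hts, htN, ht⟩ := ih (s.erase a) hcard
    refine ⟨t, hts.trans (erase_subset _ _), htN, ?_⟩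
    have h1 : ∑ i ∈ s, g i ≤ #s * g a := by
      rw [← nsmul_eq_mul, ← sum_const]
      exact sum_le_sum hmax
    have h2 : ∑ i ∈ s.erase a, g i = ∑ i ∈ s, g i - g a := by
      rw [← sum_erase_add s g ha]; ring
    have hNk : (0 : ℝ) < N + k := by positivity
    rw [hcard, h2] at ht
    rw [hs] at h1 ⊢
    push_cast at *
    have h3 : (N + k : ℝ) * ((N + (k + 1)) * ∑ i ∈ t, g i) ≤ (N + k) * (N * ∑ i ∈ s, g i) := by
      have h4 : (N + (k + 1) : ℝ) * (∑ i ∈ s, g i - g a) ≤ (N + k) * ∑ i ∈ s, g i := by linarith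
      calc _ = (N + (k + 1) : ℝ) * ((N + k) * ∑ i ∈ t, g i) := by ring
        _ ≤ (N + (k + 1) : ℝ) * (N * (∑ i ∈ s, g i - g a)) := by gcongr
        _ = N * ((N + (k + 1) : ℝ) * (∑ i ∈ s, g i - g a)) := by ring
        _ ≤ N * ((N + k) * ∑ i ∈ s, g i) := by gcongr
        _ = _ := by ring
    exact le_of_mul_le_mul_left h3 hNk

lemma inv_natCast_sub_one_nonneg {q : ℕ} (hq : q.Prime) : 0 ≤ ((q : ℝ) - 1)⁻¹ := by
  have : (1 : ℝ) ≤ q := by exact_mod_cast hq.one_lt.le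
  exact inv_nonneg.2 (by linarith)

lemma sum_primesBetween_window_le {w a b P : ℝ} (hw : 2 ≤ w) (ha : 0 < a) (hab : a ≤ b)
    (hP : 0 < P) :
    ∑ q ∈ primesBetween (max w (a / P)) (b / P), ((q : ℝ) - 1)⁻¹
      ≤ 2 * ((Real.log b - Real.log a + 8) / Real.log w) := by
  set x := max w (a / P)
  have hwx : w ≤ x := le_max_left _ _
  have hlw : 0 < Real.log w := Real.log_pos (by linarith)
  have hlab : Real.log a ≤ Real.log b := Real.log_le_log ha hab
  rcases le_or_gt x (b / P) with h | h
  · refine (sum_inv_sub_one_primesBetween_le (by linarith) h).trans ?_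
    have h1 : Real.log (b / P) = Real.log b - Real.log P :=
      Real.log_div (by linarith) hP.ne'
    have h2 : Real.log a - Real.log P ≤ Real.log x := by
      rw [← Real.log_div ha.ne' hP.ne']
      exact Real.log_le_log (by positivity) (le_max_right _ _)
    have h3 : Real.log w ≤ Real.log x := Real.log_le_log (by linarith) hwx
    have h4 : 1 + 1 / (x - 1) ≤ 2 := by
      have : 1 / (x - 1) ≤ 1 := by
        rw [div_le_one (by linarith)]; linarith
      linarith
    have h5 : 0 ≤ 1 + 1 / (x - 1) := by
      have : 0 < x - 1 := by linarith
      positivity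
    have h6 := Real.log_le_log (by linarith : (0 : ℝ) < x) h
    have h7 : (Real.log (b / P) - Real.log x + 8) / Real.log x
        ≤ (Real.log b - Real.log a + 8) / Real.log w := by
      apply div_le_div₀ <;> linarith
    apply mul_le_mul h4 h7 ?_ (by norm_num)
    apply div_nonneg <;> linarith
  · have : primesBetween x (b / P) = ∅ := by
      apply eq_empty_of_forall_notMem
      intro q hq
      rw [mem_primesBetween] at hq
      linarith [hq.2.1, hq.2.2]
    rw [this, sum_empty]
    have : 0 ≤ Real.log b - Real.log a + 8 := by linarith
    positivity

lemma sum_prod_window_le {Q : Finset ℕ} (hQ : ∀ q ∈ Q, q.Prime) {w a b : ℝ} {J : ℕ}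
    (hw : 2 ≤ w) (ha : w ^ J ≤ a) (hab : a ≤ b) :
    ∑ U ∈ Q.powerset.filter (fun U : Finset ℕ =>
        #U ≤ J ∧ a < ∏ q ∈ U, (q : ℝ) ∧ ∏ q ∈ U, (q : ℝ) ≤ b),
      ∏ q ∈ U, ((q : ℝ) - 1)⁻¹
      ≤ 2 ^ J * Real.exp ((∑ q ∈ Q, ((q : ℝ) - 1)⁻¹) / 2)
        * (2 * ((Real.log b - Real.log a + 8) / Real.log w)) := by
  set f : ℕ → ℝ := fun q => ((q : ℝ) - 1)⁻¹
  set 𝒰 : Finset (Finset ℕ) :=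
    Q.powerset.filter fun U : Finset ℕ =>
      #U ≤ J ∧ a < ∏ q ∈ U, (q : ℝ) ∧ ∏ q ∈ U, (q : ℝ) ≤ b
  have ha0 : 0 < a := lt_of_lt_of_le (by positivity) ha
  have hf : ∀ q ∈ Q, 0 ≤ f q := fun q hq => inv_natCast_sub_one_nonneg (hQ q hq)
  have hbig : ∀ U ∈ 𝒰, ∃ q ∈ U, w < (q : ℝ) := by
    intro U hU
    by_contra! h
    obtain ⟨-, h2, h3, -⟩ := mem_filter.1 hU
    have : ∏ q ∈ U, (q : ℝ) ≤ w ^ J := by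
      calc ∏ q ∈ U, (q : ℝ) ≤ ∏ q ∈ U, w := prod_le_prod (fun _ _ => by positivity) h
        _ = w ^ #U := by simp
        _ ≤ w ^ J := pow_le_pow_right₀ (by linarith) h2
    linarith
  choose! c hcU hcw using hbig
  let φ : Finset ℕ → (_ : Finset ℕ) × ℕ := fun U => ⟨U.erase (c U), c U⟩
  have hφ : Set.InjOn φ 𝒰 := by
    intro U hU V hV h
    rw [Sigma.mk.injEq] at h
    have h2 : c U = c V := eq_of_heq h.2
    rw [← insert_erase (hcU U hU), ← insert_erase (hcU V hV), h.1, h2]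
  let g : (_ : Finset ℕ) × ℕ → ℝ := fun z => f z.2 * ∏ q ∈ z.1, f q
  have h1 : ∑ U ∈ 𝒰, ∏ q ∈ U, f q = ∑ z ∈ 𝒰.image φ, g z := by
    rw [sum_image hφ]
    exact sum_congr rfl fun U hU => (mul_prod_erase U f (hcU U hU)).symm
  have hpos : ∀ V ∈ Q.powerset, 0 < ∏ q ∈ V, (q : ℝ) := fun V hV => prod_pos fun q hq => by
    exact_mod_cast (hQ q (mem_powerset.1 hV hq)).pos
  have h2 : 𝒰.image φ ⊆ ({V ∈ Q.powerset | #V ≤ J} : Finset (Finset ℕ)).sigma fun V =>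
      primesBetween (max w (a / ∏ q ∈ V, (q : ℝ))) (b / ∏ q ∈ V, (q : ℝ)) := by
    intro z hz
    obtain ⟨U, hU, rfl⟩ := mem_image.1 hz
    obtain ⟨k1, k2, k3, k4⟩ := mem_filter.1 hU
    have hV : U.erase (c U) ∈ Q.powerset :=
      mem_powerset.2 ((erase_subset _ _).trans (mem_powerset.1 k1))
    have hP := hpos _ hV
    rw [← mul_prod_erase U _ (hcU U hU)] at k3 k4
    simp only [φ, mem_sigma, mem_filter, mem_primesBetween, max_lt_iff]
    refine ⟨⟨hV, (card_erase_le).trans k2⟩, hQ _ (mem_powerset.1 k1 (hcU U hU)),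
      ⟨hcw U hU, ?_⟩, ?_⟩
    · rwa [div_lt_iff₀ hP]
    · rwa [le_div_iff₀ hP]
  have hprodnn : ∀ V ∈ Q.powerset, 0 ≤ ∏ q ∈ V, f q := fun V hV =>
    prod_nonneg fun q hq => hf q (mem_powerset.1 hV hq)
  rw [h1]
  have hC : 0 ≤ 2 * ((Real.log b - Real.log a + 8) / Real.log w) := by
    have := Real.log_pos (by linarith : (1 : ℝ) < w)
    have := Real.log_le_log ha0 hab
    have : 0 ≤ Real.log b - Real.log a + 8 := by linarith
    positivity
  calc _ ≤ ∑ z ∈ ({V ∈ Q.powerset | #V ≤ J} : Finset (Finset ℕ)).sigma fun V =>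
      primesBetween (max w (a / ∏ q ∈ V, (q : ℝ))) (b / ∏ q ∈ V, (q : ℝ)), g z := by
        refine sum_le_sum_of_subset_of_nonneg h2 fun z hz _ => ?_
        rw [mem_sigma, mem_filter, mem_primesBetween] at hz
        exact mul_nonneg (inv_natCast_sub_one_nonneg hz.2.1) (hprodnn _ hz.1.1)
    _ = ∑ V ∈ Q.powerset with #V ≤ J, (∏ q ∈ V, f q) *
          ∑ q ∈ primesBetween (max w (a / ∏ q ∈ V, (q : ℝ))) (b / ∏ q ∈ V, (q : ℝ)), f q := by
        rw [sum_sigma]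
        refine sum_congr rfl fun V _ => ?_
        rw [mul_sum]
        exact sum_congr rfl fun q _ => mul_comm _ _
    _ ≤ ∑ V ∈ Q.powerset with #V ≤ J, (∏ q ∈ V, f q) *
          (2 * ((Real.log b - Real.log a + 8) / Real.log w)) := by
        refine sum_le_sum fun V hV => ?_
        rw [mem_filter] at hV
        exact mul_le_mul_of_nonneg_left (sum_primesBetween_window_le hw ha0 hab (hpos V hV.1))
          (hprodnn V hV.1)
    _ ≤ _ := by
        rw [← sum_mul]
        exact mul_le_mul_of_nonneg_right (sum_powerset_card_le_prod_le hf J) hC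

open Classical in
lemma card_few_large_primes_le {T y w a b : ℝ} {J : ℕ} (hT : 1 < T)
    (hw : 2 ≤ w) (ha : w ^ J ≤ a) (hab : a ≤ b) (hb : b ≤ T ^ (9 / 10 : ℝ)) :
    ((#{p ∈ (⌊T⌋₊).primesLE | ∃ U ⊆ primesBetween y T, #U ≤ J ∧ a < ∏ q ∈ U, (q : ℝ) ∧
      ∏ q ∈ U, (q : ℝ) ≤ b ∧ ∏ q ∈ U, q ∣ p - 1} : ℕ) : ℝ)
    ≤ 120 * (T / Real.log T) * (2 ^ J *
      Real.exp ((∑ q ∈ primesBetween y T, ((q : ℝ) - 1)⁻¹) / 2)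
        * (2 * ((Real.log b - Real.log a + 8) / Real.log w))) := by
  set Q := primesBetween y T
  have hQ : ∀ q ∈ Q, q.Prime := fun q hq => (mem_primesBetween.1 hq).1
  set 𝒰 : Finset (Finset ℕ) :=
    Q.powerset.filter fun U : Finset ℕ =>
      #U ≤ J ∧ a < ∏ q ∈ U, (q : ℝ) ∧ ∏ q ∈ U, (q : ℝ) ≤ b
  have h1 : ({p ∈ (⌊T⌋₊).primesLE | ∃ U ⊆ Q, #U ≤ J ∧ a < ∏ q ∈ U, (q : ℝ) ∧
      ∏ q ∈ U, (q : ℝ) ≤ b ∧ ∏ q ∈ U, q ∣ p - 1} : Finset ℕ)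
      ⊆ 𝒰.biUnion fun U => {p ∈ (⌊T⌋₊).primesLE | ∏ q ∈ U, q ∣ p - 1} := by
    intro p hp
    obtain ⟨hp1, U, hU, h2, h3, h4, h5⟩ := mem_filter.1 hp
    exact mem_biUnion.2 ⟨U, mem_filter.2 ⟨mem_powerset.2 hU, h2, h3, h4⟩,
      mem_filter.2 ⟨hp1, h5⟩⟩
  have hl := Real.log_pos hT
  calc _ ≤ ∑ U ∈ 𝒰, ((#{p ∈ (⌊T⌋₊).primesLE | ∏ q ∈ U, q ∣ p - 1} : ℕ) : ℝ) := by
        exact_mod_cast (card_le_card h1).trans card_biUnion_le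
    _ ≤ ∑ U ∈ 𝒰, 120 * (T / Real.log T) * ∏ q ∈ U, ((q : ℝ) - 1)⁻¹ := by
        refine sum_le_sum fun U hU => ?_
        obtain ⟨k1, k2, k3, k4⟩ := mem_filter.1 hU
        refine card_prod_dvd_le hT (fun q hq => hQ q (mem_powerset.1 k1 hq)) ?_
        push_cast
        exact k4.trans hb
    _ ≤ _ := by
        rw [← mul_sum]
        have : 0 ≤ T / Real.log T := by positivity
        gcongr
        exact sum_prod_window_le hQ hw ha hab

lemma pow_le_choose_mul_factorial (m : ℕ) :
    (17 * m : ℝ) ^ m ≤ (18 * m).choose m * m.factorial := by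
  have h1 := Nat.pow_sub_le_descFactorial (18 * m) m
  rw [Nat.descFactorial_eq_factorial_mul_choose] at h1
  have h2 : (17 * m) ^ m ≤ (18 * m + 1 - m) ^ m := Nat.pow_le_pow_left (by omega) m
  have h3 : ((17 * m) ^ m : ℝ) ≤ m.factorial * (18 * m).choose m := by
    exact_mod_cast h2.trans h1
  linarith

open Classical in
lemma card_many_large_primes_le {T y : ℝ} {m : ℕ} (hT : 1 < T) (hm : 1 ≤ m)
    (hy : ∑ q ∈ primesBetween y T, ((q : ℝ) - 1)⁻¹ ≤ 33 / 2 * m) :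
    ((#{p ∈ (⌊T⌋₊).primesLE | ∃ U ⊆ primesBetween y T, #U = 18 * m ∧
      ∏ q ∈ U, (q : ℝ) ≤ T ^ (9 / 10 : ℝ) ∧ ∏ q ∈ U, q ∣ p - 1} : ℕ) : ℝ)
    ≤ 120 * (T / Real.log T) * (33 / 34) ^ m := by
  set Q := primesBetween y T
  have hQ : ∀ q ∈ Q, q.Prime := fun q hq => (mem_primesBetween.1 hq).1
  have hl := Real.log_pos hT
  have hTl : 0 ≤ T / Real.log T := by positivity
  set S := ({p ∈ (⌊T⌋₊).primesLE | ∃ U ⊆ Q, #U = 18 * m ∧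
      ∏ q ∈ U, (q : ℝ) ≤ T ^ (9 / 10 : ℝ) ∧ ∏ q ∈ U, q ∣ p - 1} : Finset ℕ)
  set ℒ : Finset (Finset ℕ) := 
    (powersetCard m Q).filter fun l : Finset ℕ => ∏ q ∈ l, (q : ℝ) ≤ T ^ (9 / 10 : ℝ)
  have h1 : ∀ p ∈ S, (18 * m).choose m ≤ #{l ∈ ℒ | ∏ q ∈ l, q ∣ p - 1} := by
    intro p hp
    obtain ⟨-, U, hU, h2, h3, h4⟩ := mem_filter.1 hp
    rw [← h2, ← card_powersetCard]
    refine card_le_card fun l hl => ?_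
    rw [mem_powersetCard] at hl
    refine mem_filter.2 ⟨mem_filter.2 ⟨mem_powersetCard.2 ⟨hl.1.trans hU, hl.2⟩, ?_⟩,
      (prod_dvd_prod_of_subset _ _ _ hl.1).trans h4⟩
    refine le_trans ?_ h3
    have h5 : ∏ q ∈ l, q ≤ ∏ q ∈ U, q :=
      prod_le_prod_of_subset_of_one_le' hl.1 fun q hq _ => (hQ q (hU hq)).one_lt.le
    have h6 : ((∏ q ∈ l, q : ℕ) : ℝ) ≤ ((∏ q ∈ U, q : ℕ) : ℝ) := by exact_mod_cast h5
    push_cast at h6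
    exact h6
  have h2 : (#S : ℝ) * (18 * m).choose m
      ≤ 120 * (T / Real.log T) * ((33 / 2 * m) ^ m / m.factorial) := by
    calc (#S : ℝ) * (18 * m).choose m
        ≤ ∑ p ∈ S, ((#{l ∈ ℒ | ∏ q ∈ l, q ∣ p - 1} : ℕ) : ℝ) := by
          rw [← nsmul_eq_mul, ← sum_const]
          exact sum_le_sum fun p hp => by exact_mod_cast h1 p hp
      _ ≤ ∑ p ∈ (⌊T⌋₊).primesLE, ((#{l ∈ ℒ | ∏ q ∈ l, q ∣ p - 1} : ℕ) : ℝ) :=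
          sum_le_sum_of_subset_of_nonneg (filter_subset _ _) fun _ _ _ => by positivity
      _ = ∑ l ∈ ℒ, ((#{p ∈ (⌊T⌋₊).primesLE | ∏ q ∈ l, q ∣ p - 1} : ℕ) : ℝ) := by
          simp only [card_filter, Nat.cast_sum]
          rw [sum_comm]
      _ ≤ ∑ l ∈ ℒ, 120 * (T / Real.log T) * ∏ q ∈ l, ((q : ℝ) - 1)⁻¹ := by
          refine sum_le_sum fun l hl => ?_
          obtain ⟨k1, k2⟩ := mem_filter.1 hl
          refine card_prod_dvd_le hT (fun q hq => hQ q ((mem_powersetCard.1 k1).1 hq)) ?_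
          push_cast
          exact k2
      _ ≤ ∑ l ∈ powersetCard m Q, 120 * (T / Real.log T) * ∏ q ∈ l, ((q : ℝ) - 1)⁻¹ := by
          refine sum_le_sum_of_subset_of_nonneg (filter_subset _ _) fun l hl _ => ?_
          refine mul_nonneg (by positivity) (prod_nonneg fun q hq =>
            inv_natCast_sub_one_nonneg (hQ q ((mem_powersetCard.1 hl).1 hq)))
      _ ≤ 120 * (T / Real.log T) *
            ((∑ q ∈ Q, ((q : ℝ) - 1)⁻¹) ^ m / m.factorial) := by
          rw [← mul_sum]
          gcongr
          exact sum_powersetCard_prod_le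
            (fun q hq => inv_natCast_sub_one_nonneg (hQ q hq)) m
      _ ≤ _ := by
          have : 0 ≤ ∑ q ∈ Q, ((q : ℝ) - 1)⁻¹ :=
            sum_nonneg fun q hq => inv_natCast_sub_one_nonneg (hQ q hq)
          gcongr
  have h3 := pow_le_choose_mul_factorial m
  have hm0 : (0 : ℝ) < 17 * m := by
    have : (1 : ℝ) ≤ m := by exact_mod_cast hm
    linarith
  have h4 : (#S : ℝ) * (17 * m) ^ m ≤ 120 * (T / Real.log T) * (33 / 34) ^ m * (17 * m) ^ m := by
    calc (#S : ℝ) * (17 * m) ^ m ≤ #S * ((18 * m).choose m * m.factorial) := by gcongr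
      _ = #S * (18 * m).choose m * m.factorial := by ring
      _ ≤ 120 * (T / Real.log T) * ((33 / 2 * m) ^ m / m.factorial) * m.factorial := by gcongr
      _ = 120 * (T / Real.log T) * (33 / 2 * m) ^ m := by
        have : (m.factorial : ℝ) ≠ 0 := by positivity
        field_simp
      _ = _ := by
        rw [mul_assoc _ ((33 / 34 : ℝ) ^ m), ← mul_pow]
        congr 2; ring
  exact le_of_mul_le_mul_right h4 (by positivity)

/-- The prime factors of `n` exceeding `y`. -/
noncomputable def largePrimes (y : ℝ) (n : ℕ) : Finset ℕ := by
  classical exact {q ∈ n.primeFactors | y < q}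

lemma mem_largePrimes {y : ℝ} {n q : ℕ} :
    q ∈ largePrimes y n ↔ q.Prime ∧ q ∣ n ∧ n ≠ 0 ∧ y < q := by
  simp [largePrimes, Nat.mem_primeFactors, and_assoc]

lemma largePrimes_subset_primesBetween {y T : ℝ} {n : ℕ} (h : (n : ℝ) ≤ T) :
    largePrimes y n ⊆ primesBetween y T := by
  intro q hq
  obtain ⟨h1, h2, h3, h4⟩ := mem_largePrimes.1 hq
  refine mem_primesBetween.2 ⟨h1, h4, le_trans ?_ h⟩
  exact_mod_cast Nat.le_of_dvd (Nat.pos_of_ne_zero h3) h2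

lemma prod_largePrimes_dvd (y : ℝ) (n : ℕ) : ∏ q ∈ largePrimes y n, q ∣ n :=
  (prod_dvd_prod_of_subset _ _ _ (filter_subset _ _)).trans (Nat.prod_primeFactors_dvd n)

lemma exists_smooth_cofactor {y : ℝ} {n d : ℕ} (hn : n ≠ 0) (hd : d ∣ n)
    (hsq : ∀ q : ℕ, q.Prime → y < q → ¬ q ^ 2 ∣ n) :
    ∃ s, d = (∏ q ∈ largePrimes y d, q) * s ∧ ∀ q : ℕ, q.Prime → q ∣ s → (q : ℝ) ≤ y := by
  obtain ⟨s, hs⟩ := prod_largePrimes_dvd y d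
  refine ⟨s, hs, fun q hq hqs => ?_⟩
  by_contra! h
  have hqd : q ∣ d := hqs.trans ⟨_, hs.trans (mul_comm _ _)⟩
  have h1 : q ∈ largePrimes y d :=
    mem_largePrimes.2 ⟨hq, hqd, fun h0 => hn (by simpa [h0] using hd), h⟩
  refine hsq q hq h (dvd_trans ?_ hd)
  rw [hs, sq]
  exact mul_dvd_mul (dvd_prod_of_mem _ h1) hqs

lemma card_largePrimes_add {y : ℝ} {d e : ℕ} (hde : d * e ≠ 0)
    (hsq : ∀ q : ℕ, q.Prime → y < q → ¬ q ^ 2 ∣ d * e) :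
    #(largePrimes y d) + #(largePrimes y e) ≤ #(largePrimes y (d * e)) := by
  classical
  rw [← card_union_of_disjoint]
  · refine card_le_card fun q hq => ?_
    rw [mem_union, mem_largePrimes, mem_largePrimes] at hq
    rw [mem_largePrimes]
    rcases hq with ⟨h1, h2, -, h4⟩ | ⟨h1, h2, -, h4⟩
    · exact ⟨h1, h2.mul_right _, hde, h4⟩
    · exact ⟨h1, h2.mul_left _, hde, h4⟩
  · rw [disjoint_left]
    intro q h1 h2
    rw [mem_largePrimes] at h1 h2
    refine hsq q h1.1 h1.2.2.2 ?_
    rw [sq]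
    exact mul_dvd_mul h1.2.1 h2.2.1

open Classical in
lemma card_sq_dvd_le {T y : ℝ} (hT : 1 ≤ T) (hy : 0 < y) :
    ((#{p ∈ (⌊T⌋₊).primesLE | ∃ q : ℕ, q.Prime ∧ y < q ∧ q ^ 2 ∣ p - 1} : ℕ) : ℝ)
      ≤ 2 * (T / y) := by
  have h1 : ({p ∈ (⌊T⌋₊).primesLE | ∃ q : ℕ, q.Prime ∧ y < q ∧ q ^ 2 ∣ p - 1} : Finset ℕ) ⊆
      (Ioo ⌊y⌋₊ (⌊T⌋₊ + 1)).biUnion fun q => {p ∈ (⌊T⌋₊).primesLE | q ^ 2 ∣ p - 1} := by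
    intro p hp
    obtain ⟨hp1, q, hq, h2, h3⟩ := mem_filter.1 hp
    refine mem_biUnion.2 ⟨q, mem_Ioo.2 ⟨?_, ?_⟩, mem_filter.2 ⟨hp1, h3⟩⟩
    · exact (Nat.floor_lt hy.le).2 h2
    · have h4 := Nat.mem_primesLE.1 hp1
      have h5 := Nat.le_of_dvd (by have := h4.2.two_le; omega) h3
      nlinarith [hq.two_le, Nat.sub_le p 1, h4.1]
  calc _ ≤ ∑ q ∈ Ioo ⌊y⌋₊ (⌊T⌋₊ + 1),
        ((#{p ∈ (⌊T⌋₊).primesLE | q ^ 2 ∣ p - 1} : ℕ) : ℝ) := by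
        exact_mod_cast (card_le_card h1).trans card_biUnion_le
    _ ≤ ∑ q ∈ Ioo ⌊y⌋₊ (⌊T⌋₊ + 1), T * ((q : ℝ) ^ 2)⁻¹ := by
        refine sum_le_sum fun q hq => ?_
        have hq0 : 1 ≤ q ^ 2 := Nat.one_le_pow _ _ (by have := (mem_Ioo.1 hq).1; omega)
        have := card_primes_dvd_sub_one_le_div (T := T) (by linarith) hq0
        push_cast at this
        rwa [div_eq_mul_inv] at this
    _ ≤ T * (2 / (⌊y⌋₊ + 1)) := by
        rw [← mul_sum]
        exact mul_le_mul_of_nonneg_left (sum_Ioo_inv_sq_le _ _) (by linarith)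
    _ ≤ T * (2 / y) := by
        have := (Nat.lt_floor_add_one y).le
        gcongr
    _ = _ := by ring

lemma prod_natCast_largePrimes_le {y : ℝ} {n : ℕ} (hn : n ≠ 0) :
    ∏ q ∈ largePrimes y n, (q : ℝ) ≤ n := by
  rw [← Nat.cast_prod]
  exact_mod_cast Nat.le_of_dvd (Nat.pos_of_ne_zero hn) (prod_largePrimes_dvd y n)

lemma exists_subset_largePrimes {T y : ℝ} {m n : ℕ} (hT : 1 < T) (hm : 1 ≤ m) (hn : n ≠ 0)
    (hnT : (n : ℝ) ≤ T) (h : 20 * m ≤ #(largePrimes y n)) :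
    ∃ U ⊆ largePrimes y n, #U = 18 * m ∧ ∏ q ∈ U, (q : ℝ) ≤ T ^ (9 / 10 : ℝ) := by
  obtain ⟨U, hU, hc, hle⟩ := exists_subset_card_mul_sum_le (fun q : ℕ => Real.log q)
    (N := 18 * m) (by omega) (#(largePrimes y n) - 18 * m) (largePrimes y n) (by omega)
  refine ⟨U, hU, hc, ?_⟩
  have hpos : ∀ q ∈ largePrimes y n, 0 < (q : ℝ) := fun q hq => by
    exact_mod_cast (mem_largePrimes.1 hq).1.pos
  rw [← Real.log_prod fun q hq => (hpos q (hU hq)).ne',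
    ← Real.log_prod fun q hq => (hpos q hq).ne'] at hle
  have h1 : Real.log (∏ q ∈ largePrimes y n, (q : ℝ)) ≤ Real.log T :=
    Real.log_le_log (prod_pos hpos) ((prod_natCast_largePrimes_le hn).trans hnT)
  have h2 : (20 * m : ℝ) ≤ #(largePrimes y n) := by exact_mod_cast h
  have h3 : (1 : ℝ) ≤ m := by exact_mod_cast hm
  have h4 : 0 ≤ Real.log (∏ q ∈ U, (q : ℝ)) := by
    apply Real.log_nonneg
    rw [← Nat.cast_prod]
    exact_mod_cast Nat.one_le_iff_ne_zero.2
      (prod_ne_zero_iff.2 fun q hq => (mem_largePrimes.1 (hU hq)).1.ne_zero)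
  rw [← Real.log_le_log_iff (prod_pos fun q hq => hpos q (hU hq)) (by positivity),
    Real.log_rpow (by linarith)]
  push_cast at hle
  have h5 : 20 * m * Real.log (∏ q ∈ U, (q : ℝ)) ≤ 18 * m * Real.log T :=
    calc _ ≤ _ := mul_le_mul_of_nonneg_right h2 h4
      _ ≤ _ := hle
      _ ≤ _ := by gcongr
  nlinarith

lemma exists_few_largePrimes {T γ : ℝ} {m n d : ℕ} (hT : 1 < T) (hγ : 0 < γ)
    (hn1 : T ^ (1 - γ) ≤ n) (hnT : (n : ℝ) ≤ T)
    (hsq : ∀ q : ℕ, q.Prime → T ^ γ < q → ¬ q ^ 2 ∣ n)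
    (hsm : ∀ s : ℕ, s ∣ n → (∀ q : ℕ, q.Prime → q ∣ s → (q : ℝ) ≤ T ^ γ) →
      (s : ℝ) ≤ T ^ (m * γ))
    (hd : d ∣ n) (hd1 : T ^ (1 / 2 - γ) ≤ d) (hd2 : (d : ℝ) ≤ T ^ (1 / 2 + γ))
    (hc : #(largePrimes (T ^ γ) n) ≤ 20 * m) :
    ∃ U ⊆ primesBetween (T ^ γ) T, #U ≤ 10 * m ∧
      T ^ (1 / 2 - (m + 3) * γ) < ∏ q ∈ U, (q : ℝ) ∧ ∏ q ∈ U, (q : ℝ) ≤ T ^ (1 / 2 + γ) ∧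
      ∏ q ∈ U, q ∣ n := by
  have hT0 : 0 < T := by linarith
  have hn0 : n ≠ 0 := by
    rintro rfl
    have : 0 < T ^ (1 - γ) := by positivity
    simp only [Nat.cast_zero] at hn1
    linarith
  have key : ∀ e : ℕ, e ∣ n → #(largePrimes (T ^ γ) e) ≤ 10 * m → T ^ (1 / 2 - 2 * γ) ≤ e →
      (e : ℝ) ≤ T ^ (1 / 2 + γ) → ∃ U ⊆ primesBetween (T ^ γ) T, #U ≤ 10 * m ∧
      T ^ (1 / 2 - (m + 3) * γ) < ∏ q ∈ U, (q : ℝ) ∧ ∏ q ∈ U, (q : ℝ) ≤ T ^ (1 / 2 + γ) ∧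
      ∏ q ∈ U, q ∣ n := by
    intro e he hce he1 he2
    have he0 : e ≠ 0 := fun h0 => hn0 (by simpa [h0] using he)
    have heT : (e : ℝ) ≤ T := le_trans (by exact_mod_cast Nat.le_of_dvd (Nat.pos_of_ne_zero hn0) he) hnT
    refine ⟨largePrimes (T ^ γ) e, largePrimes_subset_primesBetween heT, hce, ?_,
      (prod_natCast_largePrimes_le he0).trans he2, (prod_largePrimes_dvd _ _).trans he⟩
    obtain ⟨s, hs, hs2⟩ := exists_smooth_cofactor hn0 he hsq
    have hsn := hsm s (dvd_trans ⟨_, hs.trans (mul_comm _ _)⟩ he) hs2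
    set P := ∏ q ∈ largePrimes (T ^ γ) e, q
    have hP : (∏ q ∈ largePrimes (T ^ γ) e, (q : ℝ)) = P := by simp [P]
    rw [hP]
    have h1 : (e : ℝ) = P * s := by exact_mod_cast hs
    have hs0 : 0 < (s : ℝ) := by
      rcases Nat.eq_zero_or_pos s with h | h
      · exact absurd (by rw [hs, h, mul_zero]) he0
      · exact_mod_cast h
    by_contra! hcon
    have : T ^ (1 / 2 - 2 * γ) ≤ T ^ (1 / 2 - (m + 3) * γ) * T ^ (m * γ) := by
      rw [h1] at he1
      refine he1.trans ?_
      gcongr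
    rw [← Real.rpow_add hT0, Real.rpow_le_rpow_left_iff hT] at this
    nlinarith
  obtain ⟨e, he⟩ := hd
  rw [he] at hn0 hsq hc
  have hadd := card_largePrimes_add hn0 hsq
  have hd0 : 0 < (d : ℝ) := by
    exact_mod_cast Nat.pos_of_ne_zero (left_ne_zero_of_mul hn0)
  have hnde : (n : ℝ) = d * e := by exact_mod_cast he
  rcases le_or_gt #(largePrimes (T ^ γ) d) (10 * m) with h | h
  · refine key d ⟨e, he⟩ h (le_trans ?_ hd1) hd2
    exact Real.rpow_le_rpow_of_exponent_le hT.le (by linarith)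
  · refine key e ⟨d, by rw [he, mul_comm]⟩ (by omega) ?_ ?_
    · by_contra! hlt
      have : T ^ (1 - γ) < T ^ (1 / 2 + γ) * T ^ (1 / 2 - 2 * γ) := by
        refine lt_of_le_of_lt hn1 ?_
        rw [hnde]
        exact mul_lt_mul' hd2 hlt (by positivity) (by positivity)
      rw [← Real.rpow_add hT0, Real.rpow_lt_rpow_left_iff hT] at this
      linarith
    · by_contra! hlt
      have : T ^ (1 / 2 - γ) * T ^ (1 / 2 + γ) < T := by
        refine lt_of_lt_of_le ?_ hnT
        rw [hnde]
        exact mul_lt_mul' hd1 hlt (by positivity) hd0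
      rw [← Real.rpow_add hT0] at this
      norm_num at this

lemma two_pow_mul_exp_le (m : ℕ) :
    2 ^ (10 * m) * Real.exp (33 / 4 * m) * Real.exp (-(16 * m : ℝ)) ≤ (1 / 2 : ℝ) ^ m := by
  have h1 : (2 ^ 44 : ℝ) ≤ Real.exp 31 := by
    have h := Real.exp_one_gt_d9.le
    calc (2 ^ 44 : ℝ) ≤ 2.7182818283 ^ 31 := by norm_num
      _ ≤ Real.exp 1 ^ 31 := by gcongr
      _ = Real.exp 31 := by rw [← Real.exp_nat_mul]; norm_num
  have h2 : (2 ^ 11 : ℝ) ≤ Real.exp (31 / 4) := by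
    refine le_of_pow_le_pow_left₀ (n := 4) (by norm_num) (by positivity) ?_
    rw [← Real.exp_nat_mul, ← pow_mul]
    norm_num at h1 ⊢
    exact h1
  have h3 : Real.exp (33 / 4 * m) * Real.exp (-(16 * m : ℝ)) = (Real.exp (31 / 4))⁻¹ ^ m := by
    rw [← Real.exp_neg, ← Real.exp_nat_mul, ← Real.exp_add]
    congr 1; ring
  rw [mul_assoc, h3, pow_mul, ← mul_pow]
  refine pow_le_pow_left₀ (by positivity) ?_ m
  rw [← div_eq_mul_inv, div_le_iff₀ (by positivity)]
  linarith

lemma exists_dichotomy_parameter {ε : ℝ} (hε : 0 < ε) :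
    ∃ m : ℕ, 1 ≤ m ∧ 500 / (m : ℝ) ≤ ε ∧ 120 * (33 / 34 : ℝ) ^ m ≤ ε ∧
      9600 * m * (m + 4) * (1 / 2 : ℝ) ^ m ≤ ε ∧ (m + 3) * Real.exp (-(16 * m : ℝ)) ≤ 1 / 4 := by
  have h1 : ∀ᶠ m : ℕ in atTop, 500 / (m : ℝ) < ε :=
    (tendsto_const_div_atTop_nhds_zero_nat 500).eventually_lt_const hε
  have h2 : Tendsto (fun m : ℕ => 120 * (33 / 34 : ℝ) ^ m) atTop (nhds 0) := by
    simpa using (tendsto_pow_atTop_nhds_zero_of_lt_one (r := (33 / 34 : ℝ)) (by norm_num)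
      (by norm_num)).const_mul 120
  have h3 (k : ℕ) : Tendsto (fun m : ℕ => (m : ℝ) ^ k * (1 / 2 : ℝ) ^ m) atTop (nhds 0) :=
    tendsto_pow_const_mul_const_pow_of_lt_one k (by norm_num) (by norm_num)
  have h4 : Tendsto (fun m : ℕ => 9600 * m * (m + 4) * (1 / 2 : ℝ) ^ m) atTop (nhds 0) := by
    have := ((h3 2).const_mul 9600).add ((h3 1).const_mul 38400)
    simp only [mul_zero, add_zero] at this
    refine this.congr fun m => ?_
    ring
  have h5 : Tendsto (fun m : ℕ => (m + 3) * (1 / 2 : ℝ) ^ m) atTop (nhds 0) := by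
    have := (h3 1).add ((h3 0).const_mul 3)
    simp only [mul_zero, add_zero] at this
    refine this.congr fun m => ?_
    ring
  obtain ⟨m, k1, k2, k3, k4, k5⟩ := (h1.and ((h2.eventually_lt_const hε).and
    ((h4.eventually_lt_const hε).and ((h5.eventually_lt_const (by norm_num : (0 : ℝ) < 1 / 4)).and
      (eventually_ge_atTop 1))))).exists
  refine ⟨m, k5, k1.le, k2.le, k3.le, le_trans ?_ k4.le⟩
  have : Real.exp (-(16 * m : ℝ)) ≤ (1 / 2 : ℝ) ^ m := by
    refine le_trans ?_ (two_pow_mul_exp_le m)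
    have : (1 : ℝ) ≤ 2 ^ (10 * m) * Real.exp (33 / 4 * m) :=
      one_le_mul_of_one_le_of_one_le (one_le_pow₀ (by norm_num)) (Real.one_le_exp (by positivity))
    exact le_mul_of_one_le_left (Real.exp_pos _).le this
  gcongr

lemma eventually_rpow_le_div_log {s ε : ℝ} (hs : s < 1) (hε : 0 < ε) :
    ∀ᶠ T : ℝ in atTop, T ^ s ≤ ε * (T / Real.log T) := by
  have h := (isLittleO_log_rpow_atTop (sub_pos.2 hs)).def hε
  filter_upwards [h, eventually_gt_atTop 1] with T h1 h2
  have hl := Real.log_pos h2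
  have hT : 0 < T := by linarith
  rw [Real.norm_of_nonneg hl.le, Real.norm_of_nonneg (by positivity)] at h1
  rw [← mul_div_assoc, le_div_iff₀ hl]
  calc T ^ s * Real.log T ≤ T ^ s * (ε * T ^ (1 - s)) := by gcongr
    _ = ε * (T ^ s * T ^ (1 - s)) := by ring
    _ = ε * T := by rw [← Real.rpow_add hT]; simp

open Classical in
lemma card_primesLE_filter_le_le {n : ℕ} {X : ℝ} (hX : 0 ≤ X) :
    ((#(n.primesLE.filter fun p : ℕ => (p : ℝ) ≤ X) : ℕ) : ℝ) ≤ X := by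
  have h : (n.primesLE.filter fun p : ℕ => (p : ℝ) ≤ X) ⊆ Icc 1 ⌊X⌋₊ := by
    intro p hp
    obtain ⟨h1, h2⟩ := mem_filter.1 hp
    exact mem_Icc.2 ⟨(Nat.mem_primesLE.1 h1).2.one_lt.le, Nat.le_floor h2⟩
  have := card_le_card h
  rw [Nat.card_Icc, Nat.add_sub_cancel] at this
  exact le_trans (by exact_mod_cast this) (Nat.floor_le hX)

open Classical in
/-- Few primes `p ≤ T` are such that `p - 1` has a divisor close to `√T`. -/
lemma exists_card_divisor_near_sqrt_le {ε : ℝ} (hε : 0 < ε) :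
    ∃ δ : ℝ, 0 < δ ∧ ∀ᶠ T : ℝ in atTop,
      ((#{p ∈ (⌊T⌋₊).primesLE | ∃ d : ℕ, d ∣ p - 1 ∧ T ^ (1 / 2 - δ) ≤ d ∧
        (d : ℝ) ≤ T ^ (1 / 2 + δ)} : ℕ) : ℝ) ≤ ε * (T / Real.log T) := by
  obtain ⟨m, hm, p1, p2, p3, p4⟩ := exists_dichotomy_parameter (by positivity : 0 < ε / 6)
  set γ := Real.exp (-(16 * m : ℝ)) with hγdef
  have hγ : 0 < γ := Real.exp_pos _
  have hm1 : (1 : ℝ) ≤ m := by exact_mod_cast hm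
  have hγ4 : γ ≤ 1 / 16 := by nlinarith
  set C : ℝ := 120 * (2 ^ (10 * m) * Real.exp (33 / 4 * m) * (80 * m)) with hC
  have hC0 : 0 < C := by positivity
  refine ⟨γ, hγ, ?_⟩
  have e1 := eventually_card_smooth_divisor_le (γ := γ) (σ := m * γ) hγ (by linarith)
    (by positivity)
  have e2 : ∀ᶠ T : ℝ in atTop, C * (8 / Real.log T) < ε / 6 := by
    have : Tendsto (fun T : ℝ => C * (8 / Real.log T)) atTop (nhds 0) := by
      simpa using (Real.tendsto_log_atTop.const_div_atTop 8).const_mul C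
    exact this.eventually_lt_const (by positivity)
  have e3 : ∀ᶠ T : ℝ in atTop, (2 : ℝ) ≤ T ^ (1 / (40 * m : ℝ)) :=
    (tendsto_rpow_atTop (by positivity)).eventually_ge_atTop 2
  have e4 := eventually_rpow_le_div_log (s := 1 - γ) (by linarith) (by positivity : 0 < ε / 24)
  filter_upwards [e1, e2, e3, e4, eventually_sum_inv_sub_one_le m, eventually_gt_atTop 1]
    with T e1 e2 e3 e4 e5 hT
  have hT0 : 0 < T := by linarith
  have hl := Real.log_pos hT
  set L := T / Real.log T
  have hL : 0 < L := by positivity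
  set S1 : Finset ℕ := (⌊T⌋₊).primesLE.filter fun p : ℕ => (p : ℝ) ≤ T ^ (1 - γ) + 1
  set S2 : Finset ℕ := {p ∈ (⌊T⌋₊).primesLE | ∃ q : ℕ, q.Prime ∧ T ^ γ < q ∧ q ^ 2 ∣ p - 1}
  set S3 : Finset ℕ := {p ∈ (⌊T⌋₊).primesLE | ∃ s : ℕ, s ∣ p - 1 ∧
    (∀ q : ℕ, q.Prime → q ∣ s → (q : ℝ) ≤ T ^ γ) ∧ T ^ (m * γ) < s}
  set S4 : Finset ℕ := {p ∈ (⌊T⌋₊).primesLE | ∃ U ⊆ primesBetween (T ^ γ) T, #U ≤ 10 * m ∧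
      T ^ (1 / 2 - (m + 3) * γ) < ∏ q ∈ U, (q : ℝ) ∧ ∏ q ∈ U, (q : ℝ) ≤ T ^ (1 / 2 + γ) ∧
      ∏ q ∈ U, q ∣ p - 1}
  set S5 : Finset ℕ := {p ∈ (⌊T⌋₊).primesLE | ∃ U ⊆ primesBetween (T ^ γ) T, #U = 18 * m ∧
      ∏ q ∈ U, (q : ℝ) ≤ T ^ (9 / 10 : ℝ) ∧ ∏ q ∈ U, q ∣ p - 1}
  have b1 : (#S1 : ℝ) ≤ ε / 12 * L := by
    refine (card_primesLE_filter_le_le (by positivity)).trans ?_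
    have : 1 ≤ T ^ (1 - γ) := Real.one_le_rpow hT.le (by linarith)
    linarith
  have b2 : (#S2 : ℝ) ≤ ε / 12 * L := by
    refine (card_sq_dvd_le hT.le (by positivity)).trans ?_
    have : T / T ^ γ = T ^ (1 - γ) := by rw [Real.rpow_sub hT0, Real.rpow_one]
    rw [this]
    linarith
  have b3 : (#S3 : ℝ) ≤ ε / 6 * L := by
    refine e1.trans (mul_le_mul_of_nonneg_right (le_trans (le_of_eq ?_) p1) hL.le)
    field_simp
  have b4 : (#S4 : ℝ) ≤ ε / 3 * L := by
    have hw : (T ^ (1 / (40 * m : ℝ))) ^ (10 * m) ≤ T ^ (1 / 2 - (m + 3) * γ) := by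
      rw [← Real.rpow_natCast, ← Real.rpow_mul hT0.le]
      refine Real.rpow_le_rpow_of_exponent_le hT.le ?_
      have : 1 / (40 * m : ℝ) * ((10 * m : ℕ) : ℝ) = 1 / 4 := by
        push_cast; field_simp; norm_num
      rw [this]; linarith
    refine (card_few_large_primes_le hT e3 hw
      (Real.rpow_le_rpow_of_exponent_le hT.le (by nlinarith))
      (Real.rpow_le_rpow_of_exponent_le hT.le (by linarith))).trans ?_
    rw [Real.log_rpow hT0, Real.log_rpow hT0, Real.log_rpow hT0]
    have h1 : ((1 / 2 + γ) * Real.log T - (1 / 2 - (m + 3) * γ) * Real.log T + 8) /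
        (1 / (40 * m) * Real.log T) = 40 * m * ((m + 4) * γ + 8 / Real.log T) := by
      field_simp; ring
    rw [h1]
    have h2 : Real.exp ((∑ q ∈ primesBetween (T ^ γ) T, ((q : ℝ) - 1)⁻¹) / 2)
        ≤ Real.exp (33 / 4 * m) := Real.exp_le_exp.2 (by linarith)
    have h3 : C * ((m + 4) * γ) ≤ ε / 6 := by
      refine le_trans ?_ p3
      calc C * ((m + 4) * γ) = 9600 * m * (m + 4) *
            (2 ^ (10 * m) * Real.exp (33 / 4 * m) * γ) := by rw [hC]; ring
        _ ≤ _ := by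
          have := two_pow_mul_exp_le m
          gcongr
    calc _ ≤ 120 * L * (2 ^ (10 * m) * Real.exp (33 / 4 * m) *
          (2 * (40 * m * ((m + 4) * γ + 8 / Real.log T)))) := by gcongr
      _ = (C * ((m + 4) * γ) + C * (8 / Real.log T)) * L := by rw [hC]; ring
      _ ≤ _ := by
        have : C * ((m + 4) * γ) + C * (8 / Real.log T) ≤ ε / 3 := by linarith
        gcongr
  have b5 : (#S5 : ℝ) ≤ ε / 6 * L := by
    refine (card_many_large_primes_le hT hm e5).trans ?_
    calc 120 * L * (33 / 34) ^ m = 120 * (33 / 34) ^ m * L := by ring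
      _ ≤ _ := by gcongr
  have hsub : ({p ∈ (⌊T⌋₊).primesLE | ∃ d : ℕ, d ∣ p - 1 ∧ T ^ (1 / 2 - γ) ≤ d ∧
      (d : ℝ) ≤ T ^ (1 / 2 + γ)} : Finset ℕ) ⊆ S1 ∪ (S2 ∪ (S3 ∪ (S4 ∪ S5))) := by
    intro p hp
    obtain ⟨hp0, d, hd, hd1, hd2⟩ := mem_filter.1 hp
    obtain ⟨hpT, hpp⟩ := Nat.mem_primesLE.1 hp0
    by_contra hcon
    simp only [mem_union, not_or] at hcon
    obtain ⟨c1, c2, c3, c4, c5⟩ := hcon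
    have hpc : ((p - 1 : ℕ) : ℝ) = p - 1 := by
      rw [Nat.cast_sub hpp.one_lt.le, Nat.cast_one]
    have hp1 : T ^ (1 - γ) ≤ ((p - 1 : ℕ) : ℝ) := by
      rw [hpc]
      by_contra! h
      exact c1 (mem_filter.2 ⟨hp0, by linarith⟩)
    have hpT' : ((p - 1 : ℕ) : ℝ) ≤ T := by
      have : (p : ℝ) ≤ T := (Nat.le_floor_iff hT0.le).1 hpT
      rw [hpc]; linarith
    rcases le_or_gt #(largePrimes (T ^ γ) (p - 1)) (20 * m) with h | h
    · refine c4 (mem_filter.2 ⟨hp0, exists_few_largePrimes hT hγ hp1 hpT' ?_ ?_ hd hd1 hd2 h⟩)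
      · exact fun q hq hq1 hq2 => c2 (mem_filter.2 ⟨hp0, q, hq, hq1, hq2⟩)
      · intro s hs hs1
        by_contra! h
        exact c3 (mem_filter.2 ⟨hp0, s, hs, hs1, h⟩)
    · obtain ⟨U, hU, hc, hle⟩ := exists_subset_largePrimes (y := T ^ γ) hT hm
        (by have := hpp.two_le; omega) hpT' h.le
      exact c5 (mem_filter.2 ⟨hp0, U, hU.trans (largePrimes_subset_primesBetween hpT'), hc, hle,
        (prod_dvd_prod_of_subset _ _ _ hU).trans (prod_largePrimes_dvd _ _)⟩)
  have hcard : ((#{p ∈ (⌊T⌋₊).primesLE | ∃ d : ℕ, d ∣ p - 1 ∧ T ^ (1 / 2 - γ) ≤ d ∧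
      (d : ℝ) ≤ T ^ (1 / 2 + γ)} : ℕ) : ℝ) ≤ #S1 + (#S2 + (#S3 + (#S4 + #S5))) := by
    have h4 := card_union_le S4 S5
    have h3 := card_union_le S3 (S4 ∪ S5)
    have h2 := card_union_le S2 (S3 ∪ (S4 ∪ S5))
    have h1 := card_union_le S1 (S2 ∪ (S3 ∪ (S4 ∪ S5)))
    have := card_le_card hsub
    exact_mod_cast (by omega : _ ≤ #S1 + (#S2 + (#S3 + (#S4 + #S5))))
  linarith

section Packing

variable {E : Type*} [NormedAddCommGroup E] [NormedSpace ℝ E] [FiniteDimensional ℝ E]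

lemma card_le_of_separated_of_norm_le {s : Finset E} {x : E} {ρ : ℝ} (hρ : 0 < ρ)
    (hs : ∀ c ∈ s, ‖c - x‖ ≤ ρ) (h : ∀ c ∈ s, ∀ d ∈ s, c ≠ d → ρ / 2 ≤ ‖c - d‖) :
    #s ≤ 5 ^ Module.finrank ℝ E := by
  classical
  have hinj : Function.Injective fun c : E => (2 / ρ) • (c - x) := fun c d hcd => by
    have := smul_right_injective E (by positivity : (2 / ρ) ≠ 0) hcd
    exact sub_left_injective this
  rw [← card_image_of_injective s hinj]
  refine Besicovitch.card_le_of_separated _ ?_ ?_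
  · intro c hc
    obtain ⟨c, hc', rfl⟩ := mem_image.1 hc
    rw [norm_smul, Real.norm_of_nonneg (by positivity), div_mul_eq_mul_div, div_le_iff₀ hρ]
    linarith [hs c hc']
  · intro c hc d hd hcd
    obtain ⟨c, hc', rfl⟩ := mem_image.1 hc
    obtain ⟨d, hd', rfl⟩ := mem_image.1 hd
    rw [← smul_sub, norm_smul, Real.norm_of_nonneg (by positivity), sub_sub_sub_cancel_right,
      div_mul_eq_mul_div, le_div_iff₀ hρ]
    linarith [h c hc' d hd' fun h => hcd (by rw [h])]

lemma exists_finset_cover_half {s : Finset E} {x : E} {ρ : ℝ} (hρ : 0 < ρ)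
    (hs : ∀ c ∈ s, ‖c - x‖ ≤ ρ) :
    ∃ t ⊆ s, #t ≤ 5 ^ Module.finrank ℝ E ∧ ∀ c ∈ s, ∃ d ∈ t, ‖c - d‖ ≤ ρ / 2 := by
  classical
  obtain ⟨t, ht, hmax⟩ := exists_max_image
    (s.powerset.filter fun t : Finset E => ∀ c ∈ t, ∀ d ∈ t, c ≠ d → ρ / 2 ≤ ‖c - d‖) card
    ⟨∅, by simp⟩
  obtain ⟨hts, hsep⟩ := mem_filter.1 ht
  rw [mem_powerset] at hts
  refine ⟨t, hts, card_le_of_separated_of_norm_le hρ (fun c hc => hs c (hts hc)) hsep, ?_⟩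
  intro c hc
  by_contra! hcon
  have hct : c ∉ t := fun h => by
    have := hcon c h
    rw [sub_self, norm_zero] at this
    linarith
  have := hmax (insert c t) (mem_filter.2 ⟨mem_powerset.2 (insert_subset hc hts), ?_⟩)
  · rw [card_insert_of_notMem hct] at this
    omega
  · intro a ha b hb hab
    rw [mem_insert] at ha hb
    rcases ha with rfl | ha <;> rcases hb with rfl | hb
    · exact absurd rfl hab
    · exact (hcon b hb).le
    · rw [norm_sub_rev]; exact (hcon a ha).le
    · exact hsep a ha b hb hab

lemma exists_cluster {ι : Type*} (f : ι → E) {s : Finset ι} {ρ : ℝ} (hρ : 0 < ρ)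
    (hs : ∀ i ∈ s, ‖f i‖ ≤ ρ) (j : ℕ) :
    ∃ t ⊆ s, #s ≤ (5 ^ Module.finrank ℝ E) ^ j * #t ∧ ∃ x, ∀ i ∈ t, ‖f i - x‖ ≤ ρ / 2 ^ j := by
  classical
  induction j with
  | zero => exact ⟨s, Subset.rfl, by simp, 0, by simpa using hs⟩
  | succ j ih =>
    obtain ⟨t, hts, hc, x, hx⟩ := ih
    obtain ⟨u, -, hu, hcov⟩ := exists_finset_cover_half (s := t.image f) (x := x)
      (ρ := ρ / 2 ^ j) (by positivity) (by simpa using hx)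
    rcases t.eq_empty_or_nonempty with rfl | hne
    · exact ⟨∅, by simp, by simpa using hc, 0, by simp⟩
    have hmap : ∀ i ∈ t, ∃ d ∈ u, ‖f i - d‖ ≤ ρ / 2 ^ j / 2 := fun i hi =>
      hcov _ (mem_image_of_mem _ hi)
    choose! g hgu hg using hmap
    have hune : u.Nonempty := ⟨_, hgu _ hne.choose_spec⟩
    obtain ⟨d, hd, hle⟩ := exists_le_card_fiber_of_nsmul_le_card_of_maps_to (s := t) (t := u)
      (f := g) (b := (#t : ℚ) / #u) hgu hune (by
        rw [nsmul_eq_mul, mul_div_cancel₀]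
        exact_mod_cast hune.card_pos.ne')
    refine ⟨t.filter fun i => g i = d, (filter_subset _ _).trans hts, ?_, d, ?_⟩
    · rw [div_le_iff₀ (by exact_mod_cast hune.card_pos)] at hle
      have h1 : #t ≤ #(t.filter fun i => g i = d) * #u := by exact_mod_cast hle
      calc #s ≤ _ := hc
        _ ≤ (5 ^ Module.finrank ℝ E) ^ j *
            (#(t.filter fun i => g i = d) * 5 ^ Module.finrank ℝ E) := by gcongr; exact h1.trans (by gcongr)
        _ = _ := by ring
    · intro i hi
      obtain ⟨h1, rfl⟩ := mem_filter.1 hi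
      refine (hg i h1).trans (le_of_eq ?_)
      rw [pow_succ]; field_simp

end Packing

end OrderInIntervals

namespace OrderInIntervals

open Finset Filter
open scoped Real

lemma log_norm_le_of_two_le {z : ℂ} {ρ : ℝ} (hρ : 2 ≤ ρ) (hz : z ≠ 0) (hu : 1 + z ≠ 0)
    (hv : 1 + ρ * z ≠ 0) :
    Real.log ‖z‖ ≤ 2 * (|Real.log ‖1 + z‖| + |Real.log ‖1 + ρ * z‖|) - Real.log 2 := by
  have key : (ρ ^ 2 - ρ) * ‖z‖ ^ 2 = (‖1 + ρ * z‖ ^ 2 - 1) - ρ * (‖1 + z‖ ^ 2 - 1) := by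
    rw [Complex.sq_norm, Complex.sq_norm, Complex.sq_norm, Complex.normSq_apply,
      Complex.normSq_apply, Complex.normSq_apply]
    simp only [Complex.add_re, Complex.add_im, Complex.mul_re, Complex.mul_im, Complex.one_re,
      Complex.one_im, Complex.ofReal_re, Complex.ofReal_im]
    ring
  have habs : ∀ w : ℂ, w ≠ 0 → |‖w‖ ^ 2 - 1| ≤ Real.exp (2 * |Real.log ‖w‖|) - 1 := by
    intro w hw
    have hw0 : 0 < ‖w‖ := norm_pos_iff.2 hw
    have h1 : ‖w‖ ^ 2 = Real.exp (2 * Real.log ‖w‖) := by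
      rw [mul_comm, Real.exp_mul, Real.exp_log hw0]; norm_cast
    rw [h1, abs_le]
    set t := 2 * Real.log ‖w‖
    have ht : 2 * |Real.log ‖w‖| = |t| := by rw [abs_mul]; norm_num
    rw [ht]
    have h2 := Real.exp_le_exp.2 (le_abs_self t)
    have h3 := Real.exp_le_exp.2 (neg_abs_le t)
    have h4 : Real.exp |t| * Real.exp (-|t|) = 1 := by rw [← Real.exp_add]; simp
    have h5 := Real.exp_pos |t|
    have h6 := Real.exp_pos (-|t|)
    constructor
    · nlinarith [sq_nonneg (Real.exp |t| - Real.exp (-|t|)),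
        sq_nonneg (Real.exp |t| + Real.exp (-|t|) - 2)]
    · linarith
  have hU := habs _ hu
  have hV := habs _ hv
  set A := |Real.log ‖1 + z‖|
  set B := |Real.log ‖1 + ρ * z‖|
  have h1 : ‖z‖ ^ 2 ≤ (Real.exp (2 * A) - 1) + (Real.exp (2 * B) - 1) := by
    have h2 := abs_le.1 hU
    have h3 := abs_le.1 hV
    have h4 : (ρ ^ 2 - ρ) * ‖z‖ ^ 2 ≤
        (ρ ^ 2 - ρ) * ((Real.exp (2 * A) - 1) + (Real.exp (2 * B) - 1)) := by
      rw [key]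
      have hA : 0 ≤ Real.exp (2 * A) - 1 := (abs_nonneg _).trans hU
      have hB : 0 ≤ Real.exp (2 * B) - 1 := (abs_nonneg _).trans hV
      have h5 : (Real.exp (2 * B) - 1) ≤ (ρ ^ 2 - ρ) * (Real.exp (2 * B) - 1) :=
        le_mul_of_one_le_left hB (by nlinarith)
      have h6 : ρ * (Real.exp (2 * A) - 1) ≤ (ρ ^ 2 - ρ) * (Real.exp (2 * A) - 1) :=
        mul_le_mul_of_nonneg_right (by nlinarith) hA
      nlinarith
    exact le_of_mul_le_mul_left h4 (by nlinarith)
  have hz0 : 0 < ‖z‖ := norm_pos_iff.2 hz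
  have h2 : ‖z‖ ≤ Real.exp (2 * (A + B)) / 2 := by
    refine le_of_sq_le_sq ?_ (by positivity)
    have h3 : Real.exp (2 * (A + B)) = Real.exp (2 * A) * Real.exp (2 * B) := by
      rw [← Real.exp_add]; ring_nf
    have hA : 1 ≤ Real.exp (2 * A) := Real.one_le_exp (by positivity)
    have hB : 1 ≤ Real.exp (2 * B) := Real.one_le_exp (by positivity)
    rw [h3]
    nlinarith [mul_nonneg (sub_nonneg.2 hA) (sub_nonneg.2 hB),
      sq_nonneg (Real.exp (2 * A) * Real.exp (2 * B) - 2)]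
  have h3 := Real.log_le_log hz0 h2
  rwa [Real.log_div (by positivity) (by norm_num), Real.log_exp] at h3

section Places

open NumberField

variable {F : Type*} [Field F] [NumberField F] (S : Finset (FinitePlace F))

/-- The absolute values of `F` given by the complex embeddings and the places in `S`. -/
noncomputable def placeAbs (i : (F →+* ℂ) ⊕ S) (x : F) : ℝ :=
  Sum.elim (fun φ => ‖φ x‖) (fun v => v.1 x) i

/-- The vector of logarithms of the absolute values `placeAbs`. -/
noncomputable def placeLog (x : F) : PiLp 1 (fun _ : (F →+* ℂ) ⊕ S => ℝ) :=
  WithLp.toLp 1 fun i => Real.log (placeAbs S i x)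

/-- The (unnormalised) height attached to the absolute values `placeAbs`. -/
noncomputable def placeHeight (x : F) : ℝ := ∑ i, log⁺ (placeAbs S i x)

variable {S}

lemma placeAbs_mul (i : (F →+* ℂ) ⊕ S) (x y : F) :
    placeAbs S i (x * y) = placeAbs S i x * placeAbs S i y := by
  cases i <;> simp [placeAbs]

lemma placeAbs_inv (i : (F →+* ℂ) ⊕ S) (x : F) :
    placeAbs S i x⁻¹ = (placeAbs S i x)⁻¹ := by
  cases i <;> simp [placeAbs]

lemma placeAbs_ne_zero (i : (F →+* ℂ) ⊕ S) {x : F} (hx : x ≠ 0) : placeAbs S i x ≠ 0 := by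
  cases i <;> simp [placeAbs, hx]

lemma placeLog_apply (i : (F →+* ℂ) ⊕ S) (x : F) :
    placeLog S x i = Real.log (placeAbs S i x) := rfl

lemma placeLog_mul {x y : F} (hx : x ≠ 0) (hy : y ≠ 0) :
    placeLog S (x * y) = placeLog S x + placeLog S y := by
  ext i
  simp only [placeLog_apply, PiLp.add_apply, placeAbs_mul]
  exact Real.log_mul (placeAbs_ne_zero i hx) (placeAbs_ne_zero i hy)

lemma placeLog_inv (x : F) : placeLog S x⁻¹ = - placeLog S x := by
  ext i
  simp [placeLog_apply, placeAbs_inv]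

lemma placeLog_div {x y : F} (hx : x ≠ 0) (hy : y ≠ 0) :
    placeLog S (x / y) = placeLog S x - placeLog S y := by
  rw [div_eq_mul_inv, placeLog_mul hx (inv_ne_zero hy), placeLog_inv, sub_eq_add_neg]

lemma placeLog_one : placeLog S (1 : F) = 0 := by
  ext i
  cases i <;> simp [placeLog_apply, placeAbs]

lemma placeLog_pow {x : F} (hx : x ≠ 0) (n : ℕ) : placeLog S (x ^ n) = (n : ℝ) • placeLog S x := by
  induction n with
  | zero => simp [placeLog_one]
  | succ n ih => rw [pow_succ, placeLog_mul (pow_ne_zero _ hx) hx, ih, Nat.cast_succ, add_smul, one_smul]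

lemma placeLog_zpow {x : F} (hx : x ≠ 0) (n : ℤ) :
    placeLog S (x ^ n) = (n : ℝ) • placeLog S x := by
  cases n with
  | ofNat n => simpa using placeLog_pow hx n
  | negSucc n =>
    rw [zpow_negSucc, placeLog_inv, placeLog_pow hx, ← neg_smul]
    congr 1
    push_cast
    ring

lemma placeLog_prod {ι : Type*} (s : Finset ι) (f : ι → F) (hf : ∀ i ∈ s, f i ≠ 0) :
    placeLog S (∏ i ∈ s, f i) = ∑ i ∈ s, placeLog S (f i) := by
  classical
  induction s using Finset.induction_on with
  | empty => simp [placeLog_one]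
  | insert a s ha ih =>
    rw [prod_insert ha, sum_insert ha, placeLog_mul (hf _ (mem_insert_self _ _))
      (prod_ne_zero_iff.2 fun i hi => hf i (mem_insert_of_mem hi)),
      ih fun i hi => hf i (mem_insert_of_mem hi)]

lemma norm_placeLog (x : F) : ‖placeLog S x‖ = ∑ i, |Real.log (placeAbs S i x)| := by
  rw [PiLp.norm_eq_of_L1]
  rfl

lemma norm_placeLog_eq_two_mul {x : F} (hx : ∑ i, placeLog S x i = 0) :
    ‖placeLog S x‖ = 2 * placeHeight S x := by
  rw [norm_placeLog, placeHeight, mul_sum]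
  simp only [← Real.half_mul_log_add_log_abs, mul_inv_cancel_left₀ (two_ne_zero' ℝ),
    sum_add_distrib]
  simp only [placeLog_apply] at hx
  rw [hx, zero_add]

lemma placeHeight_inv {x : F} (hx : ∑ i, placeLog S x i = 0) :
    placeHeight S x⁻¹ = placeHeight S x := by
  simp only [placeLog_apply] at hx
  have : placeHeight S x - placeHeight S x⁻¹ = 0 := by
    simp only [placeHeight, ← sum_sub_distrib, placeAbs_inv, Real.posLog_sub_posLog_inv, hx]
  linarith

lemma placeHeight_mul_le (x y : F) :
    placeHeight S (x * y) ≤ placeHeight S x + placeHeight S y := by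
  simp only [placeHeight, ← sum_add_distrib, placeAbs_mul]
  exact sum_le_sum fun i _ => Real.posLog_mul

lemma placeHeight_add_le (x y : F) :
    placeHeight S (x + y) ≤
      placeHeight S x + placeHeight S y + Fintype.card (F →+* ℂ) * Real.log 2 := by
  simp only [placeHeight, Fintype.sum_sum_type]
  have h1 : ∑ φ : F →+* ℂ, log⁺ (placeAbs S (.inl φ) (x + y)) ≤
      ∑ φ : F →+* ℂ, (Real.log 2 + log⁺ (placeAbs S (.inl φ) x) + log⁺ (placeAbs S (.inl φ) y)) := by
    refine sum_le_sum fun φ _ => ?_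
    simp only [placeAbs, Sum.elim_inl, map_add]
    linarith [Real.posLog_norm_add_le (φ x) (φ y)]
  have h2 : ∑ v : S, log⁺ (placeAbs S (.inr v) (x + y)) ≤
      ∑ v : S, (log⁺ (placeAbs S (.inr v) x) + log⁺ (placeAbs S (.inr v) y)) := by
    refine sum_le_sum fun v _ => ?_
    simp only [placeAbs, Sum.elim_inr]
    have h := FinitePlace.add_le v.1 x y
    rcases le_total (v.1 x) (v.1 y) with h' | h'
    · rw [max_eq_right h'] at h
      exact (Real.posLog_le_posLog (apply_nonneg _ _) h).trans
        (le_add_of_nonneg_left Real.posLog_nonneg)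
    · rw [max_eq_left h'] at h
      exact (Real.posLog_le_posLog (apply_nonneg _ _) h).trans
        (le_add_of_nonneg_right Real.posLog_nonneg)
  simp only [sum_add_distrib, sum_const, nsmul_eq_mul, card_univ] at h1 h2
  linarith

lemma finitePlace_natCast_le_one (v : FinitePlace F) (n : ℕ) : v n ≤ 1 := by
  induction n with
  | zero => simp
  | succ n ih =>
    rw [Nat.cast_succ]
    exact (FinitePlace.add_le v _ _).trans (max_le ih (by simp))

lemma placeHeight_natCast_le {n : ℕ} {M : ℝ} (hn : n ≠ 0) (hM : (n : ℝ) ≤ M) :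
    placeHeight S (n : F) ≤ Fintype.card (F →+* ℂ) * Real.log M := by
  have h1 : (1 : ℝ) ≤ n := by exact_mod_cast Nat.pos_of_ne_zero hn
  simp only [placeHeight, Fintype.sum_sum_type]
  have h2 : ∑ v : S, log⁺ (placeAbs S (.inr v) (n : F)) = 0 := by
    refine sum_eq_zero fun v _ => ?_
    simp only [placeAbs, Sum.elim_inr]
    rw [Real.posLog_eq_zero_iff, abs_of_nonneg (apply_nonneg _ _)]
    exact finitePlace_natCast_le_one _ _
  rw [h2, add_zero, ← nsmul_eq_mul, ← card_univ]
  refine sum_le_card_nsmul _ _ _ fun φ _ => ?_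
  simp only [placeAbs, Sum.elim_inl, map_natCast, Complex.norm_natCast, Real.log_of_nat_eq_posLog]
  exact Real.log_le_log (by linarith) hM

lemma placeHeight_neg (x : F) : placeHeight S (-x) = placeHeight S x := by
  have : ∀ i, placeAbs S i (-x) = placeAbs S i x := by
    intro i
    cases i with
    | inl φ => simp [placeAbs]
    | inr v => simp [placeAbs]
  simp only [placeHeight, this]

lemma placeHeight_one : placeHeight S (1 : F) = 0 := by
  have : ∀ i, placeAbs S i (1 : F) = 1 := by
    intro i
    cases i <;> simp [placeAbs]
  simp [placeHeight, this]

/-- The product formula, for finitely many elements and finitely many places. -/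
lemma exists_sum_placeLog_eq_zero (X : Finset F) (hX : ∀ x ∈ X, x ≠ 0) :
    ∃ S : Finset (FinitePlace F), ∀ x ∈ X, ∑ i, placeLog S x i = 0 := by
  classical
  have hfin : ∀ x ∈ X, (Function.mulSupport fun v : FinitePlace F => v x).Finite :=
    fun x hx => FinitePlace.hasFiniteMulSupport (hX x hx)
  refine ⟨X.attach.biUnion fun x => (hfin x.1 x.2).toFinset, fun x hx => ?_⟩
  set S := X.attach.biUnion fun x => (hfin x.1 x.2).toFinset
  have h0 := hX x hx
  have h1 := prod_abs_eq_one h0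
  have h2 : ∏ᶠ v : FinitePlace F, v x = ∏ v ∈ S, v x := by
    refine finprod_eq_prod_of_mulSupport_subset _ fun v hv => ?_
    simp only [S, coe_biUnion, Set.mem_iUnion]
    exact ⟨⟨x, hx⟩, by simp, by simpa using hv⟩
  have h3 : ∏ w : InfinitePlace F, w x ^ w.mult = ∏ φ : F →+* ℂ, ‖φ x‖ := by
    rw [InfinitePlace.prod_eq_abs_norm]
    have := (congr_arg (‖·‖) (Algebra.norm_eq_prod_embeddings ℚ ℂ x))
    rw [norm_prod, ← Fintype.prod_equiv (RingHom.equivRatAlgHom F ℂ) (fun f => ‖f x‖)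
      (fun φ => ‖φ x‖) fun _ => by simp [RingHom.equivRatAlgHom_apply]] at this
    rw [← this, eq_ratCast, Rat.cast_abs, ← Real.norm_eq_abs, ← Complex.norm_real,
      Complex.ofReal_ratCast]
  rw [h2, h3] at h1
  simp only [placeLog_apply, Fintype.sum_sum_type, placeAbs, Sum.elim_inl, Sum.elim_inr]
  rw [← Real.log_prod (fun φ _ => by simpa using h0), ← Real.log_prod (fun v _ => by simpa using h0),
    ← Real.log_mul (prod_ne_zero_iff.2 fun φ _ => by simpa using h0)
      (prod_ne_zero_iff.2 fun φ _ => by simpa using h0), prod_coe_sort S (fun v => v x), h1,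
      Real.log_one]

end Places

end OrderInIntervals

namespace OrderInIntervals

open Finset Filter

section Places

open NumberField

variable {F : Type*} [Field F] [NumberField F] {S : Finset (FinitePlace F)}

lemma card_mul_log_two_le {z : F} {ρ : ℚ} (hρ : 2 ≤ ρ) (hz : z ≠ 0) (hu : 1 + z ≠ 0)
    (hv : 1 + ρ * z ≠ 0) (hsum : ∑ i, placeLog S z i = 0) :
    Fintype.card (F →+* ℂ) * Real.log 2 ≤
      2 * (‖placeLog S (1 + z)‖ + ‖placeLog S (1 + ρ * z)‖) := by
  rw [norm_placeLog, norm_placeLog]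
  simp only [Fintype.sum_sum_type, placeLog_apply] at hsum ⊢
  have h1 : ∑ φ : F →+* ℂ, Real.log (placeAbs S (.inl φ) z) ≤
      ∑ φ : F →+* ℂ, (2 * (|Real.log (placeAbs S (.inl φ) (1 + z))| +
        |Real.log (placeAbs S (.inl φ) (1 + ρ * z))|) - Real.log 2) := by
    refine sum_le_sum fun φ _ => ?_
    simp only [placeAbs, Sum.elim_inl]
    have hρ' : (2 : ℝ) ≤ (ρ : ℝ) := by exact_mod_cast hρ
    have e1 : φ (1 + z) = 1 + φ z := by simp
    have e2 : φ (1 + ρ * z) = 1 + ((ρ : ℝ) : ℂ) * φ z := by simp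
    have := log_norm_le_of_two_le hρ' (z := φ z) (by simpa using hz)
      (by rw [← e1]; simpa only [map_ne_zero] using hu)
      (by rw [← e2]; simpa only [map_ne_zero] using hv)
    rw [e1, e2]
    exact this
  have h2 : ∑ v : S, Real.log (placeAbs S (.inr v) z) ≤
      ∑ v : S, (2 * (|Real.log (placeAbs S (.inr v) (1 + z))| +
        |Real.log (placeAbs S (.inr v) (1 + ρ * z))|)) := by
    refine sum_le_sum fun v _ => ?_
    simp only [placeAbs, Sum.elim_inr]
    have h3 : v.1 z ≤ max (v.1 (1 + z)) 1 := by
      have := FinitePlace.add_le v.1 (1 + z) (-1)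
      rw [add_neg_cancel_comm, map_neg_eq_map, map_one] at this
      exact this
    have h4 : Real.log (v.1 z) ≤ |Real.log (v.1 (1 + z))| := by
      have h0 : 0 < v.1 z := (FinitePlace.pos_iff).2 hz
      refine (Real.log_le_log h0 h3).trans ?_
      rcases le_total (v.1 (1 + z)) 1 with h | h
      · rw [max_eq_right h, Real.log_one]; exact abs_nonneg _
      · rw [max_eq_left h]; exact le_abs_self _
    have := abs_nonneg (Real.log (v.1 (1 + z)))
    have := abs_nonneg (Real.log (v.1 (1 + ρ * z)))
    linarith
  simp only [← mul_sum, sum_add_distrib, sum_sub_distrib, sum_const, nsmul_eq_mul,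
    card_univ] at h1 h2
  linarith

lemma sum_placeLog_div {x y : F} (hx : x ≠ 0) (hy : y ≠ 0)
    (hx' : ∑ i, placeLog S x i = 0) (hy' : ∑ i, placeLog S y i = 0) :
    ∑ i, placeLog S (x / y) i = 0 := by
  rw [placeLog_div hx hy]
  simp [sum_sub_distrib, hx', hy']

lemma card_mul_log_two_le_of_three {α : F} {a b l : ℕ} (hab : a ≠ b)
    (hρ : (2 : ℚ) ≤ ((l : ℚ) - b) / ((a : ℚ) - b)) (ha : α + a ≠ 0) (hb : α + b ≠ 0)
    (hl : α + l ≠ 0) (hd : ∑ i, placeLog S ((a : F) - b) i = 0)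
    (hb' : ∑ i, placeLog S (α + b) i = 0) :
    Fintype.card (F →+* ℂ) * Real.log 2 ≤
      2 * (‖placeLog S (α + a) - placeLog S (α + b)‖ +
        ‖placeLog S (α + l) - placeLog S (α + b)‖) := by
  have hd0 : (a : F) - b ≠ 0 := sub_ne_zero.2 (by exact_mod_cast hab)
  have e1 : 1 + ((a : F) - b) / (α + b) = (α + a) / (α + b) := by field_simp; ring
  have e2 : 1 + ((((l : ℚ) - b) / ((a : ℚ) - b) : ℚ) : F) * (((a : F) - b) / (α + b)) =
      (α + l) / (α + b) := by
    push_cast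
    field_simp
    ring
  have := card_mul_log_two_le (S := S) hρ (div_ne_zero hd0 hb)
    (by rw [e1]; exact div_ne_zero ha hb) (by rw [e2]; exact div_ne_zero hl hb)
    (sum_placeLog_div hd0 hb hd hb')
  rwa [e1, e2, placeLog_div ha hb, placeLog_div hl hb] at this

lemma placeHeight_natCast_sub_le {a b M : ℕ} (hab : a ≠ b) (ha : a ≤ M) (hb : b ≤ M) :
    placeHeight S ((a : F) - b) ≤ Fintype.card (F →+* ℂ) * Real.log M := by
  rcases lt_or_gt_of_ne hab with h | h
  · have : (a : F) - b = - ((b - a : ℕ) : F) := by rw [Nat.cast_sub h.le]; ring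
    rw [this, placeHeight_neg]
    exact placeHeight_natCast_le (by omega) (by exact_mod_cast (by omega : b - a ≤ M))
  · have : (a : F) - b = ((a - b : ℕ) : F) := by rw [Nat.cast_sub h.le]
    rw [this]
    exact placeHeight_natCast_le (by omega) (by exact_mod_cast (by omega : a - b ≤ M))

lemma placeHeight_add_natCast_le {α : F} {a b c M : ℕ} (hab : a ≠ b) (haM : a ≤ M) (hbM : b ≤ M)
    (hcM : c ≤ M) (ha : α + a ≠ 0) (hb : α + b ≠ 0)
    (hd : ∑ i, placeLog S ((a : F) - b) i = 0) (ha' : ∑ i, placeLog S (α + a) i = 0)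
    (hb' : ∑ i, placeLog S (α + b) i = 0) :
    2 * placeHeight S (α + c) ≤ ‖placeLog S (α + a) - placeLog S (α + b)‖ +
      4 * (Fintype.card (F →+* ℂ) * (Real.log M + Real.log 2)) := by
  have hd0 : (a : F) - b ≠ 0 := sub_ne_zero.2 (by exact_mod_cast hab)
  set D : ℝ := ((Fintype.card (F →+* ℂ) : ℕ) : ℝ)
  have hlM : 0 ≤ D * Real.log M := mul_nonneg (by positivity) (Real.log_natCast_nonneg M)
  have hl2 : 0 ≤ D * Real.log 2 := mul_nonneg (by positivity) (Real.log_nonneg (by norm_num))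
  rw [← placeLog_div ha hb, norm_placeLog_eq_two_mul (sum_placeLog_div ha hb ha' hb')]
  have h1 := placeHeight_add_le (S := S) ((α + a) / (α + b)) (-1)
  rw [placeHeight_neg, placeHeight_one] at h1
  have e1 : (α + a) / (α + b) + -1 = ((a : F) - b) / (α + b) := by field_simp; ring
  rw [e1, ← placeHeight_inv (sum_placeLog_div hd0 hb hd hb')] at h1
  have h2 := placeHeight_mul_le (S := S) ((a : F) - b) (((a : F) - b) / (α + b))⁻¹
  have e2 : ((a : F) - b) * (((a : F) - b) / (α + b))⁻¹ = α + b := by field_simp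
  rw [e2] at h2
  have h3 := placeHeight_natCast_sub_le (F := F) (S := S) hab haM hbM
  have h4 : placeHeight S (α + c) ≤ placeHeight S (α + b) + D * Real.log M + D * Real.log 2 := by
    rcases eq_or_ne c b with rfl | h
    · linarith
    · have h5 := placeHeight_add_le (S := S) (α + b) ((c : F) - b)
      have e3 : α + b + ((c : F) - b) = α + c := by ring
      rw [e3] at h5
      have h6 := placeHeight_natCast_sub_le (F := F) (S := S) h hcM hbM
      linarith
  linarith

lemma exists_ratio_two_le {t : Finset ℕ} (ht : 3 ≤ #t) :
    ∃ a ∈ t, ∃ b ∈ t, ∃ l ∈ t, a ≠ b ∧ (2 : ℚ) ≤ ((l : ℚ) - b) / ((a : ℚ) - b) := by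
  obtain ⟨u, hu, hc⟩ := exists_subset_card_eq ht
  let e := u.orderEmbOfFin hc
  have h01 : e 0 < e 1 := e.strictMono (by decide)
  have h12 : e 1 < e 2 := e.strictMono (by decide)
  have hm : ∀ i, e i ∈ t := fun i => hu (orderEmbOfFin_mem u hc i)
  have q01 : ((e 0 : ℕ) : ℚ) < (e 1 : ℕ) := by exact_mod_cast h01
  have q12 : ((e 1 : ℕ) : ℚ) < (e 2 : ℕ) := by exact_mod_cast h12
  rcases le_total (2 * ((e 1 : ℚ) - e 0)) ((e 2 : ℚ) - e 0) with h | h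
  · refine ⟨e 1, hm 1, e 0, hm 0, e 2, hm 2, h01.ne', ?_⟩
    rw [le_div_iff₀ (by linarith)]
    exact h
  · refine ⟨e 1, hm 1, e 2, hm 2, e 0, hm 0, h12.ne, ?_⟩
    rw [le_div_iff_of_neg (by linarith)]
    linarith

lemma exists_linearIndepOn_subset {V : Type*} [AddCommGroup V] [Module ℝ V] (f : ℕ → V)
    (A : Finset ℕ) {R : ℕ} (hR : R ≤ Module.finrank ℝ (Submodule.span ℝ (f '' A))) :
    ∃ B ⊆ A, #B = R ∧ LinearIndepOn ℝ f (B : Set ℕ) := by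
  obtain ⟨b, hb, -, hspan, hli⟩ := exists_linearIndepOn_extension (linearIndepOn_empty ℝ f)
    (Set.empty_subset (A : Set ℕ))
  have hfin : b.Finite := A.finite_toSet.subset hb
  obtain ⟨C, rfl⟩ := hfin.exists_finset_coe
  have h1 : R ≤ #C := by
    refine hR.trans ?_
    classical
    have h2 : Submodule.span ℝ (f '' A) ≤ Submodule.span ℝ ((C.image f : Finset V) : Set V) := by
      rw [coe_image]
      exact Submodule.span_le.2 hspan
    exact (Submodule.finrank_mono h2).trans ((finrank_span_finset_le_card _).trans card_image_le)
  obtain ⟨B, hBC, hB⟩ := exists_subset_card_eq h1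
  exact ⟨B, hBC.trans (by exact_mod_cast hb), hB, hli.mono (by exact_mod_cast hBC)⟩

/-- Among sufficiently many translates `α + a` by integers `0 ≤ a ≤ M` of an algebraic number,
one finds `R` multiplicatively independent ones. -/
theorem exists_subset_prod_zpow_ne_one {α : F} {A : Finset ℕ} {M j R : ℕ} (hM : 2 ≤ M)
    (hA : ∀ a ∈ A, a ≤ M) (hα : ∀ a ∈ A, α + a ≠ 0) (hj : 200 * Real.log M ≤ 2 ^ j)
    (hcard : 3 * (5 ^ R) ^ j ≤ #A) :
    ∃ B ⊆ A, #B = R ∧ ∀ e : ℕ → ℤ, ∏ b ∈ B, (α + b) ^ e b = 1 → ∀ b ∈ B, e b = 0 := by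
  classical
  obtain ⟨S, hS⟩ := exists_sum_placeLog_eq_zero
    (A.image (fun a : ℕ => α + a) ∪ A.offDiag.image (fun x => (x.1 : F) - x.2)) (by
      intro x hx
      rw [mem_union, mem_image, mem_image] at hx
      rcases hx with ⟨a, ha, rfl⟩ | ⟨y, hy, rfl⟩
      · exact hα a ha
      · exact sub_ne_zero.2 (by exact_mod_cast (mem_offDiag.1 hy).2.2))
  have hS1 : ∀ a ∈ A, ∑ i, placeLog S (α + a) i = 0 := fun a ha =>
    hS _ (mem_union_left _ (mem_image_of_mem _ ha))
  have hS2 : ∀ a ∈ A, ∀ b ∈ A, a ≠ b → ∑ i, placeLog S ((a : F) - b) i = 0 :=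
    fun a ha b hb hab => hS _ (mem_union_right _ (mem_image.2
      ⟨(a, b), mem_offDiag.2 ⟨ha, hb, hab⟩, rfl⟩))
  set f : ℕ → PiLp 1 (fun _ : (F →+* ℂ) ⊕ S => ℝ) := fun a => placeLog S (α + a) with hf
  by_cases hR : R ≤ Module.finrank ℝ (Submodule.span ℝ (f '' A))
  · obtain ⟨B, hBA, hB, hli⟩ := exists_linearIndepOn_subset f A hR
    refine ⟨B, hBA, hB, fun e he b hb => ?_⟩
    have h1 := congrArg (placeLog S) he
    rw [placeLog_prod _ _ fun i hi => zpow_ne_zero _ (hα i (hBA hi)), placeLog_one] at h1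
    have h2 : ∑ b ∈ B, (e b : ℝ) • f b = 0 := by
      rw [← h1]
      exact sum_congr rfl fun i hi => (placeLog_zpow (hα i (hBA hi)) _).symm
    have := linearIndepOn_finset_iff.1 hli (fun b => (e b : ℝ)) h2 b hb
    exact_mod_cast this
  · exfalso
    push Not at hR
    have hpos : 0 < #A := lt_of_lt_of_le (by positivity) hcard
    obtain ⟨c, hcA, hc⟩ := exists_max_image A (fun a => ‖f a‖) (card_pos.1 hpos)
    set D : ℝ := ((Fintype.card (F →+* ℂ) : ℕ) : ℝ) with hD
    have hD1 : 0 < D := by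
      have : Nonempty (F →+* ℂ) := inferInstance
      have := Fintype.card_pos (α := F →+* ℂ)
      rw [hD]
      exact_mod_cast this
    set W := Submodule.span ℝ (f '' A) with hW
    let g : ℕ → W := fun a => if ha : a ∈ A then
      ⟨f a, Submodule.subset_span (Set.mem_image_of_mem f ha)⟩ else 0
    have hg : ∀ a ∈ A, (g a : PiLp 1 (fun _ : (F →+* ℂ) ⊕ S => ℝ)) = f a := by
      intro a ha
      simp only [g, dif_pos ha]
    set ρ : ℝ := ‖f c‖ + D with hρ
    have hρ0 : 0 < ρ := by positivity
    obtain ⟨t, htA, ht, x, hx⟩ := exists_cluster g hρ0 (s := A) (fun a ha => by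
      have h1 : ‖g a‖ = ‖f a‖ := by rw [← hg a ha]; rfl
      linarith [hc a ha]) j
    have ht3 : 3 ≤ #t := by
      by_contra h
      push Not at h
      have h1 : (5 ^ Module.finrank ℝ W) ^ j ≤ (5 ^ R) ^ j :=
        Nat.pow_le_pow_left (Nat.pow_le_pow_right (by norm_num) hR.le) _
      have h2 : (5 ^ Module.finrank ℝ W) ^ j * #t ≤ (5 ^ R) ^ j * 2 :=
        Nat.mul_le_mul h1 (by omega)
      have : 0 < (5 ^ R) ^ j := by positivity
      omega
    have hdiff : ∀ a ∈ t, ∀ b ∈ t, ‖f a - f b‖ ≤ 2 * ρ / 2 ^ j := by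
      intro a ha b hb
      have h1 : ‖f a - f b‖ = ‖g a - g b‖ := by
        rw [← hg a (htA ha), ← hg b (htA hb)]; rfl
      rw [h1, ← sub_sub_sub_cancel_right _ _ x]
      refine (norm_sub_le _ _).trans ?_
      rw [two_mul, add_div]
      exact add_le_add (hx a ha) (hx b hb)
    obtain ⟨a, ha, b, hb, l, hl, hab, hr⟩ := exists_ratio_two_le ht3
    have k1 := card_mul_log_two_le_of_three hab hr (hα a (htA ha)) (hα b (htA hb))
      (hα l (htA hl)) (hS2 a (htA ha) b (htA hb) hab) (hS1 b (htA hb))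
    have k2 := placeHeight_add_natCast_le (α := α) hab (hA a (htA ha)) (hA b (htA hb)) (hA c hcA)
      (hα a (htA ha)) (hα b (htA hb)) (hS2 a (htA ha) b (htA hb) hab) (hS1 a (htA ha))
      (hS1 b (htA hb))
    rw [← norm_placeLog_eq_two_mul (hS1 c hcA)] at k2
    have d1 := hdiff a ha b hb
    have d2 := hdiff l hl b hb
    simp only [hf] at d1 d2 hρ
    rw [← hD] at k1 k2
    have hL : Real.log 2 ≤ Real.log M := Real.log_le_log (by norm_num) (by exact_mod_cast hM)
    have hl2 := Real.log_two_gt_d9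
    set L := Real.log M
    have hL0 : 0 < L := by linarith
    have hs : 2 * ρ / 2 ^ j ≤ ρ / (100 * L) := by
      rw [div_le_div_iff₀ (by positivity) (by positivity)]
      nlinarith
    have hs0 : 100 * L * (ρ / (100 * L)) = ρ := by field_simp
    set s := ρ / (100 * L)
    have hs1 : 0 < s := by positivity
    have hDL : D * Real.log 2 ≤ D * L := by gcongr
    have hDl : D * 0.69 ≤ D * Real.log 2 := by gcongr; linarith
    have hsL : s * 0.69 ≤ s * L := by gcongr; linarith
    have h5 : ρ ≤ s + 4 * (D * (L + Real.log 2)) + D := by linarith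
    have h6 : D * L ≤ 6 * (s * L) := by nlinarith
    nlinarith

end Places

section Resultants

open Polynomial

lemma mahlerMeasure_le_of_forall_norm_le {p : ℂ[X]} {H : ℝ} (hH : 1 ≤ H)
    (h : ∀ z : ℂ, ‖z‖ = 1 → ‖p.eval z‖ ≤ H) : p.mahlerMeasure ≤ H := by
  by_cases hp : p = 0
  · simp [hp]; linarith
  have h1 : p.logMahlerMeasure ≤ Real.log H := by
    rw [logMahlerMeasure_def]
    refine Real.circleAverage_mono_on_of_le_circle ?_ ?_
    · exact (analyticOnNhd_id.aeval_polynomial p).meromorphicOn.circleIntegrable_log_norm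
    · intro z hz
      have hz1 : ‖z‖ = 1 := by simpa using hz
      rcases eq_or_lt_of_le (norm_nonneg (p.eval z)) with h0 | h0
      · rw [← h0, Real.log_zero]; exact Real.log_nonneg hH
      · exact Real.log_le_log h0 (h z hz1)
  rw [logMahlerMeasure_eq_log_MahlerMeasure] at h1
  exact (Real.log_le_log_iff (mahlerMeasure_pos_of_ne_zero hp) (by linarith)).1 h1

lemma abs_resultant_le {Q g P : ℤ[X]} (hQ : Q ≠ 0) (hg : g ∣ Q) {N : ℕ} (hQN : Q.natDegree ≤ N)
    (hPN : P.natDegree ≤ N) {H : ℝ} (hH : 1 ≤ H)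
    (hQH : ∀ z : ℂ, ‖aeval z Q‖ ≤ H * max 1 ‖z‖ ^ N)
    (hPH : ∀ z : ℂ, ‖aeval z P‖ ≤ H * max 1 ‖z‖ ^ N) :
    |((resultant g P : ℤ) : ℝ)| ≤ H ^ (2 * N) := by
  obtain ⟨h, rfl⟩ := hg
  have hg0 : g ≠ 0 := left_ne_zero_of_mul hQ
  have hh0 : h ≠ 0 := right_ne_zero_of_mul hQ
  have hinj : Function.Injective (Int.castRingHom ℂ) := Int.cast_injective
  set φ := Int.castRingHom ℂ with hφ
  have hlead : ∀ q : ℤ[X], q ≠ 0 → 1 ≤ ‖(q.map φ).leadingCoeff‖ := by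
    intro q hq
    rw [leadingCoeff_map_of_injective hinj]
    have : q.leadingCoeff ≠ 0 := leadingCoeff_ne_zero.2 hq
    simp only [φ, eq_intCast, Complex.norm_intCast]
    exact_mod_cast Int.one_le_abs this
  have hMg : (g.map φ).mahlerMeasure ≤ H := by
    have h1 : ((g * h).map φ).mahlerMeasure ≤ H := by
      refine mahlerMeasure_le_of_forall_norm_le hH fun z hz => ?_
      have := hQH z
      rw [hz, max_self, one_pow, mul_one] at this
      rwa [eval_map, hφ, ← algebraMap_int_eq, ← aeval_def]
    rw [Polynomial.map_mul, mahlerMeasure_mul] at h1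
    refine le_trans ?_ h1
    exact le_mul_of_one_le_right (mahlerMeasure_nonneg _)
      (one_le_mahlerMeasure_of_one_le_norm_leadingCoeff (hlead h hh0))
  have hdeg : g.natDegree ≤ N := by
    rw [natDegree_mul hg0 hh0] at hQN
    omega
  have e1 : ((resultant g P : ℤ) : ℂ) =
      (g.map φ).leadingCoeff ^ P.natDegree * ((g.map φ).roots.map (P.map φ).eval).prod := by
    rw [← resultant_eq_prod_eval (g.map φ) (P.map φ) P.natDegree natDegree_map_le
      (IsAlgClosed.splits _), natDegree_map_eq_of_injective hinj, resultant_map_map]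
    rfl
  have e2 : |((resultant g P : ℤ) : ℝ)| = ‖((resultant g P : ℤ) : ℂ)‖ := by
    rw [Complex.norm_intCast]
  rw [e2, e1, norm_mul, norm_pow]
  have h2 : ‖((g.map φ).roots.map (P.map φ).eval).prod‖ ≤
      ((g.map φ).roots.map fun z => H * max 1 ‖z‖ ^ N).prod := by
    rw [← normHom_apply, map_multiset_prod, Multiset.map_map]
    refine Multiset.prod_map_le_prod_map₀ _ _ (fun _ _ => by simp) fun z _ => ?_
    have := hPH z
    simpa [eval_map, hφ, ← algebraMap_int_eq, ← aeval_def] using this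
  rw [Multiset.prod_map_mul, Multiset.prod_map_pow, Multiset.map_const', Multiset.prod_replicate]
    at h2
  have hcard : Multiset.card (g.map φ).roots ≤ N :=
    (card_roots' _).trans (natDegree_map_le.trans hdeg)
  have h3 : 1 ≤ ‖(g.map φ).leadingCoeff‖ := hlead g hg0
  have h4 : 0 ≤ ((g.map φ).roots.map fun a => max 1 ‖a‖).prod :=
    zero_le_one.trans (one_le_prod_max_one_norm_roots _)
  calc _ ≤ ‖(g.map φ).leadingCoeff‖ ^ N *
        (H ^ N * ((g.map φ).roots.map fun a => max 1 ‖a‖).prod ^ N) := by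
        refine mul_le_mul (pow_le_pow_right₀ h3 hPN) (h2.trans ?_) (norm_nonneg _) (by positivity)
        exact mul_le_mul_of_nonneg_right (pow_le_pow_right₀ hH hcard) (pow_nonneg h4 _)
    _ = H ^ N * (g.map φ).mahlerMeasure ^ N := by
        rw [mahlerMeasure_eq_leadingCoeff_mul_prod_roots, mul_pow]; ring
    _ ≤ H ^ N * H ^ N := by
        have := mahlerMeasure_nonneg (g.map φ)
        gcongr
    _ = H ^ (2 * N) := by ring

lemma exists_factor_of_dvd_eval {Q : ℤ[X]} {p : ℕ} (hp : p.Prime) {t : ℤ}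
    (hQ : Q.map (Int.castRingHom (ZMod p)) ≠ 0) (ht : (p : ℤ) ∣ Q.eval t) :
    ∃ g ∈ UniqueFactorizationMonoid.normalizedFactors Q, Irreducible g ∧ g ∣ Q ∧
      g.natDegree ≠ 0 ∧ (p : ℤ) ∣ g.eval t := by
  have hQ0 : Q ≠ 0 := by rintro rfl; simp at hQ
  have hp' : Prime (p : ℤ) := Nat.prime_iff_prime_int.1 hp
  have h1 := UniqueFactorizationMonoid.prod_normalizedFactors hQ0
  have h2 : (p : ℤ) ∣ (UniqueFactorizationMonoid.normalizedFactors Q).prod.eval t := by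
    refine ht.trans ?_
    exact map_dvd (evalRingHom t) h1.symm.dvd
  rw [eval_multiset_prod] at h2
  obtain ⟨g, hg, hd⟩ := hp'.exists_mem_multiset_map_dvd h2
  have hgQ := UniqueFactorizationMonoid.dvd_of_mem_normalizedFactors hg
  refine ⟨g, hg, UniqueFactorizationMonoid.irreducible_of_normalized_factor g hg, hgQ, ?_, hd⟩
  intro h0
  rw [natDegree_eq_zero] at h0
  obtain ⟨x, rfl⟩ := h0
  apply hQ
  obtain ⟨h, rfl⟩ := hgQ
  rw [eval_C] at hd
  rw [Polynomial.map_mul, map_C, eq_intCast, (ZMod.intCast_zmod_eq_zero_iff_dvd _ _).2 hd]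
  simp

lemma card_filter_normalizedFactors_le {Q : ℤ[X]} (hQ : Q ≠ 0) :
    #{g ∈ (UniqueFactorizationMonoid.normalizedFactors Q).toFinset | g.natDegree ≠ 0} ≤
      Q.natDegree := by
  have h1 := UniqueFactorizationMonoid.prod_normalizedFactors hQ
  set s := UniqueFactorizationMonoid.normalizedFactors Q with hs
  have h0 : (0 : ℤ[X]) ∉ s := UniqueFactorizationMonoid.zero_notMem_normalizedFactors Q
  have h2 : Q.natDegree = (s.map natDegree).sum := by
    rw [← natDegree_multiset_prod s h0]
    exact (natDegree_eq_of_degree_eq (degree_eq_degree_of_associated h1)).symm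
  rw [h2]
  calc _ = ∑ g ∈ s.toFinset with g.natDegree ≠ 0, 1 := by simp
    _ ≤ ∑ g ∈ s.toFinset with g.natDegree ≠ 0, s.count g * g.natDegree := by
        refine sum_le_sum fun g hg => ?_
        rw [mem_filter, Multiset.mem_toFinset] at hg
        exact Nat.mul_pos (Multiset.count_pos.2 hg.1) (Nat.pos_of_ne_zero hg.2)
    _ ≤ ∑ g ∈ s.toFinset, s.count g * g.natDegree :=
        sum_le_sum_of_subset (filter_subset _ _)
    _ = (s.map natDegree).sum := by
        rw [sum_multiset_map_count]
        simp

lemma dvd_resultant_of_dvd_eval {g P : ℤ[X]} (hg : g.natDegree ≠ 0) {p t : ℤ}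
    (h1 : p ∣ g.eval t) (h2 : p ∣ P.eval t) : p ∣ resultant g P := by
  obtain ⟨u, v, -, -, h⟩ := exists_mul_add_mul_eq_C_resultant g P le_rfl le_rfl (Or.inl hg)
  have := congrArg (eval t) h
  rw [eval_add, eval_mul, eval_mul, eval_C] at this
  rw [← this]
  exact dvd_add (h1.mul_right _) (h2.mul_right _)

lemma irreducible_map_of_natDegree_ne_zero {g : ℤ[X]} (hg : Irreducible g)
    (hd : g.natDegree ≠ 0) : Irreducible (g.map (Int.castRingHom ℚ)) :=
  (IsPrimitive.Int.irreducible_iff_irreducible_map_cast (hg.isPrimitive hd)).1 hg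

lemma resultant_ne_zero_of_aeval_root_ne_zero {g P : ℤ[X]}
    (hg : Irreducible (g.map (Int.castRingHom ℚ)))
    (h : aeval (AdjoinRoot.root (g.map (Int.castRingHom ℚ))) P ≠ 0) : resultant g P ≠ 0 := by
  have hinj : Function.Injective (Int.castRingHom ℚ) := Int.cast_injective
  have h1 : IsCoprime (g.map (Int.castRingHom ℚ)) (P.map (Int.castRingHom ℚ)) := by
    rw [hg.coprime_iff_not_dvd, ← AdjoinRoot.mk_eq_zero, ← AdjoinRoot.aeval_eq]
    rwa [← algebraMap_int_eq, aeval_map_algebraMap]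
  have h2 := resultant_ne_zero _ _ h1
  rw [natDegree_map_eq_of_injective hinj, natDegree_map_eq_of_injective hinj,
    resultant_map_map] at h2
  intro h3
  rw [h3] at h2
  simp at h2

end Resultants

section Relations

open Polynomial

variable {R : ℕ}

lemma prod_zpow_eq_one_iff {K : Type*} [Field K] {x : Fin R → K} (hx : ∀ i, x i ≠ 0)
    (c : Fin R → ℤ) :
    ∏ i, x i ^ c i = 1 ↔ ∏ i, x i ^ (c i).toNat - ∏ i, x i ^ (-c i).toNat = 0 := by
  have h : ∏ i, x i ^ c i = (∏ i, x i ^ (c i).toNat) / ∏ i, x i ^ (-c i).toNat := by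
    rw [← prod_div_distrib]
    refine prod_congr rfl fun i _ => ?_
    conv_lhs => rw [← Int.toNat_sub_toNat_neg (c i)]
    rw [zpow_sub₀ (hx i), zpow_natCast, zpow_natCast]
  rw [h, div_eq_one_iff_eq (prod_ne_zero_iff.2 fun i _ => pow_ne_zero _ (hx i)), sub_eq_zero]

/-- The integer polynomial expressing the multiplicative relation `∏ (x + b i) ^ c i = 1`. -/
noncomputable def relPoly (b : Fin R → ℕ) (c : Fin R → ℤ) : ℤ[X] :=
  ∏ i, (X + (b i : ℤ[X])) ^ (c i).toNat - ∏ i, (X + (b i : ℤ[X])) ^ (-c i).toNat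

lemma aeval_relPoly {K : Type*} [CommRing K] (b : Fin R → ℕ) (c : Fin R → ℤ) (x : K) :
    aeval x (relPoly b c) = ∏ i, (x + b i) ^ (c i).toNat - ∏ i, (x + b i) ^ (-c i).toNat := by
  simp [relPoly, map_prod]

lemma prod_X_add_C_pow_injective {K : Type*} [Field K] {x : Fin R → K}
    (hx : Function.Injective x) {k l : Fin R → ℕ}
    (h : ∏ i, (X + C (x i)) ^ k i = ∏ i, (X + C (x i)) ^ l i) : k = l := by
  classical
  have key : ∀ (k : Fin R → ℕ) (j : Fin R),
      (∏ i, (X + C (x i)) ^ k i : K[X]).roots.count (-x j) = k j := by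
    intro k j
    rw [roots_prod _ _ (prod_ne_zero_iff.2 fun i _ => pow_ne_zero _ (X_add_C_ne_zero _)),
      Multiset.count_bind]
    simp only [roots_pow, roots_X_add_C, Multiset.count_nsmul, Multiset.count_singleton]
    change ∑ i, _ = _
    rw [sum_eq_single j]
    · simp
    · intro i _ hij
      rw [if_neg, mul_zero]
      intro he
      exact hij (hx (neg_injective he)).symm
    · simp
  funext j
  rw [← key k j, ← key l j, h]

lemma relPoly_map_ne_zero {p : ℕ} (hp : p.Prime) {b : Fin R → ℕ} (hb : Function.Injective b)
    (hbp : ∀ i, b i < p) {c : Fin R → ℤ} (hc : c ≠ 0) :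
    (relPoly b c).map (Int.castRingHom (ZMod p)) ≠ 0 := by
  have := Fact.mk hp
  intro h
  apply hc
  have h1 : (relPoly b c).map (Int.castRingHom (ZMod p)) =
      ∏ i, (X + C ((b i : ℕ) : ZMod p)) ^ (c i).toNat -
        ∏ i, (X + C ((b i : ℕ) : ZMod p)) ^ (-c i).toNat := by
    simp [relPoly, Polynomial.map_prod]
  rw [h1, sub_eq_zero] at h
  have hinj : Function.Injective fun i => ((b i : ℕ) : ZMod p) := by
    intro i j hij
    apply hb
    simp only [ZMod.natCast_eq_natCast_iff] at hij
    exact Nat.ModEq.eq_of_lt_of_lt hij (hbp i) (hbp j)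
  have h2 := prod_X_add_C_pow_injective hinj h
  funext i
  have := congrFun h2 i
  simp only [Pi.zero_apply]
  omega

lemma sum_toNat_le {c : Fin R → ℤ} {n : ℕ} (hc : ∀ i, c i ≤ n) :
    ∑ i, (c i).toNat ≤ R * n := by
  calc ∑ i, (c i).toNat ≤ ∑ _i : Fin R, n := sum_le_sum fun i _ => by have := hc i; omega
    _ = R * n := by simp

lemma natDegree_relPoly_le {b : Fin R → ℕ} {c : Fin R → ℤ} {n : ℕ} (hc : ∀ i, |c i| ≤ n) :
    (relPoly b c).natDegree ≤ R * n := by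
  have key : ∀ d : Fin R → ℤ, (∀ i, d i ≤ n) →
      (∏ i, (X + (b i : ℤ[X])) ^ (d i).toNat).natDegree ≤ R * n := by
    intro d hd
    refine (natDegree_prod_le _ _).trans (le_trans (sum_le_sum fun i _ => ?_) (sum_toNat_le hd))
    refine natDegree_pow_le.trans ?_
    have : (X + (b i : ℤ[X])).natDegree = 1 := by
      rw [← C_eq_natCast]
      exact natDegree_X_add_C _
    rw [this, mul_one]
  rw [← max_self (R * n)]
  exact natDegree_sub_le_of_le (key c fun i => (abs_le.1 (hc i)).2)
    (key (-c) fun i => by have := (abs_le.1 (hc i)).1; simp only [Pi.neg_apply]; omega)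

lemma norm_aeval_relPoly_le {b : Fin R → ℕ} {c : Fin R → ℤ} {n M : ℕ} (hc : ∀ i, |c i| ≤ n)
    (hb : ∀ i, b i ≤ M) (z : ℂ) :
    ‖aeval z (relPoly b c)‖ ≤ 2 * ((M : ℝ) + 1) ^ (R * n) * max 1 ‖z‖ ^ (R * n) := by
  have hz : (1 : ℝ) ≤ max 1 ‖z‖ := le_max_left _ _
  have hM : (1 : ℝ) ≤ ((M : ℝ) + 1) * max 1 ‖z‖ := by
    have : (0 : ℝ) ≤ M := by positivity
    nlinarith
  have key : ∀ d : Fin R → ℤ, (∀ i, d i ≤ n) →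
      ‖∏ i, (z + b i) ^ (d i).toNat‖ ≤ (((M : ℝ) + 1) * max 1 ‖z‖) ^ (R * n) := by
    intro d hd
    rw [norm_prod]
    calc ∏ i, ‖(z + b i) ^ (d i).toNat‖
        ≤ ∏ i, (((M : ℝ) + 1) * max 1 ‖z‖) ^ (d i).toNat := by
          refine prod_le_prod (fun _ _ => norm_nonneg _) fun i _ => ?_
          rw [norm_pow]
          refine pow_le_pow_left₀ (norm_nonneg _) ?_ _
          refine (norm_add_le _ _).trans ?_
          have h1 : ‖z‖ ≤ max 1 ‖z‖ := le_max_right _ _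
          have h2 : ((b i : ℕ) : ℝ) ≤ M := by exact_mod_cast hb i
          rw [Complex.norm_natCast]
          have : (0 : ℝ) ≤ M := by positivity
          nlinarith
      _ = (((M : ℝ) + 1) * max 1 ‖z‖) ^ (∑ i, (d i).toNat) := prod_pow_eq_pow_sum _ _ _
      _ ≤ _ := pow_le_pow_right₀ hM (sum_toNat_le hd)
  rw [aeval_relPoly]
  refine (norm_sub_le _ _).trans ?_
  have h1 := key c fun i => (abs_le.1 (hc i)).2
  have h2 := key (-c) fun i => by
    have := (abs_le.1 (hc i)).1; simp only [Pi.neg_apply]; omega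
  simp only [Pi.neg_apply] at h2
  rw [mul_pow] at h1 h2
  linarith

lemma exists_prod_zpow_eq_one {K : Type*} [Field K] {D n : ℕ} (hD : 0 < D)
    (hDn : D < (n + 1) ^ R) {x : Fin R → K} (hx : ∀ i, x i ^ D = 1) :
    ∃ c : Fin R → ℤ, c ≠ 0 ∧ (∀ i, |c i| ≤ n) ∧ ∏ i, x i ^ c i = 1 := by
  classical
  have hx0 : ∀ i, x i ≠ 0 := by
    intro i h
    have := hx i
    rw [h, zero_pow hD.ne'] at this
    exact zero_ne_one this
  obtain ⟨k, -, l, -, hkl, h⟩ := exists_ne_map_eq_of_card_lt_of_maps_to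
    (s := (univ : Finset (Fin R → Fin (n + 1)))) (t := nthRootsFinset D (1 : K))
    (f := fun k => ∏ i, x i ^ (k i : ℕ)) (by
      refine lt_of_le_of_lt ?_ (lt_of_lt_of_eq hDn (by simp))
      rw [nthRootsFinset_def]
      exact (Multiset.toFinset_card_le _).trans (card_nthRoots _ _)) (by
      intro k _
      simp only [mem_coe, mem_nthRootsFinset hD]
      rw [← prod_pow]
      refine prod_eq_one fun i _ => ?_
      rw [← pow_mul, mul_comm, pow_mul, hx, one_pow])
  refine ⟨fun i => (k i : ℤ) - (l i : ℤ), ?_, fun i => ?_, ?_⟩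
  · intro h0
    apply hkl
    funext i
    have := congrFun h0 i
    simp only [Pi.zero_apply] at this
    omega
  · have := (k i).2
    have := (l i).2
    simp only [abs_le]
    omega
  · have e : ∀ i, x i ^ ((k i : ℤ) - (l i : ℤ)) = x i ^ (k i : ℕ) / x i ^ (l i : ℕ) := fun i => by
      rw [zpow_sub₀ (hx0 i), zpow_natCast, zpow_natCast]
    simp only [e]
    rw [prod_div_distrib, h]
    exact div_self (prod_ne_zero_iff.2 fun i _ => pow_ne_zero _ (hx0 i))

lemma exists_relPoly_dvd_eval {p : ℕ} (hp : p.Prime) {D n : ℕ} (hD : 0 < D)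
    (hDn : D < (n + 1) ^ R) {t : ℤ} {b : Fin R → ℕ} (hb : ∀ i, ((t + b i : ℤ) : ZMod p) ^ D = 1) :
    ∃ c : Fin R → ℤ, c ≠ 0 ∧ (∀ i, |c i| ≤ n) ∧ (p : ℤ) ∣ (relPoly b c).eval t := by
  have := Fact.mk hp
  obtain ⟨c, hc0, hc, h⟩ := exists_prod_zpow_eq_one hD hDn hb
  refine ⟨c, hc0, hc, ?_⟩
  rw [prod_zpow_eq_one_iff] at h
  · rw [← ZMod.intCast_zmod_eq_zero_iff_dvd, ← coe_aeval_eq_eval, aeval_relPoly]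
    push_cast at h ⊢
    exact h
  · intro i h0
    have := hb i
    rw [h0, zero_pow hD.ne'] at this
    exact zero_ne_one this

lemma exists_injective_prod_zpow_ne_one {F : Type*} [Field F] [NumberField F] {α : F}
    {A : Finset ℕ} {M j : ℕ} (hM : 2 ≤ M) (hA : ∀ a ∈ A, a ≤ M) (hα : ∀ a ∈ A, α + a ≠ 0)
    (hj : 200 * Real.log M ≤ 2 ^ j) (hcard : 3 * (5 ^ R) ^ j ≤ #A) :
    ∃ b : Fin R → ℕ, Function.Injective b ∧ (∀ i, b i ∈ A) ∧
      ∀ c : Fin R → ℤ, ∏ i, (α + b i) ^ c i = 1 → c = 0 := by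
  obtain ⟨B, hBA, hB, h⟩ := exists_subset_prod_zpow_ne_one hM hA hα hj hcard
  let e := B.equivFinOfCardEq hB
  refine ⟨fun i => (e.symm i : ℕ), fun i k hik => e.symm.injective (Subtype.ext hik),
    fun i => hBA (e.symm i).2, fun c hc => ?_⟩
  have h1 := h (fun x => if hx : x ∈ B then c (e ⟨x, hx⟩) else 0) (by
    rw [← prod_coe_sort, ← hc, ← e.symm.prod_comp]
    refine prod_congr rfl fun i _ => ?_
    simp)
  funext i
  have := h1 _ (e.symm i).2
  simpa using this

end Relations

section Counting

open Polynomial UniqueFactorizationMonoid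

/-- The pairs `(b, c)` of base points and exponents defining the relations under consideration. -/
noncomputable def relIndex (R M n : ℕ) : Finset ((Fin R → ℕ) × (Fin R → ℤ)) :=
  (Fintype.piFinset fun _ => range (M + 1)) ×ˢ Fintype.piFinset fun _ => Icc (-(n : ℤ)) n

lemma mem_relIndex {R M n : ℕ} {x : (Fin R → ℕ) × (Fin R → ℤ)} :
    x ∈ relIndex R M n ↔ (∀ i, x.1 i ≤ M) ∧ ∀ i, |x.2 i| ≤ n := by
  simp [relIndex, abs_le]

lemma card_relIndex (R M n : ℕ) : #(relIndex R M n) = (M + 1) ^ R * (2 * n + 1) ^ R := by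
  simp only [relIndex, card_product, Fintype.card_piFinset, card_range, Int.card_Icc, prod_const,
    card_univ, Fintype.card_fin]
  congr 2
  omega

/-- The nonconstant irreducible factors of an integer polynomial. -/
noncomputable def nonconstFactors (Q : ℤ[X]) : Finset ℤ[X] :=
  {g ∈ (normalizedFactors Q).toFinset | g.natDegree ≠ 0}

lemma exists_dvd_resultant {p : ℕ} (hp : p.Prime) {R M n j D : ℕ} (hM : 2 ≤ M) (hMp : M < p)
    (hD : 0 < D) (hDn : D < (n + 1) ^ R) {A : Finset ℕ} (hA : ∀ a ∈ A, a ≤ M)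
    (hj : 200 * Real.log M ≤ 2 ^ j) (hcard : 3 * (5 ^ R) ^ j < #A) {t : ℤ}
    (ht : ∀ a ∈ A, ((t + a : ℤ) : ZMod p) ^ D = 1) :
    ∃ x ∈ relIndex R M n, ∃ g ∈ nonconstFactors (relPoly x.1 x.2), ∃ y ∈ relIndex R M n,
      resultant g (relPoly y.1 y.2) ≠ 0 ∧ (p : ℤ) ∣ resultant g (relPoly y.1 y.2) := by
  classical
  obtain ⟨b, hb, hbA, -⟩ := exists_injective_prod_zpow_ne_one (F := ℚ) (α := 1) (R := R) hM hA
    (fun a _ => by positivity) hj hcard.le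
  obtain ⟨c, hc0, hc, hdvd⟩ := exists_relPoly_dvd_eval hp hD hDn fun i => ht _ (hbA i)
  have hne := relPoly_map_ne_zero hp hb (fun i => (hA _ (hbA i)).trans_lt hMp) hc0
  obtain ⟨g, hg, hirr, -, hdeg, hgt⟩ := exists_factor_of_dvd_eval hp hne hdvd
  have hirr' := irreducible_map_of_natDegree_ne_zero hirr hdeg
  have := Fact.mk hirr'
  set α := AdjoinRoot.root (g.map (Int.castRingHom ℚ)) with hα
  have hcard' : 3 * (5 ^ R) ^ j ≤ #(A.filter fun a : ℕ => α + a ≠ 0) := by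
    have h1 : #(A.filter fun a : ℕ => ¬ α + a ≠ 0) ≤ 1 := by
      rw [card_le_one]
      intro a ha a' ha'
      simp only [mem_filter, not_not] at ha ha'
      have h2 := ha.2.trans ha'.2.symm
      exact_mod_cast add_left_cancel h2
    have h2 := card_filter_add_card_filter_not (s := A)
      (p := fun a : ℕ => α + a ≠ 0)
    omega
  obtain ⟨b', -, hbA', hind⟩ := exists_injective_prod_zpow_ne_one (α := α) (R := R) hM
    (fun a ha => hA a (filter_subset _ _ ha)) (fun a ha => (mem_filter.1 ha).2) hj hcard'
  have hbA'' : ∀ i, b' i ∈ A := fun i => filter_subset _ _ (hbA' i)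
  obtain ⟨c', hc0', hc', hdvd'⟩ := exists_relPoly_dvd_eval hp hD hDn fun i => ht _ (hbA'' i)
  refine ⟨(b, c), mem_relIndex.2 ⟨fun i => hA _ (hbA i), hc⟩, g, ?_,
    (b', c'), mem_relIndex.2 ⟨fun i => hA _ (hbA'' i), hc'⟩, ?_,
    dvd_resultant_of_dvd_eval hdeg hgt hdvd'⟩
  · exact mem_filter.2 ⟨Multiset.mem_toFinset.2 hg, hdeg⟩
  · refine resultant_ne_zero_of_aeval_root_ne_zero hirr' fun h => hc0' (hind c' ?_)
    exact (prod_zpow_eq_one_iff (fun i => (mem_filter.1 (hbA' i)).2) c').2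
      ((aeval_relPoly b' c' α).symm.trans h)

lemma card_primeFactors_le_of_le_two_pow {m k : ℕ} (h : m ≤ 2 ^ k) : #m.primeFactors ≤ k := by
  rcases eq_or_ne m 0 with rfl | hm
  · simp
  refine (Nat.pow_le_pow_iff_right (a := 2) (by norm_num)).1 (le_trans ?_ h)
  refine le_trans ?_ (Nat.le_of_dvd (Nat.pos_of_ne_zero hm) (Nat.prod_primeFactors_dvd m))
  rw [← prod_const]
  exact prod_le_prod' fun q hq => (Nat.prime_of_mem_primeFactors hq).two_le

lemma card_primeFactors_resultant_le {R M n : ℕ} {x y : (Fin R → ℕ) × (Fin R → ℤ)}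
    (hx : x ∈ relIndex R M n) (hy : y ∈ relIndex R M n) {g : ℤ[X]}
    (hg : g ∈ nonconstFactors (relPoly x.1 x.2)) :
    #(resultant g (relPoly y.1 y.2)).natAbs.primeFactors ≤
      (1 + M * (R * n)) * (2 * (R * n)) := by
  rw [mem_relIndex] at hx hy
  rw [nonconstFactors, mem_filter, Multiset.mem_toFinset] at hg
  have hQ : relPoly x.1 x.2 ≠ 0 := by
    intro h
    rw [h, normalizedFactors_zero] at hg
    simp at hg
  refine card_primeFactors_le_of_le_two_pow ?_
  have hM : (1 : ℝ) ≤ (M : ℝ) + 1 := by simp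
  have h1 := abs_resultant_le hQ (dvd_of_mem_normalizedFactors hg.1)
    (natDegree_relPoly_le hx.2) (natDegree_relPoly_le hy.2)
    (H := 2 * ((M : ℝ) + 1) ^ (R * n)) (by have := one_le_pow₀ hM (n := R * n); linarith)
    (norm_aeval_relPoly_le hx.2 hx.1) (norm_aeval_relPoly_le hy.2 hy.1)
  have h2 : (((resultant g (relPoly y.1 y.2)).natAbs : ℕ) : ℝ) ≤
      ((2 ^ ((1 + M * (R * n)) * (2 * (R * n))) : ℕ) : ℝ) := by
    rw [Nat.cast_natAbs, Int.cast_abs]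
    refine h1.trans ?_
    push_cast
    rw [pow_mul 2 (1 + M * (R * n)), pow_add, pow_one, pow_mul 2 M]
    have h3 : (M : ℝ) + 1 ≤ 2 ^ M := by exact_mod_cast Nat.lt_two_pow_self
    gcongr
  exact_mod_cast h2

lemma card_nonconstFactors_relPoly_le {R M n : ℕ} {x : (Fin R → ℕ) × (Fin R → ℤ)}
    (hx : x ∈ relIndex R M n) : #(nonconstFactors (relPoly x.1 x.2)) ≤ R * n := by
  by_cases hQ : relPoly x.1 x.2 = 0
  · simp [nonconstFactors, hQ]
  · exact (card_filter_normalizedFactors_le hQ).trans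
      (natDegree_relPoly_le (mem_relIndex.1 hx).2)

open Classical in
/-- There are few primes `p` for which many elements of an interval of bounded length lie in a
small subgroup of the multiplicative group modulo `p`. -/
theorem card_many_small_order_le {R M n j N : ℕ} (hM : 2 ≤ M) (hj : 200 * Real.log M ≤ 2 ^ j) :
    #{p ∈ N.primesLE | M < p ∧ ∃ t : ℤ, ∃ D : ℕ, 0 < D ∧ D < (n + 1) ^ R ∧ ∃ A : Finset ℕ,
      (∀ a ∈ A, a ≤ M) ∧ 3 * (5 ^ R) ^ j < #A ∧ ∀ a ∈ A, ((t + a : ℤ) : ZMod p) ^ D = 1} ≤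
      ((M + 1) ^ R * (2 * n + 1) ^ R) * ((R * n) * (((M + 1) ^ R * (2 * n + 1) ^ R) *
        ((1 + M * (R * n)) * (2 * (R * n))))) := by
  rw [← card_relIndex]
  refine (card_le_card (t := (relIndex R M n).biUnion fun x =>
    (nonconstFactors (relPoly x.1 x.2)).biUnion fun g => (relIndex R M n).biUnion fun y =>
      (resultant g (relPoly y.1 y.2)).natAbs.primeFactors) ?_).trans ?_
  · intro p hp
    rw [mem_filter, Nat.mem_primesLE] at hp
    obtain ⟨⟨-, hp⟩, hMp, t, D, hD, hDn, A, hA, hcard, ht⟩ := hp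
    obtain ⟨x, hx, g, hg, y, hy, hne, hdvd⟩ :=
      exists_dvd_resultant hp hM hMp hD hDn hA hj hcard ht
    simp only [mem_biUnion]
    exact ⟨x, hx, g, hg, y, hy, Nat.mem_primeFactors.2
      ⟨hp, Int.natCast_dvd.1 hdvd, Int.natAbs_ne_zero.2 hne⟩⟩
  · refine card_biUnion_le_card_mul _ _ _ fun x hx => ?_
    refine (card_biUnion_le_card_mul _ _ _ fun g hg => card_biUnion_le_card_mul _ _ _ fun y hy =>
      card_primeFactors_resultant_le hx hy hg).trans ?_
    exact Nat.mul_le_mul_right _ (card_nonconstFactors_relPoly_le hx)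

end Counting

lemma exists_log_le_two_pow (R K : ℕ) :
    ∃ j : ℕ, 200 * Real.log ((K * (3 * (5 ^ R) ^ j + 1) + 2 : ℕ) : ℝ) ≤ 2 ^ j := by
  set c := Real.log (4 * K + 2) + R * Real.log 5 with hc
  have hK : 0 < Real.log (4 * (K : ℝ) + 2) := Real.log_pos (by
    have : (0 : ℝ) ≤ K := by positivity
    linarith)
  have hR : 0 ≤ R * Real.log 5 := by positivity
  have hc0 : 0 < c := by positivity
  have h1 := (tendsto_pow_const_div_const_pow_of_one_lt 1 (r := (2 : ℝ)) (by norm_num)).eventually_lt_const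
    (show (0 : ℝ) < 1 / (200 * c) by positivity)
  obtain ⟨j, hj, hj1⟩ := (h1.and (eventually_ge_atTop 1)).exists
  refine ⟨j, ?_⟩
  rw [pow_one, div_lt_div_iff₀ (by positivity) (by positivity)] at hj
  have hj1' : (1 : ℝ) ≤ j := by exact_mod_cast hj1
  have h2 : Real.log ((K * (3 * (5 ^ R) ^ j + 1) + 2 : ℕ) : ℝ) ≤
      Real.log ((4 * K + 2) * (5 ^ R) ^ j) := by
    refine Real.log_le_log (by positivity) ?_
    push_cast
    have : (1 : ℝ) ≤ (5 ^ R) ^ j := one_le_pow₀ (one_le_pow₀ (by norm_num))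
    have : (0 : ℝ) ≤ K := by positivity
    nlinarith
  rw [Real.log_mul (by positivity) (by positivity), Real.log_pow, Real.log_pow] at h2
  have h3 : Real.log (4 * K + 2) ≤ j * Real.log (4 * K + 2) := le_mul_of_one_le_left hK.le hj1'
  have h4 : j * c = j * Real.log (4 * K + 2) + j * (R * Real.log 5) := by rw [hc]; ring
  nlinarith

open Classical in
/-- For `M` large enough, there are few primes `p ≤ T` for which a positive proportion of an
interval of length `M` lies in a subgroup of order at most `T ^ (1 / 2 - δ)` modulo `p`. -/
theorem exists_card_many_small_order_le {δ ε : ℝ} (hδ : 0 < δ) (hδ' : δ ≤ 1 / 4) (hε : 0 < ε)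
    (K : ℕ) : ∃ M : ℕ, 0 < M ∧ ∀ᶠ T : ℝ in atTop,
      ((#{p ∈ (⌊T⌋₊).primesLE | M < p ∧ ∃ t : ℤ, ∃ D : ℕ, 0 < D ∧ (D : ℝ) ≤ T ^ (1 / 2 - δ) ∧
        ∃ A : Finset ℕ, (∀ a ∈ A, a ≤ M) ∧ M ≤ K * #A ∧
          ∀ a ∈ A, ((t + a : ℤ) : ZMod p) ^ D = 1} : ℕ) : ℝ) ≤ ε * (T / Real.log T) := by
  set R : ℕ := ⌈3 / δ⌉₊ with hR
  have hRδ : 3 ≤ R * δ := by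
    have := Nat.le_ceil (3 / δ)
    rwa [div_le_iff₀ hδ] at this
  have hR0 : (0 : ℝ) < R := by
    by_contra h
    nlinarith
  obtain ⟨j, hj⟩ := exists_log_le_two_pow R K
  set M := K * (3 * (5 ^ R) ^ j + 1) + 2 with hM
  set s := (1 / 2 - δ) / R with hs
  have hs0 : 0 < s := div_pos (by linarith) hR0
  have hsR : s * R = 1 / 2 - δ := by rw [hs]; field_simp
  have hs1 : s * (2 * R + 3) < 1 := by
    have : s * 3 ≤ s * (R * δ) := by gcongr
    nlinarith
  set C : ℝ := (((M + 1) ^ R * 3 ^ R) * (R * (((M + 1) ^ R * 3 ^ R) * ((1 + M * R) * (2 * R)))))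
    with hC
  have hC0 : 0 < C := by positivity
  refine ⟨M, by omega, ?_⟩
  filter_upwards [eventually_rpow_le_div_log hs1 (show 0 < ε / C by positivity),
    eventually_ge_atTop 1] with T hT hT1
  set x := T ^ s with hx
  have hx1 : 1 ≤ x := Real.one_le_rpow hT1 hs0.le
  have hxR : x ^ R = T ^ (1 / 2 - δ) := by
    rw [hx, ← Real.rpow_natCast, ← Real.rpow_mul (by linarith), hsR]
  set n := ⌊x⌋₊ with hn
  have hnx : (n : ℝ) ≤ x := Nat.floor_le (by linarith)
  have h1 := card_many_small_order_le (R := R) (M := M) (n := n) (j := j) (N := ⌊T⌋₊)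
    (by omega) hj
  refine le_trans (Nat.cast_le.2 (le_trans (card_le_card ?_) h1)) ?_
  · intro p hp
    rw [mem_filter] at hp ⊢
    obtain ⟨hp, hMp, t, D, hD, hDT, A, hA, hcard, ht⟩ := hp
    refine ⟨hp, hMp, t, D, hD, ?_, A, hA, ?_, ht⟩
    · have h2 : (D : ℝ) < ((n : ℝ) + 1) ^ R := by
        refine (hDT.trans_eq hxR.symm).trans_lt ?_
        refine pow_lt_pow_left₀ (Nat.lt_floor_add_one x) (by linarith) ?_
        rintro h
        rw [h] at hR0
        simp at hR0
      exact_mod_cast h2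
    · by_contra h
      have : K * #A ≤ K * (3 * (5 ^ R) ^ j) := Nat.mul_le_mul_left _ (by omega)
      rw [hM, mul_add] at hcard
      omega
  · have e : C * x ^ (2 * R + 3) = ((M + 1) ^ R * (3 * x) ^ R) * ((R * x) *
        (((M + 1) ^ R * (3 * x) ^ R) * (((1 + M * R) * x) * (2 * (R * x))))) := by
      rw [hC, mul_pow]
      ring
    have hT2 : x ^ (2 * R + 3) ≤ ε / C * (T / Real.log T) := by
      refine le_trans (le_of_eq ?_) hT
      rw [hx, ← Real.rpow_natCast, ← Real.rpow_mul (by linarith)]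
      push_cast
      ring_nf
    have h3 : C * x ^ (2 * R + 3) ≤ ε * (T / Real.log T) := by
      calc C * x ^ (2 * R + 3) ≤ C * (ε / C * (T / Real.log T)) := by gcongr
        _ = _ := by field_simp
    refine le_trans ?_ h3
    rw [e]
    push_cast
    have h4 : 2 * (n : ℝ) + 1 ≤ 3 * x := by linarith
    have h5 : 1 + (M : ℝ) * (R * n) ≤ (1 + M * R) * x := by
      have : (M : ℝ) * (R * n) ≤ M * (R * x) := by gcongr
      nlinarith
    gcongr

lemma exists_common_exponent {p k M : ℕ} (hp : p.Prime) (hM : 0 < M) (hMp : M < p) {y X Z : ℝ}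
    {t : ℤ} (hk : #(largePrimes y (p - 1)) ≤ k)
    (hsq : ∀ q : ℕ, q.Prime → y < q → ¬ q ^ 2 ∣ p - 1)
    (hs : ∀ s : ℕ, s ∣ p - 1 → (∀ q : ℕ, q.Prime → q ∣ s → (q : ℝ) ≤ y) → (s : ℝ) ≤ X)
    (hord : ∀ a : ℕ, a ≤ M → ¬ (p : ℤ) ∣ t + a → (orderOf ((t + a : ℤ) : ZMod p) : ℝ) ≤ Z) :
    ∃ D : ℕ, 0 < D ∧ (D : ℝ) ≤ Z * X ∧ ∃ A : Finset ℕ, (∀ a ∈ A, a ≤ M) ∧ M ≤ 2 ^ k * #A ∧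
      ∀ a ∈ A, ((t + a : ℤ) : ZMod p) ^ D = 1 := by
  classical
  have := Fact.mk hp
  have hp1 : p - 1 ≠ 0 := by have := hp.two_le; omega
  set G := (range (M + 1)).filter fun a : ℕ => ¬ (p : ℤ) ∣ t + a with hG
  set o : ℕ → ℕ := fun a => orderOf ((t + a : ℤ) : ZMod p) with ho
  have hdvd : ∀ a ∈ G, o a ∣ p - 1 := by
    intro a ha
    refine ZMod.orderOf_dvd_card_sub_one ?_
    rw [Ne, ZMod.intCast_zmod_eq_zero_iff_dvd]
    exact (mem_filter.1 ha).2
  have hGM : M ≤ #G := by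
    have h1 : #((range (M + 1)).filter fun a : ℕ => ¬ ¬ (p : ℤ) ∣ t + a) ≤ 1 := by
      rw [card_le_one]
      intro a ha b hb
      simp only [mem_filter, not_not, mem_range] at ha hb
      have h2 : (p : ℤ) ∣ a - b := by
        have := dvd_sub ha.2 hb.2
        rwa [add_sub_add_left_eq_sub] at this
      have h3 := Int.eq_zero_of_abs_lt_dvd h2 (by rw [abs_lt]; omega)
      omega
    have h2 := card_filter_add_card_filter_not (s := range (M + 1))
      (p := fun a : ℕ => ¬ (p : ℤ) ∣ t + a)
    rw [card_range, ← hG] at h2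
    omega
  set P := (largePrimes y (p - 1)).powerset with hP
  have hmaps : ∀ a ∈ G, largePrimes y (o a) ∈ P := by
    intro a ha
    rw [hP, mem_powerset]
    intro q hq
    rw [mem_largePrimes] at hq ⊢
    exact ⟨hq.1, hq.2.1.trans (hdvd a ha), hp1, hq.2.2.2⟩
  obtain ⟨U, -, hU⟩ := exists_max_image P (fun U => #{a ∈ G | largePrimes y (o a) = U})
    ⟨∅, empty_mem_powerset _⟩
  set A := {a ∈ G | largePrimes y (o a) = U} with hA
  have hcard : M ≤ 2 ^ k * #A := by
    refine hGM.trans ?_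
    rw [card_eq_sum_card_fiberwise hmaps]
    refine (sum_le_card_nsmul _ _ _ hU).trans ?_
    rw [smul_eq_mul, hP, card_powerset]
    gcongr
    norm_num
  obtain ⟨s, hs1, hs2⟩ := exists_smooth_cofactor hp1 dvd_rfl hsq
  have hA0 : A.Nonempty := by
    rw [← card_pos]
    by_contra h
    have : #A = 0 := by omega
    rw [this] at hcard
    omega
  have hU' : ∀ a ∈ A, ∏ q ∈ largePrimes y (o a), q = ∏ q ∈ U, q := by
    intro a ha
    rw [(mem_filter.1 ha).2]
  have hs0 : s ≠ 0 := by
    rintro rfl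
    exact hp1 (by simpa using hs1)
  have hsX : (s : ℝ) ≤ X := hs s ⟨_, hs1.trans (mul_comm _ _)⟩ hs2
  obtain ⟨a₀, ha₀⟩ := hA0
  have ha₀G : a₀ ∈ G := filter_subset _ _ ha₀
  have ho₀ : o a₀ ≠ 0 := ne_zero_of_dvd_ne_zero hp1 (hdvd _ ha₀G)
  have hprod : ((∏ q ∈ U, q : ℕ) : ℝ) ≤ Z := by
    rw [← hU' a₀ ha₀]
    have h1 : a₀ ≤ M := by
      have := mem_range.1 (mem_filter.1 ha₀G).1
      omega
    refine le_trans ?_ (hord a₀ h1 (mem_filter.1 ha₀G).2)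
    exact_mod_cast Nat.le_of_dvd (Nat.pos_of_ne_zero ho₀) (prod_largePrimes_dvd y (o a₀))
  refine ⟨(∏ q ∈ U, q) * s, ?_, ?_, A, ?_, hcard, ?_⟩
  · refine Nat.mul_pos ?_ (Nat.pos_of_ne_zero hs0)
    rw [← hU' a₀ ha₀]
    exact Nat.pos_of_ne_zero (ne_zero_of_dvd_ne_zero ho₀ (prod_largePrimes_dvd y _))
  · rw [Nat.cast_mul]
    exact mul_le_mul hprod hsX (Nat.cast_nonneg _) ((Nat.cast_nonneg _).trans hprod)
  · intro a ha
    have := mem_range.1 (mem_filter.1 (filter_subset _ _ ha : a ∈ G)).1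
    omega
  · intro a ha
    rw [← orderOf_dvd_iff_pow_eq_one]
    change o a ∣ _
    obtain ⟨r, hr1, hr2⟩ := exists_smooth_cofactor hp1 (hdvd a (filter_subset _ _ ha)) hsq
    rw [hU' a ha] at hr1
    rw [hr1]
    refine Nat.mul_dvd_mul_left _ ?_
    have h1 : r ∣ (∏ q ∈ largePrimes y (p - 1), q) * s := by
      rw [← hs1]
      exact (Dvd.intro_left _ hr1.symm).trans (hdvd a (filter_subset _ _ ha))
    refine Nat.Coprime.dvd_of_dvd_mul_left ?_ h1
    rw [Nat.coprime_prod_right_iff]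
    intro q hq
    rw [mem_largePrimes] at hq
    rw [Nat.coprime_comm, hq.1.coprime_iff_not_dvd]
    intro hqr
    exact absurd (hr2 q hq.1 hqr) (not_le.2 hq.2.2.2)

lemma card_largePrimes_rpow_le {T γ : ℝ} {n : ℕ} (hT : 1 < T) (hγ : 0 < γ) (hn : n ≠ 0)
    (hnT : (n : ℝ) ≤ T) : #(largePrimes (T ^ γ) n) ≤ ⌈1 / γ⌉₊ := by
  have h1 : (T ^ γ) ^ #(largePrimes (T ^ γ) n) ≤ T := by
    refine le_trans ?_ ((prod_natCast_largePrimes_le (y := T ^ γ) hn).trans hnT)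
    rw [← prod_const]
    exact prod_le_prod (fun _ _ => by positivity) fun q hq => (mem_largePrimes.1 hq).2.2.2.le
  rw [← Real.rpow_natCast, ← Real.rpow_mul (by linarith)] at h1
  replace h1 : T ^ (γ * (#(largePrimes (T ^ γ) n) : ℝ)) ≤ T ^ (1 : ℝ) := by
    rwa [Real.rpow_one]
  rw [Real.rpow_le_rpow_left_iff hT] at h1
  have h2 : (#(largePrimes (T ^ γ) n) : ℝ) ≤ ⌈1 / γ⌉₊ := by
    refine le_trans ?_ (Nat.le_ceil _)
    rw [le_div_iff₀ hγ]
    linarith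
  exact_mod_cast h2

lemma eventually_card_small_order_le {η m : ℝ → ℝ} (hη0 : Tendsto η atTop (nhds 0))
    (hmTop : Tendsto m atTop atTop) {ε : ℝ} (hε : 0 < ε) :
    ∀ᶠ T : ℝ in atTop, ∀ s : Finset ℕ, s ⊆ (⌊T⌋₊).primesLE →
      (∀ p ∈ s, ∃ t : ℤ, ∀ ξ : ℤ, t ≤ ξ → (ξ : ℝ) ≤ (t : ℝ) + m T → ¬ ((p : ℤ) ∣ ξ) →
        (orderOf ((ξ : ZMod p)) : ℝ) ≤ T ^ ((1 : ℝ) / 2 + η T)) →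
      (#s : ℝ) ≤ 5 * (ε * (T / Real.log T)) := by
  classical
  obtain ⟨δ₀, hδ₀, hdiv⟩ := exists_card_divisor_near_sqrt_le hε
  set δ := min δ₀ (1 / 4) with hδdef
  have hδ : 0 < δ := lt_min hδ₀ (by norm_num)
  have hδ1 : δ ≤ δ₀ := min_le_left _ _
  have hδ2 : δ ≤ 1 / 4 := min_le_right _ _
  set γ := min (1 / 3) (ε * δ / 1000) with hγdef
  have hγ : 0 < γ := lt_min (by norm_num) (by positivity)
  have hγ1 : γ ≤ 1 / 3 := min_le_left _ _
  have hγ2 : 500 * γ / (δ / 2) ≤ ε := by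
    have : γ ≤ ε * δ / 1000 := min_le_right _ _
    rw [div_le_iff₀ (by positivity)]
    linarith
  have hsmooth := eventually_card_smooth_divisor_le hγ hγ1 (show 0 < δ / 2 by positivity)
  obtain ⟨M, hM, halg⟩ := exists_card_many_small_order_le (δ := δ / 2) (by positivity)
    (by linarith) hε (2 ^ ⌈1 / γ⌉₊)
  have hM' : (0 : ℝ) < M := by exact_mod_cast hM
  filter_upwards [hdiv, hsmooth, halg, eventually_gt_atTop 1,
    eventually_rpow_le_div_log (show 1 - γ < 1 by linarith) (show 0 < ε / 2 by positivity),
    eventually_rpow_le_div_log (show (0 : ℝ) < 1 by norm_num) (show 0 < ε / M by positivity),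
    hη0.eventually_lt_const hδ, hmTop.eventually_ge_atTop (M : ℝ)]
    with T hdiv hsmooth halg hT1 hTγ hT0 hηT hmT s hsub hs
  have hT0' : 0 < T := by linarith
  have hlog : 0 < Real.log T := Real.log_pos hT1
  have hsq := card_sq_dvd_le hT1.le (show 0 < T ^ γ by positivity)
  have hsmall := card_primesLE_filter_le_le (n := ⌊T⌋₊) (X := M) (by positivity)
  have hcover : s ⊆ (((({p ∈ (⌊T⌋₊).primesLE | ∃ d : ℕ, d ∣ p - 1 ∧ T ^ (1 / 2 - δ₀) ≤ d ∧
        (d : ℝ) ≤ T ^ (1 / 2 + δ₀)}) ∪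
      {p ∈ (⌊T⌋₊).primesLE | ∃ s : ℕ, s ∣ p - 1 ∧
        (∀ q : ℕ, q.Prime → q ∣ s → (q : ℝ) ≤ T ^ γ) ∧ T ^ (δ / 2) < s}) ∪
      {p ∈ (⌊T⌋₊).primesLE | M < p ∧ ∃ t : ℤ, ∃ D : ℕ, 0 < D ∧ (D : ℝ) ≤ T ^ (1 / 2 - δ / 2) ∧
        ∃ A : Finset ℕ, (∀ a ∈ A, a ≤ M) ∧ M ≤ 2 ^ ⌈1 / γ⌉₊ * #A ∧
          ∀ a ∈ A, ((t + a : ℤ) : ZMod p) ^ D = 1}) ∪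
      {p ∈ (⌊T⌋₊).primesLE | ∃ q : ℕ, q.Prime ∧ T ^ γ < q ∧ q ^ 2 ∣ p - 1}) ∪
      (⌊T⌋₊).primesLE.filter fun p : ℕ => (p : ℝ) ≤ M := by
    intro p hp
    have hpT := hsub hp
    obtain ⟨hpT', hprime⟩ := Nat.mem_primesLE.1 hpT
    obtain ⟨t, ht⟩ := hs p hp
    simp only [mem_union, mem_filter, hpT, true_and]
    by_contra! h
    obtain ⟨⟨⟨⟨h1, h2⟩, h3⟩, h4⟩, h5⟩ := h
    have hMp : M < p := by exact_mod_cast h5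
    have := Fact.mk hprime
    have hp1 : p - 1 ≠ 0 := by have := hprime.two_le; omega
    have hpT2 : ((p - 1 : ℕ) : ℝ) ≤ T := by
      have : ((p - 1 : ℕ) : ℝ) ≤ (⌊T⌋₊ : ℝ) := by exact_mod_cast (Nat.sub_le p 1).trans hpT'
      exact this.trans (Nat.floor_le hT0'.le)
    have hord : ∀ a : ℕ, a ≤ M → ¬ (p : ℤ) ∣ t + a →
        (orderOf ((t + a : ℤ) : ZMod p) : ℝ) ≤ T ^ (1 / 2 - δ) := by
      intro a ha hpa
      have h6 := ht (t + a) (by omega) (by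
        push_cast
        have : (a : ℝ) ≤ M := by exact_mod_cast ha
        linarith) hpa
      have h7 : orderOf ((t + a : ℤ) : ZMod p) ∣ p - 1 := by
        refine ZMod.orderOf_dvd_card_sub_one ?_
        rwa [Ne, ZMod.intCast_zmod_eq_zero_iff_dvd]
      have h8 : T ^ (1 / 2 + η T) ≤ T ^ (1 / 2 + δ₀) :=
        Real.rpow_le_rpow_of_exponent_le hT1.le (by linarith)
      have h9 : T ^ (1 / 2 - δ₀) ≤ T ^ (1 / 2 - δ) :=
        Real.rpow_le_rpow_of_exponent_le hT1.le (by linarith)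
      by_contra! h10
      exact absurd (h6.trans h8) (not_le.2 (h1 _ h7 (h9.trans h10.le)))
    obtain ⟨D, hD, hDle, A, hA, hcard, hAD⟩ := exists_common_exponent hprime hM hMp
      (X := T ^ (δ / 2)) (card_largePrimes_rpow_le hT1 hγ hp1 hpT2)
      (fun q hq hyq hqp => h4 q hq hyq hqp) h2 hord
    rw [← Real.rpow_add hT0'] at hDle
    obtain ⟨a, ha, hne⟩ := h3 hMp t D hD (hDle.trans (le_of_eq (by ring_nf))) A hA hcard
    exact hne (hAD a ha)
  have hc := (card_le_card hcover).trans ((card_union_le _ _).trans (Nat.add_le_add_right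
    ((card_union_le _ _).trans (Nat.add_le_add_right ((card_union_le _ _).trans
      (Nat.add_le_add_right (card_union_le _ _) _)) _)) _))
  refine le_trans (Nat.cast_le.2 hc) ?_
  simp only [Nat.cast_add]
  have e1 : 500 * γ / (δ / 2) * (T / Real.log T) ≤ ε * (T / Real.log T) := by gcongr
  have e2 : 2 * (T / T ^ γ) ≤ ε * (T / Real.log T) := by
    rw [Real.rpow_sub hT0', Real.rpow_one] at hTγ
    linarith
  have e3 : (M : ℝ) ≤ ε * (T / Real.log T) := by
    rw [Real.rpow_zero, div_mul_eq_mul_div, le_div_iff₀ hM'] at hT0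
    linarith
  linarith

end OrderInIntervals

/-- Let `η, m : ℝ → ℝ` be positive functions with `η(z) → 0` and `m(z) → ∞` as
`z → ∞`. For every `ε > 0` there is `T₀` such that for every `T ≥ T₀`, the number of primes
`p ≤ T` for which some interval `[t, t + m(T)]` consists entirely of elements of multiplicative
order at most `T^{1/2+η(T)}` (among those not divisible by `p`) is at most `ε·π(T)`. -/
theorem stmt9 (η m : ℝ → ℝ) (hη : ∀ z, 0 < η z) (hm : ∀ z, 0 < m z)
    (hη0 : Filter.Tendsto η Filter.atTop (nhds 0))
    (hmTop : Filter.Tendsto m Filter.atTop Filter.atTop) :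
    ∀ ε : ℝ, 0 < ε → ∃ T₀ : ℝ, ∀ T : ℝ, T₀ ≤ T →
      (Set.ncard {p : ℕ | p.Prime ∧ (p : ℝ) ≤ T ∧
        ∃ t : ℤ, ∀ ξ : ℤ, t ≤ ξ → (ξ : ℝ) ≤ (t : ℝ) + m T → ¬ ((p : ℤ) ∣ ξ) →
          (orderOf ((ξ : ZMod p)) : ℝ) ≤ T ^ ((1 : ℝ) / 2 + η T)} : ℝ)
      ≤ ε * (Set.ncard {p : ℕ | p.Prime ∧ (p : ℝ) ≤ T} : ℝ) := by
  classical
  intro ε hε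
  have h := OrderInIntervals.eventually_card_small_order_le hη0 hmTop
    (show 0 < ε / 10 by positivity)
  obtain ⟨T₀, hT₀⟩ := Filter.eventually_atTop.1
    ((h.and OrderInIntervals.eventually_le_card_primesLE).and (Filter.eventually_gt_atTop 1))
  refine ⟨T₀, fun T hT => ?_⟩
  obtain ⟨⟨h1, h2⟩, hT1⟩ := hT₀ T hT
  have hmem : ∀ p : ℕ, p ∈ (⌊T⌋₊).primesLE ↔ p.Prime ∧ (p : ℝ) ≤ T := fun p => by
    rw [Nat.mem_primesLE, Nat.le_floor_iff (by linarith), and_comm]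
  have e1 : {p : ℕ | p.Prime ∧ (p : ℝ) ≤ T} = ((⌊T⌋₊).primesLE : Set ℕ) := by
    ext p
    simpa using (hmem p).symm
  have e2 : {p : ℕ | p.Prime ∧ (p : ℝ) ≤ T ∧
      ∃ t : ℤ, ∀ ξ : ℤ, t ≤ ξ → (ξ : ℝ) ≤ (t : ℝ) + m T → ¬ ((p : ℤ) ∣ ξ) →
        (orderOf ((ξ : ZMod p)) : ℝ) ≤ T ^ ((1 : ℝ) / 2 + η T)} =
      (((⌊T⌋₊).primesLE.filter fun p : ℕ =>
        ∃ t : ℤ, ∀ ξ : ℤ, t ≤ ξ → (ξ : ℝ) ≤ (t : ℝ) + m T → ¬ ((p : ℤ) ∣ ξ) →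
        (orderOf ((ξ : ZMod p)) : ℝ) ≤ T ^ ((1 : ℝ) / 2 + η T) : Finset ℕ) : Set ℕ) := by
    ext p
    rw [Finset.coe_filter]
    simp only [Set.mem_ofPred_eq, hmem, and_assoc]
  rw [e1, e2, Set.ncard_coe_finset, Set.ncard_coe_finset]
  refine (h1 _ (Finset.filter_subset _ _) fun p hp => (Finset.mem_filter.1 hp).2).trans ?_
  calc 5 * (ε / 10 * (T / Real.log T)) = ε * (T / (2 * Real.log T)) := by
        have := Real.log_pos hT1
        field_simp
        ring
    _ ≤ _ := by gcongr
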